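/- Let (A, τ) be a tracial probability space generated by a braidable sequence (xₙ)ₙ≥₀ via a representation ρ: B∞ → Aut(A, τ). Then the tail algebra of (xₙ), the fixed point algebra of ρ(B∞), and the fixed point algebra of the shift endomorphism α (with α(xₙ) = x_{n+1}) all coincide. -/

import Mathlib

/-- The braid relations on the free group over generators indexed by `ℕ+`. -/
def braidRels : Set (FreeGroup ℕ+) :=
  {w | ∃ i j : ℕ+, (i : ℕ) + 1 = (j : ℕ) ∧
      w = .of i * .of j * .of i * (.of j * .of i * .of j)⁻¹} ∪
  {w | ∃ i j : ℕ+, (i : ℕ) + 1 < (j : ℕ) ∧ w = .of i * .of j * (.of j * .of i)⁻¹}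

/-- The infinite braid group `B∞`. -/
abbrev BraidGroup : Type := PresentedGroup braidRels

/-- The Artin generator `σᵢ` of `B∞`. -/
def braidGen (i : ℕ+) : BraidGroup := PresentedGroup.of i

/-- The descending word `σₙ σₙ₋₁ ⋯ σ₁` (empty for `n = 0`). -/
def descWord : ℕ → BraidGroup
  | 0 => 1
  | n + 1 => braidGen n.succPNat * descWord n

/-- The von Neumann algebra generated by a set of bounded operators (double
commutant of the set together with its adjoints). -/
def genVN {H : Type} [NormedAddCommGroup H] [InnerProductSpace ℂ H] [CompleteSpace H]
    (S : Set (H →L[ℂ] H)) : Set (H →L[ℂ] H) :=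
  Set.centralizer (Set.centralizer (S ∪ star '' S))

open Filter Topology
open scoped InnerProductSpace ComplexOrder

set_option linter.all false

namespace TailProof

section res
variable {A : Type} [CStarAlgebra A] [PartialOrder A] [StarOrderedRing A]

/-- resolvent `(1+d)⁻¹`. -/
noncomputable def res (d : A) : A := Ring.inverse (1 + d)

lemma sp_one_add {d : A} (hd : 0 ≤ d) : IsStrictlyPositive (1 + d) :=
  IsStrictlyPositive.add_nonneg isStrictlyPositive_one hd

lemma unit_one_add {d : A} (hd : 0 ≤ d) : IsUnit (1 + d) := (sp_one_add hd).isUnit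

lemma res_mul {d : A} (hd : 0 ≤ d) : res d * (1 + d) = 1 :=
  Ring.inverse_mul_cancel _ (unit_one_add hd)

lemma mul_res {d : A} (hd : 0 ≤ d) : (1 + d) * res d = 1 :=
  Ring.mul_inverse_cancel _ (unit_one_add hd)

lemma res_anti {c d : A} (hc : 0 ≤ c) (h : c ≤ d) : res d ≤ res c :=
  CStarAlgebra.ringInverse_le_ringInverse (add_le_add_right h 1) (sp_one_add hc)

lemma res_zero : res (0 : A) = 1 := by simp [res]

lemma res_le_one {d : A} (hd : 0 ≤ d) : res d ≤ 1 := by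
  have := res_anti le_rfl hd
  rwa [res_zero] at this

lemma res_comm {c d : A} (hd : 0 ≤ d) (h : Commute c d) : Commute c (res d) := by
  have h1 : Commute c (1 + d) := (Commute.one_right c).add_right h
  have e1 : res d * ((1 + d) * c) * res d = res d * (c * (1 + d)) * res d := by rw [h1.eq]
  have e2 : res d * ((1 + d) * c) * res d = c * res d := by
    rw [← mul_assoc (res d), res_mul hd, one_mul]
  have e3 : res d * (c * (1 + d)) * res d = res d * c := by
    rw [mul_assoc, mul_assoc, mul_res hd, mul_one]
  exact e2.symm.trans (e1.trans e3)

lemma res_comm_self {d : A} (hd : 0 ≤ d) : Commute d (res d) := res_comm hd (Commute.refl d)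

lemma star_res {d : A} (hd : 0 ≤ d) : star (res d) = res d := by
  have hs : star d = d := (IsSelfAdjoint.of_nonneg hd).star_eq
  have h : star (res d) * (1 + d) = 1 := by
    have := congrArg star (mul_res hd)
    simpa [hs] using this
  calc star (res d) = star (res d) * ((1 + d) * res d) := by rw [mul_res hd, mul_one]
    _ = res d := by rw [← mul_assoc, h, one_mul]

lemma res_nonneg {d : A} (hd : 0 ≤ d) : 0 ≤ res d := by
  have : res d = star (res d) * (1 + d) * res d := by
    rw [mul_assoc, mul_res hd, mul_one, star_res hd]
  rw [this]
  exact star_left_conjugate_nonneg (sp_one_add hd).nonneg _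

lemma mul_res_eq {d : A} (hd : 0 ≤ d) : d * res d = 1 - res d := by
  have := mul_res hd
  rw [add_mul, one_mul] at this
  exact eq_sub_of_add_eq (by rw [add_comm]; exact this)

lemma one_sub_res_nonneg {d : A} (hd : 0 ≤ d) : 0 ≤ 1 - res d := sub_nonneg.2 (res_le_one hd)

lemma nonneg_mul_of_comm {a b : A} (ha : 0 ≤ a) (hb : 0 ≤ b) (h : Commute a b) : 0 ≤ a * b :=
  h.mul_nonneg ha hb

lemma one_sub_res_le {d : A} (hd : 0 ≤ d) : 1 - res d ≤ d := by
  rw [← mul_res_eq hd, ← sub_nonneg]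
  have : d - d * res d = d * (1 - res d) := by rw [mul_sub, mul_one]
  rw [this]
  exact nonneg_mul_of_comm hd (one_sub_res_nonneg hd)
    ((Commute.one_right d).sub_right (res_comm_self hd))

lemma sq_le_self_of_le_one {a : A} (h0 : 0 ≤ a) (h1 : a ≤ 1) : a * a ≤ a := by
  have := CStarAlgebra.pow_antitone h0 h1 (show 1 ≤ 2 by norm_num)
  simpa [pow_two] using this

lemma rsmul_nonneg {a : A} (c : ℝ) (hc : 0 ≤ c) (h : 0 ≤ a) : 0 ≤ c • a := smul_nonneg hc h

lemma norm_le_of_le_one {a : A} (h0 : 0 ≤ a) (h1 : a ≤ 1) : ‖a‖ ≤ 1 :=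
  (CStarAlgebra.norm_le_one_iff_of_nonneg a h0).2 h1

lemma le_norm_smul_one {a : A} (h : IsSelfAdjoint a) : a ≤ ‖a‖ • (1 : A) := by
  have := h.le_algebraMap_norm_self
  rwa [Algebra.algebraMap_eq_smul_one] at this

lemma neg_norm_smul_one_le {a : A} (h : IsSelfAdjoint a) : -(‖a‖ • (1 : A)) ≤ a := by
  have := h.neg_algebraMap_norm_le_self
  rwa [Algebra.algebraMap_eq_smul_one] at this

lemma norm_le_of_between {a : A} {r : ℝ} (hr : 0 ≤ r) (ha : IsSelfAdjoint a)
    (h1 : -(r • (1 : A)) ≤ a) (h2 : a ≤ r • (1 : A)) : ‖a‖ ≤ r := by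
  rcases subsingleton_or_nontrivial A with h | h
  · rw [Subsingleton.elim a 0, norm_zero]; exact hr
  rcases CStarAlgebra.norm_or_neg_norm_mem_spectrum (a := a) ha with h | h
  · have := (le_algebraMap_iff_spectrum_le (r := r) (a := a) ha).1
      (by rwa [Algebra.algebraMap_eq_smul_one]) _ h
    exact this
  · have := (algebraMap_le_iff_le_spectrum (r := -r) (a := a) ha).1
      (by rwa [Algebra.algebraMap_eq_smul_one, neg_smul]) _ h
    linarith

end res

/-- faithful representation with sequentially strongly closed range. -/
structure VNRep (A H : Type) [CStarAlgebra A] [PartialOrder A] [StarOrderedRing A]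
    [NormedAddCommGroup H] [InnerProductSpace ℂ H] [CompleteSpace H] where
  π : A →⋆ₐ[ℂ] (H →L[ℂ] H)
  inj : Function.Injective π
  closed : ∀ (a : ℕ → A) (C : ℝ), (∀ n, ‖a n‖ ≤ C) →
    (∀ ξ : H, ∃ η, Tendsto (fun n => π (a n) ξ) atTop (𝓝 η)) →
    ∃ b : A, ∀ ξ : H, Tendsto (fun n => π (a n) ξ) atTop (𝓝 (π b ξ))

section rep
variable {A H : Type} [CStarAlgebra A] [PartialOrder A] [StarOrderedRing A]
    [NormedAddCommGroup H] [InnerProductSpace ℂ H] [CompleteSpace H] (S : VNRep A H)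

namespace VNRep

lemma norm_le (a : A) (ξ : H) : ‖S.π a ξ‖ ≤ ‖a‖ * ‖ξ‖ :=
  (ContinuousLinearMap.le_opNorm _ _).trans
    (mul_le_mul_of_nonneg_right (NonUnitalStarAlgHom.norm_apply_le S.π a) (norm_nonneg _))

lemma mul_app (a b : A) (ξ : H) : S.π (a * b) ξ = S.π a (S.π b ξ) := by simp

lemma adj (a : A) (ξ η : H) : ⟪S.π a ξ, η⟫_ℂ = ⟪ξ, S.π (star a) η⟫_ℂ := by
  rw [map_star, ContinuousLinearMap.star_eq_adjoint, ContinuousLinearMap.adjoint_inner_right]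

/-- quadratic form -/
noncomputable def ev (a : A) (ξ : H) : ℝ := (⟪S.π a ξ, ξ⟫_ℂ).re

lemma ev_star_mul (a : A) (ξ : H) : S.ev (star a * a) ξ = ‖S.π a ξ‖ ^ 2 := by
  have h := S.adj (star a) (S.π a ξ) ξ
  rw [star_star] at h
  rw [ev, mul_app, h]
  exact (norm_sq_eq_re_inner (𝕜 := ℂ) _).symm

lemma ev_add (a b : A) (ξ : H) : S.ev (a + b) ξ = S.ev a ξ + S.ev b ξ := by
  simp [ev, inner_add_left]
lemma ev_sub (a b : A) (ξ : H) : S.ev (a - b) ξ = S.ev a ξ - S.ev b ξ := by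
  simp [ev, inner_sub_left]
lemma ev_smul (c : ℝ) (a : A) (ξ : H) : S.ev (c • a) ξ = c * S.ev a ξ := by
  have : c • a = (c : ℂ) • a := (Complex.coe_smul c a).symm
  rw [this, ev, map_smul, ContinuousLinearMap.smul_apply, inner_smul_left]
  simp [ev]
lemma ev_one (ξ : H) : S.ev 1 ξ = ‖ξ‖ ^ 2 := by
  simp [ev, ← Complex.ofReal_pow]

lemma ev_sum {ι : Type} (s : Finset ι) (f : ι → A) (ξ : H) :
    S.ev (∑ i ∈ s, f i) ξ = ∑ i ∈ s, S.ev (f i) ξ := by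
  simp [ev, sum_inner]

lemma ev_nonneg {a : A} (h : 0 ≤ a) (ξ : H) : 0 ≤ S.ev a ξ := by
  obtain ⟨b, rfl⟩ := CStarAlgebra.nonneg_iff_eq_star_mul_self.1 h
  rw [ev_star_mul]; positivity

lemma ev_mono {a b : A} (h : a ≤ b) (ξ : H) : S.ev a ξ ≤ S.ev b ξ := by
  have := S.ev_nonneg (sub_nonneg.2 h) ξ
  rw [ev_sub] at this; linarith

lemma ev_tendsto {a : ℕ → A} {b : A} {ξ : H}
    (h : Tendsto (fun n => S.π (a n) ξ) atTop (𝓝 (S.π b ξ))) :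
    Tendsto (fun n => S.ev (a n) ξ) atTop (𝓝 (S.ev b ξ)) := by
  unfold ev
  exact (Complex.continuous_re.tendsto _).comp (h.inner tendsto_const_nhds)

lemma ext' {a b : A} (h : ∀ ξ, S.π a ξ = S.π b ξ) : a = b :=
  S.inj (ContinuousLinearMap.ext h)

lemma eq_zero_of {a : A} (h : ∀ ξ, S.π a ξ = 0) : a = 0 :=
  S.ext' (fun ξ => by rw [h]; simp)

lemma nonneg_of_ev {a : A} (hs : IsSelfAdjoint a) (h : ∀ ξ, 0 ≤ S.ev a ξ) : 0 ≤ a := by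
  have hp : 0 ≤ a⁺ := CFC.posPart_nonneg a
  have hn : 0 ≤ a⁻ := CFC.negPart_nonneg a
  have hns : star a⁻ = a⁻ := (IsSelfAdjoint.of_nonneg hn).star_eq
  have e : a⁺ - a⁻ = a := CFC.posPart_sub_negPart a hs
  have h0 : a⁺ * a⁻ = 0 := CFC.posPart_mul_negPart a
  have key : star a⁻ * a * a⁻ = - (a⁻ * a⁻ * a⁻) := by
    nth_rewrite 2 [← e]
    rw [hns, mul_sub, sub_mul, mul_assoc _ a⁺, h0]; simp
  have h3 : 0 ≤ a⁻ * a⁻ * a⁻ := by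
    have := star_left_conjugate_nonneg hn a⁻
    rwa [hns] at this
  have hz : ∀ ξ, S.ev (a⁻ * a⁻ * a⁻) ξ = 0 := by
    intro ξ
    have h1 := S.ev_nonneg h3 ξ
    have h2 := h (S.π a⁻ ξ)
    have : S.ev (star a⁻ * a * a⁻) ξ = S.ev a (S.π a⁻ ξ) := by
      rw [ev, mul_app, mul_app, S.adj, star_star, ev]
    rw [key] at this
    have h4 : S.ev (-(a⁻ * a⁻ * a⁻)) ξ = - S.ev (a⁻ * a⁻ * a⁻) ξ := by
      have := S.ev_sub 0 (a⁻ * a⁻ * a⁻) ξ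
      simpa [ev] using this
    rw [h4] at this; linarith
  obtain ⟨b, hb⟩ := CStarAlgebra.nonneg_iff_eq_star_mul_self.1 h3
  have hb0 : b = 0 := S.eq_zero_of (fun ξ => by
    have := hz ξ
    rw [hb, ev_star_mul] at this
    simpa using this)
  have hc : a⁻ * a⁻ * a⁻ = 0 := by rw [hb, hb0]; simp
  have h4 : a⁻ * a⁻ = 0 := by
    have : star (a⁻ * a⁻) * (a⁻ * a⁻) = 0 := by
      rw [star_mul, hns, ← mul_assoc, hc, zero_mul]
    exact CStarRing.star_mul_self_eq_zero_iff _ |>.1 this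
  have h5 : a⁻ = 0 := by
    have : star (a⁻) * (a⁻) = 0 := by rw [hns, h4]
    exact CStarRing.star_mul_self_eq_zero_iff _ |>.1 this
  rw [← e, h5, sub_zero]; exact hp

lemma le_of_ev {a b : A} (ha : IsSelfAdjoint a) (hb : IsSelfAdjoint b)
    (h : ∀ ξ, S.ev a ξ ≤ S.ev b ξ) : a ≤ b := by
  rw [← sub_nonneg]
  refine S.nonneg_of_ev (hb.sub ha) (fun ξ => ?_)
  rw [ev_sub]; linarith [h ξ]

/-- strong convergence of a sequence -/
def SC (a : ℕ → A) (b : A) : Prop := ∀ ξ : H, Tendsto (fun n => S.π (a n) ξ) atTop (𝓝 (S.π b ξ))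

lemma SC.unique {a : ℕ → A} {b c : A} (h : S.SC a b) (h' : S.SC a c) : b = c :=
  S.ext' (fun ξ => tendsto_nhds_unique (h ξ) (h' ξ))

lemma SC.selfAdjoint {a : ℕ → A} {b : A} (h : S.SC a b) (hs : ∀ n, IsSelfAdjoint (a n)) :
    IsSelfAdjoint b := by
  refine S.ext' (fun ξ => ?_)
  refine ext_inner_right ℂ (fun η => ?_)
  rw [S.adj, star_star]
  refine tendsto_nhds_unique (f := fun n => ⟪ξ, S.π (a n) η⟫_ℂ) (l := atTop)
    (tendsto_const_nhds.inner (h η)) ?_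
  have : (fun n => ⟪ξ, S.π (a n) η⟫_ℂ) = fun n => ⟪S.π (a n) ξ, η⟫_ℂ := by
    funext n
    rw [S.adj, (hs n).star_eq]
  rw [this]
  exact (h ξ).inner tendsto_const_nhds

lemma SC.le_of_le {a : ℕ → A} {b c : A} (h : S.SC a b) (hs : ∀ n, IsSelfAdjoint (a n))
    (hc : IsSelfAdjoint c) (hle : ∀ᶠ n in atTop, a n ≤ c) : b ≤ c :=
  S.le_of_ev (h.selfAdjoint S hs) hc (fun ξ => le_of_tendsto (S.ev_tendsto (h ξ))
    (hle.mono fun _ hn => S.ev_mono hn ξ))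

lemma SC.ge_of_ge {a : ℕ → A} {b c : A} (h : S.SC a b) (hs : ∀ n, IsSelfAdjoint (a n))
    (hc : IsSelfAdjoint c) (hle : ∀ᶠ n in atTop, c ≤ a n) : c ≤ b :=
  S.le_of_ev hc (h.selfAdjoint S hs) (fun ξ => ge_of_tendsto (S.ev_tendsto (h ξ))
    (hle.mono fun _ hn => S.ev_mono hn ξ))

lemma SC.const (a : A) : S.SC (fun _ => a) a := fun _ => tendsto_const_nhds
lemma SC.add {a b : ℕ → A} {c d : A} (h : S.SC a c) (h' : S.SC b d) :
    S.SC (fun n => a n + b n) (c + d) := fun ξ => by simpa using (h ξ).add (h' ξ)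
lemma SC.sub {a b : ℕ → A} {c d : A} (h : S.SC a c) (h' : S.SC b d) :
    S.SC (fun n => a n - b n) (c - d) := fun ξ => by simpa using (h ξ).sub (h' ξ)
lemma SC.mul_left {a : ℕ → A} {c : A} (h : S.SC a c) (b : A) :
    S.SC (fun n => b * a n) (b * c) := fun ξ => by
  simpa [Function.comp_def] using ((S.π b).continuous.tendsto _).comp (h ξ)
lemma SC.mul_right {a : ℕ → A} {c : A} (h : S.SC a c) (b : A) :
    S.SC (fun n => a n * b) (c * b) := fun ξ => by
  simpa using h (S.π b ξ)
lemma SC.mul {a b : ℕ → A} {c d : A} {C : ℝ} (hC : ∀ n, ‖a n‖ ≤ C)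
    (h : S.SC a c) (h' : S.SC b d) :
    S.SC (fun n => a n * b n) (c * d) := fun ξ => by
  have h1 : Tendsto (fun n => S.π (a n) (S.π (b n) ξ - S.π d ξ)) atTop (𝓝 0) := by
    refine squeeze_zero_norm (a := fun n => C * ‖S.π (b n) ξ - S.π d ξ‖) (fun n => ?_) ?_
    · exact (S.norm_le _ _).trans (mul_le_mul_of_nonneg_right (hC n) (norm_nonneg _))
    · have := ((h' ξ).sub_const (S.π d ξ)).norm.const_mul C
      simpa using this
  have := h1.add (h (S.π d ξ))
  simpa using this
lemma SC.norm_le {a : ℕ → A} {b : A} {C : ℝ} (hC : ∀ n, ‖a n‖ ≤ C) (h : S.SC a b) : ‖b‖ ≤ C := by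
  rw [← NonUnitalStarAlgHom.norm_map S.π S.inj b]
  refine ContinuousLinearMap.opNorm_le_bound _ ((norm_nonneg _).trans (hC 0)) (fun ξ => ?_)
  exact le_of_tendsto (h ξ).norm (Eventually.of_forall fun n =>
    (S.norm_le _ _).trans (mul_le_mul_of_nonneg_right (hC n) (norm_nonneg _)))
lemma SC.comp {a : ℕ → A} {b : A} (h : S.SC a b) {f : ℕ → ℕ} (hf : Tendsto f atTop atTop) :
    S.SC (fun n => a (f n)) b := fun ξ => (h ξ).comp hf

/-- Vigier: bounded increasing sequences converge strongly. -/
lemma monotone_sc {a : ℕ → A} (hm : Monotone a) (h0 : ∀ n, 0 ≤ a n) (h1 : ∀ n, a n ≤ 1) :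
    ∃ b : A, S.SC a b ∧ (∀ n, a n ≤ b) ∧ 0 ≤ b ∧ b ≤ 1 := by
  have hs : ∀ n, IsSelfAdjoint (a n) := fun n => IsSelfAdjoint.of_nonneg (h0 n)
  have key : ∀ ξ, ∃ η, Tendsto (fun n => S.π (a n) ξ) atTop (𝓝 η) := by
    intro ξ
    refine cauchySeq_tendsto_of_complete ?_
    have hc : CauchySeq (fun n => S.ev (a n) ξ) := by
      have hmm : Monotone (fun n => S.ev (a n) ξ) := fun m n h => S.ev_mono (hm h) ξ
      have hb : BddAbove (Set.range fun n => S.ev (a n) ξ) := by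
        refine ⟨S.ev 1 ξ, ?_⟩
        rintro _ ⟨n, rfl⟩
        exact S.ev_mono (h1 n) ξ
      exact (tendsto_atTop_ciSup hmm hb).cauchySeq
    rw [Metric.cauchySeq_iff'] at hc ⊢
    intro ε hε
    obtain ⟨N, hN⟩ := hc (ε ^ 2) (by positivity)
    refine ⟨N, fun n hn => ?_⟩
    have hd := hN n hn
    rw [Real.dist_eq, ← S.ev_sub] at hd
    have hd0 : 0 ≤ a n - a N := sub_nonneg.2 (hm hn)
    have hd1 : a n - a N ≤ 1 := (sub_le_self _ (h0 N)).trans (h1 n)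
    have := S.ev_mono (sq_le_self_of_le_one hd0 hd1) ξ
    nth_rewrite 1 [← (IsSelfAdjoint.of_nonneg hd0).star_eq] at this
    rw [ev_star_mul] at this
    rw [dist_eq_norm]
    have e : S.π (a n) ξ - S.π (a N) ξ = S.π (a n - a N) ξ := by simp
    rw [e]
    have h3 := lt_of_le_of_lt (this.trans (le_abs_self _)) hd
    exact lt_of_pow_lt_pow_left₀ 2 hε.le h3
  obtain ⟨b, hb⟩ := S.closed a 1 (fun n => norm_le_of_le_one (h0 n) (h1 n)) key
  have hb' : S.SC a b := hb
  refine ⟨b, hb, fun n => ?_, ?_, ?_⟩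
  · exact hb'.ge_of_ge S hs (hs n) ((eventually_ge_atTop n).mono fun m h => hm h)
  · exact hb'.ge_of_ge S hs (IsSelfAdjoint.zero A) (Eventually.of_forall h0)
  · exact hb'.le_of_le S hs (IsSelfAdjoint.one A) (Eventually.of_forall h1)

/-- squeeze: `0 ≤ a n ≤ b n`, `a n ≤ 1`, `ev (b n) ξ → 0` gives `a n ξ → 0`. -/
lemma tendsto_zero_of_ev {a : ℕ → A} (h0 : ∀ n, 0 ≤ a n) (h1 : ∀ n, a n ≤ 1) {ξ : H}
    (h : Tendsto (fun n => S.ev (a n) ξ) atTop (𝓝 0)) :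
    Tendsto (fun n => S.π (a n) ξ) atTop (𝓝 0) := by
  refine squeeze_zero_norm (a := fun n => √(S.ev (a n) ξ)) (fun n => ?_) ?_
  · refine Real.le_sqrt_of_sq_le ?_
    have := S.ev_mono (sq_le_self_of_le_one (h0 n) (h1 n)) ξ
    nth_rewrite 1 [← (IsSelfAdjoint.of_nonneg (h0 n)).star_eq] at this
    rwa [ev_star_mul] at this
  · simpa using h.sqrt

end VNRep
end rep
end TailProof

namespace TailProof
variable {A H : Type} [CStarAlgebra A] [PartialOrder A] [StarOrderedRing A]
    [NormedAddCommGroup H] [InnerProductSpace ℂ H] [CompleteSpace H]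

/-- Kadison element at finite stage. -/
noncomputable def bb (c : ℕ → A) (n m : ℕ) : A := 1 - res (∑ k ∈ Finset.range m, c (n + k))

section KL
variable {c : ℕ → A} (hc : ∀ k, 0 ≤ c k)
include hc
lemma sum_c_nonneg (n m : ℕ) : 0 ≤ ∑ k ∈ Finset.range m, c (n + k) :=
  Finset.sum_nonneg fun k _ => hc _

lemma bb_nonneg (n m : ℕ) : 0 ≤ bb c n m := one_sub_res_nonneg (sum_c_nonneg hc n m)
lemma bb_le_one (n m : ℕ) : bb c n m ≤ 1 := sub_le_self _ (res_nonneg (sum_c_nonneg hc n m))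
lemma bb_le_sum (n m : ℕ) : bb c n m ≤ ∑ k ∈ Finset.range m, c (n + k) :=
  one_sub_res_le (sum_c_nonneg hc n m)
lemma bb_mono (n : ℕ) : Monotone (bb c n) := fun m m' h =>
  sub_le_sub_left (res_anti (sum_c_nonneg hc n m) (Finset.sum_le_sum_of_subset_of_nonneg
    (Finset.range_mono h) fun _ _ _ => hc _)) _
lemma bb_anti (n m : ℕ) : bb c (n + 1) m ≤ bb c n (m + 1) := by
  refine sub_le_sub_left (res_anti (sum_c_nonneg hc _ m) ?_) _
  rw [Finset.sum_range_succ']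
  have : ∀ k, c (n + 1 + k) = c (n + (k + 1)) := fun k => by congr 1; ring
  simp only [this]
  exact le_add_of_nonneg_right (hc _)
lemma one_sub_bb_le (n m k : ℕ) (h : k < m) : 1 - bb c n m ≤ res (c (n + k)) := by
  rw [bb, sub_sub_cancel]
  refine res_anti (hc _) ?_
  exact Finset.single_le_sum (f := fun k => c (n + k)) (fun _ _ => hc _) (Finset.mem_range.2 h)

lemma KL (S : VNRep A H) : ∃ b : ℕ → A, (∀ n, S.SC (bb c n) (b n)) ∧ (∀ n, 0 ≤ b n) ∧
    (∀ n, b n ≤ 1) ∧ Antitone b ∧ (∀ n k, 1 - b n ≤ res (c (n + k))) := by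
  choose b hb using fun n => S.monotone_sc (bb_mono hc n) (bb_nonneg hc n) (bb_le_one hc n)
  refine ⟨b, fun n => (hb n).1, fun n => (hb n).2.2.1, fun n => (hb n).2.2.2, ?_, fun n k => ?_⟩
  · refine antitone_nat_of_succ_le fun n => ?_
    refine (hb (n + 1)).1.le_of_le S (fun m => IsSelfAdjoint.of_nonneg (bb_nonneg hc _ _))
      (IsSelfAdjoint.of_nonneg (hb n).2.2.1) (Eventually.of_forall fun m => ?_)
    exact (bb_anti hc n m).trans ((hb n).2.1 (m + 1))
  · refine le_trans ?_ (one_sub_bb_le hc n (k + 1) k (Nat.lt_succ_self k))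
    exact sub_le_sub_left ((hb n).2.1 _) _

lemma ev_KL_le (S : VNRep A H) {b : A} {n : ℕ} (hb : S.SC (bb c n) b) {ξ : H}
    {r : ℝ} (hr : ∀ m, ∑ k ∈ Finset.range m, S.ev (c (n + k)) ξ ≤ r) : S.ev b ξ ≤ r := by
  refine le_of_tendsto (S.ev_tendsto (hb ξ)) (Eventually.of_forall fun m => ?_)
  refine (S.ev_mono (bb_le_sum hc n m) ξ).trans ?_
  rw [S.ev_sum]; exact hr m
end KL

lemma two_smul_sq (x y : A) : star (x + y) * (x + y) ≤
    (2 : ℝ) • (star x * x) + (2 : ℝ) • (star y * y) := by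
  rw [← sub_nonneg]
  have : (2 : ℝ) • (star x * x) + (2 : ℝ) • (star y * y) - star (x + y) * (x + y) =
      star (x - y) * (x - y) := by
    simp only [star_add, star_sub, two_smul]; noncomm_ring
  rw [this]; exact star_mul_self_nonneg _

/-- GNS seminorm -/
noncomputable def nrm (φ : A →ₚ[ℂ] ℂ) (a : A) : ℝ := ‖φ.toPreGNS a‖

section nrm
variable (φ : A →ₚ[ℂ] ℂ)

lemma nrm_sq (a : A) : nrm φ a ^ 2 = (φ (star a * a)).re := by
  have := congrArg Complex.re (φ.preGNS_norm_sq (φ.toPreGNS a))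
  rw [← Complex.ofReal_pow, Complex.ofReal_re] at this
  exact this
lemma nrm_nonneg (a : A) : 0 ≤ nrm φ a := norm_nonneg _
lemma nrm_add_le (a b : A) : nrm φ (a + b) ≤ nrm φ a + nrm φ b := by
  unfold nrm; rw [map_add]; exact norm_add_le _ _
lemma nrm_sub_le (a b : A) : nrm φ (a - b) ≤ nrm φ a + nrm φ b := by
  unfold nrm; rw [map_sub]; exact norm_sub_le _ _
lemma nrm_sub_rev (a b : A) : nrm φ (a - b) = nrm φ (b - a) := by
  unfold nrm; rw [map_sub, map_sub]; exact norm_sub_rev _ _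
lemma nrm_smul (c : ℂ) (a : A) : nrm φ (c • a) = ‖c‖ * nrm φ a := by
  unfold nrm; rw [map_smul]; exact norm_smul _ _
lemma nrm_zero : nrm φ 0 = 0 := by unfold nrm; rw [map_zero]; exact norm_zero
lemma re_nonneg {a : A} (h : 0 ≤ a) : 0 ≤ (φ a).re :=
  (Complex.nonneg_iff.1 (map_nonneg φ h)).1
lemma re_mono {a b : A} (h : a ≤ b) : (φ a).re ≤ (φ b).re := by
  have := re_nonneg φ (sub_nonneg.2 h)
  rw [map_sub, Complex.sub_re] at this; linarith
lemma re_smul (c : ℝ) (a : A) : (φ (c • a)).re = c * (φ a).re := by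
  have : c • a = (c : ℂ) • a := (Complex.coe_smul c a).symm
  rw [this, map_smul]; simp
lemma re_sum {ι : Type} (s : Finset ι) (f : ι → A) :
    (φ (∑ i ∈ s, f i)).re = ∑ i ∈ s, (φ (f i)).re := by
  simp [map_sum]
lemma map_sa {a : A} (h : 0 ≤ a) : φ a = ((φ a).re : ℂ) := by
  have := (Complex.nonneg_iff.1 (map_nonneg φ h)).2
  apply Complex.ext <;> simp [← this]
lemma nrm_mul_le (a b : A) : nrm φ (a * b) ≤ ‖a‖ * nrm φ b := by
  have := (φ.leftMulMapPreGNS a).le_opNorm (φ.toPreGNS b)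
  refine le_trans ?_ (this.trans (mul_le_mul_of_nonneg_right ?_ (norm_nonneg _)))
  · exact le_of_eq rfl
  · exact LinearMap.mkContinuous_norm_le _ (norm_nonneg _) _
lemma abs_le (a b : A) : ‖φ (star a * b)‖ ≤ nrm φ a * nrm φ b := by
  have := norm_inner_le_norm (𝕜 := ℂ) (φ.toPreGNS a) (φ.toPreGNS b)
  rwa [φ.preGNS_inner_def] at this
lemma nrm_le_norm (a : A) : nrm φ a ≤ ‖a‖ * nrm φ 1 := by
  have := nrm_mul_le φ a 1; rwa [mul_one] at this

/-- for `0 ≤ a ≤ 1`, `nrm a ^ 2 ≤ φ a`. -/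
lemma nrm_sq_le_of_le_one {a : A} (h0 : 0 ≤ a) (h1 : a ≤ 1) : nrm φ a ^ 2 ≤ (φ a).re := by
  rw [nrm_sq, (IsSelfAdjoint.of_nonneg h0).star_eq]
  exact re_mono φ (sq_le_self_of_le_one h0 h1)
lemma re_le_nrm (a : A) : (φ a).re ≤ nrm φ 1 * nrm φ a := by
  have := abs_le φ 1 a
  rw [star_one, one_mul] at this
  exact (Complex.re_le_norm _).trans this

variable {φ}
section tr
variable (ht : ∀ a b, φ (a * b) = φ (b * a))
include ht
lemma nrm_star (a : A) : nrm φ (star a) = nrm φ a := by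
  have : nrm φ (star a) ^ 2 = nrm φ a ^ 2 := by
    rw [nrm_sq, nrm_sq, star_star, ht]
  exact (pow_left_inj₀ (nrm_nonneg _ _) (nrm_nonneg _ _) (by norm_num)).1 this
lemma nrm_mul_le' (a b : A) : nrm φ (a * b) ≤ nrm φ a * ‖b‖ := by
  rw [← nrm_star ht, star_mul]
  refine (nrm_mul_le φ _ _).trans ?_
  rw [nrm_star ht, norm_star, mul_comm]
lemma re_mul_nonneg {a b : A} (ha : 0 ≤ a) (hb : 0 ≤ b) : 0 ≤ (φ (a * b)).re := by
  obtain ⟨s, rfl⟩ := CStarAlgebra.nonneg_iff_eq_star_mul_self.1 ha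
  rw [mul_assoc, ht]
  exact re_nonneg φ (star_right_conjugate_nonneg hb s)
lemma re_mul_mono {a b c : A} (h : a ≤ b) (hc : 0 ≤ c) : (φ (a * c)).re ≤ (φ (b * c)).re := by
  have := re_mul_nonneg ht (sub_nonneg.2 h) hc
  rw [sub_mul, map_sub, Complex.sub_re] at this; linarith
lemma re_mul_mono' {a b c : A} (h : a ≤ b) (hc : 0 ≤ c) : (φ (c * a)).re ≤ (φ (c * b)).re := by
  rw [ht c a, ht c b]; exact re_mul_mono ht h hc

/-- trace estimate -/
lemma trace_est {a d h : A} {C : ℝ} (hC : 0 < C) (hd : 0 ≤ d) (hh : 0 ≤ h)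
    (hle : a ≤ (2 : ℝ) • d + (2 : ℝ) • h) :
    (φ (res (C • d) * a)).re ≤ 2 * ((φ 1).re / C + (φ h).re) := by
  have hCd : 0 ≤ C • d := rsmul_nonneg C hC.le hd
  refine (re_mul_mono' ht hle (res_nonneg hCd)).trans ?_
  rw [mul_add, map_add, Complex.add_re, mul_smul_comm, mul_smul_comm, re_smul, re_smul, mul_add]
  refine add_le_add (mul_le_mul_of_nonneg_left ?_ (by norm_num))
    (mul_le_mul_of_nonneg_left ?_ (by norm_num))
  · have e : res (C • d) * d = C⁻¹ • (1 - res (C • d)) := by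
      rw [← mul_res_eq hCd, smul_mul_assoc, smul_smul,
        inv_mul_cancel₀ hC.ne', one_smul]
      have := (res_comm_self hCd).eq
      rw [smul_mul_assoc, mul_smul_comm] at this
      have h2 := congrArg (fun z => C⁻¹ • z) this
      simp only [smul_smul, inv_mul_cancel₀ hC.ne', one_smul] at h2
      exact h2.symm
    rw [e, re_smul, div_eq_inv_mul]
    refine mul_le_mul_of_nonneg_left ?_ (inv_nonneg.2 hC.le)
    exact re_mono φ (sub_le_self _ (res_nonneg hCd))
  · have := re_mul_mono ht (res_le_one hCd) hh
    rwa [one_mul] at this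
end tr
end nrm

section GNS
variable (φ : A →ₚ[ℂ] ℂ)
/-- canonical map into the GNS space -/
noncomputable def hat : A →ₗ[ℂ] φ.GNS where
  toFun a := ((φ.toPreGNS a : φ.PreGNS) : φ.GNS)
  map_add' a b := by rw [map_add]; exact UniformSpace.Completion.coe_add _ _
  map_smul' c a := by rw [map_smul]; exact UniformSpace.Completion.coe_smul _ _

lemma norm_hat (a : A) : ‖hat φ a‖ = nrm φ a := UniformSpace.Completion.norm_coe _
lemma inner_hat (a b : A) : ⟪hat φ a, hat φ b⟫_ℂ = φ (star a * b) :=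
  UniformSpace.Completion.inner_coe _ _
lemma dense_hat : DenseRange (hat φ) := by
  have : Set.range (hat φ) = Set.range ((↑) : φ.PreGNS → φ.GNS) := by
    ext v; constructor
    · rintro ⟨a, rfl⟩; exact ⟨_, rfl⟩
    · rintro ⟨a, rfl⟩; exact ⟨φ.ofPreGNS a, rfl⟩
  rw [DenseRange, this]; exact UniformSpace.Completion.denseRange_coe

/-- left multiplication -/
noncomputable def lam : A →⋆ₐ[ℂ] (φ.GNS →L[ℂ] φ.GNS) := φ.gnsStarAlgHom
lemma lam_hat (a b : A) : lam φ a (hat φ b) = hat φ (a * b) :=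
  φ.gnsNonUnitalStarAlgHom_apply_coe

/-- extension of bounded maps from `A` to the GNS space -/
lemma exists_ext {E : Type} [NormedAddCommGroup E] [NormedSpace ℂ E] [CompleteSpace E]
    (f : A →ₗ[ℂ] E) (C : ℝ) (h : ∀ a, ‖f a‖ ≤ C * nrm φ a) :
    ∃ F : φ.GNS →L[ℂ] E, (∀ a, F (hat φ a) = f a) ∧ ∀ v, ‖F v‖ ≤ C * ‖v‖ := by
  have h' : ∀ a, ‖f a‖ ≤ C * ‖hat φ a‖ := fun a => by rw [norm_hat]; exact h a
  exact ⟨f.extendOfNorm (hat φ), fun a => LinearMap.extendOfNorm_eq (dense_hat φ) ⟨C, h'⟩ a,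
    LinearMap.norm_extendOfNorm_apply_le (dense_hat φ) C h'⟩

lemma clm_ext {E : Type} [NormedAddCommGroup E] [NormedSpace ℂ E]
    {F G : φ.GNS →L[ℂ] E} (h : ∀ a, F (hat φ a) = G (hat φ a)) : F = G :=
  ContinuousLinearMap.coeFn_injective
    ((dense_hat φ).equalizer F.continuous G.continuous (funext h))

lemma lam_adj (a : A) (u v : φ.GNS) : ⟪lam φ a u, v⟫_ℂ = ⟪u, lam φ (star a) v⟫_ℂ := by
  rw [map_star, ContinuousLinearMap.star_eq_adjoint, ContinuousLinearMap.adjoint_inner_right]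

lemma lam_norm_le (a : A) (v : φ.GNS) : ‖lam φ a v‖ ≤ ‖a‖ * ‖v‖ :=
  (ContinuousLinearMap.le_opNorm _ _).trans
    (mul_le_mul_of_nonneg_right (NonUnitalStarAlgHom.norm_apply_le (lam φ) a) (norm_nonneg _))

lemma hat_induction {p : φ.GNS → Prop} (hp : IsClosed {v | p v}) (h : ∀ a, p (hat φ a)) (v) : p v :=
  (dense_hat φ).induction_on v hp h

variable {φ}
variable (ht : ∀ a b, φ (a * b) = φ (b * a))

/-- right multiplication -/
noncomputable def rmul (φ : A →ₚ[ℂ] ℂ) (a : A) : φ.GNS →L[ℂ] φ.GNS :=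
  (hat φ ∘ₗ LinearMap.mulRight ℂ a).extendOfNorm (hat φ)

include ht
lemma rmul_hat (a b : A) : rmul φ a (hat φ b) = hat φ (b * a) := by
  refine LinearMap.extendOfNorm_eq (dense_hat φ) ⟨‖a‖, fun x => ?_⟩ b
  simp only [LinearMap.comp_apply, LinearMap.mulRight_apply, norm_hat]
  rw [mul_comm]; exact nrm_mul_le' ht x a

lemma rmul_norm_le (a : A) (v : φ.GNS) : ‖rmul φ a v‖ ≤ ‖a‖ * ‖v‖ := by
  refine hat_induction φ (p := fun v => ‖rmul φ a v‖ ≤ ‖a‖ * ‖v‖)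
    (isClosed_le (by fun_prop) (by fun_prop)) (fun b => ?_) v
  rw [rmul_hat ht, norm_hat, norm_hat, mul_comm]; exact nrm_mul_le' ht b a

lemma rmul_lam (a b : A) (v : φ.GNS) : rmul φ a (lam φ b v) = lam φ b (rmul φ a v) := by
  refine hat_induction φ (p := fun v => rmul φ a (lam φ b v) = lam φ b (rmul φ a v))
    (isClosed_eq (by fun_prop) (by fun_prop)) (fun c => ?_) v
  rw [rmul_hat ht, lam_hat, lam_hat, rmul_hat ht, mul_assoc]

lemma rmul_mul (a b : A) (v : φ.GNS) : rmul φ (a * b) v = rmul φ b (rmul φ a v) := by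
  refine hat_induction φ (p := fun v => rmul φ (a * b) v = rmul φ b (rmul φ a v))
    (isClosed_eq (by fun_prop) (by fun_prop)) (fun c => ?_) v
  rw [rmul_hat ht, rmul_hat ht, rmul_hat ht, mul_assoc]

lemma rmul_add (a b : A) (v : φ.GNS) : rmul φ (a + b) v = rmul φ a v + rmul φ b v := by
  refine hat_induction φ (p := fun v => rmul φ (a + b) v = rmul φ a v + rmul φ b v)
    (isClosed_eq (by fun_prop) (by fun_prop)) (fun c => ?_) v
  rw [rmul_hat ht, rmul_hat ht, rmul_hat ht, mul_add, map_add]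

lemma rmul_adj (a : A) (u v : φ.GNS) : ⟪rmul φ a u, v⟫_ℂ = ⟪u, rmul φ (star a) v⟫_ℂ := by
  refine hat_induction φ (p := fun u => ⟪rmul φ a u, v⟫_ℂ = ⟪u, rmul φ (star a) v⟫_ℂ)
    (isClosed_eq (by fun_prop) (by fun_prop)) (fun c => ?_) u
  refine hat_induction φ (p := fun v => ⟪rmul φ a (hat φ c), v⟫_ℂ = ⟪hat φ c, rmul φ (star a) v⟫_ℂ)
    (isClosed_eq (by fun_prop) (by fun_prop)) (fun d => ?_) v
  rw [rmul_hat ht, rmul_hat ht, inner_hat, inner_hat, star_mul, mul_assoc, ht, mul_assoc]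

lemma rmul_one (v : φ.GNS) : rmul φ 1 v = v := by
  refine hat_induction φ (p := fun v => rmul φ 1 v = v)
    (isClosed_eq (by fun_prop) (by fun_prop)) (fun c => ?_) v
  rw [rmul_hat ht, mul_one]
end GNS

end TailProof

namespace TailProof
variable {A H : Type} [CStarAlgebra A] [PartialOrder A] [StarOrderedRing A]
    [NormedAddCommGroup H] [InnerProductSpace ℂ H] [CompleteSpace H] (S : VNRep A H)

/-- strong continuity on bounded sets at a vector -/
def HcV {τ : A →ₚ[ℂ] ℂ} (κ : τ.GNS) : Prop := ∀ ε > 0, ∃ Ξ : Finset H, ∃ δ > 0, ∀ x : A, ‖x‖ ≤ 1 →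
  (∀ ξ ∈ Ξ, ‖S.π x ξ‖ ≤ δ) → ‖lam τ x κ‖ ≤ ε

def Hcont (φ : A →ₚ[ℂ] ℂ) : Prop := ∀ ε > 0, ∃ Ξ : Finset H, ∃ δ > 0, ∀ x : A, ‖x‖ ≤ 1 →
  (∀ ξ ∈ Ξ, ‖S.π x ξ‖ ≤ δ) → nrm φ x ≤ ε

lemma smul_app (c : ℂ) (x : A) (ξ : H) : S.π (c • x) ξ = c • S.π x ξ := by
  rw [map_smul]; rfl

lemma Hcont.tendsto {φ : A →ₚ[ℂ] ℂ} (h : Hcont S φ) {a : ℕ → A} {b : A} {C : ℝ}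
    (hC : ∀ n, ‖a n‖ ≤ C) (hs : S.SC a b) : Tendsto (fun n => nrm φ (a n - b)) atTop (𝓝 0) := by
  set D : ℝ := C + ‖b‖ + 1 with hD
  have hC0 : 0 ≤ C := (norm_nonneg _).trans (hC 0)
  have hD0 : 0 < D := by have := norm_nonneg b; linarith
  rw [Metric.tendsto_atTop]
  intro ε hε
  obtain ⟨Ξ, δ, hδ, hh⟩ := h (ε / (2 * D)) (by positivity)
  have h1 : ∀ᶠ n in atTop, ∀ ξ ∈ Ξ, ‖S.π (a n - b) ξ‖ ≤ D * δ := by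
    rw [Filter.eventually_all_finset]
    intro ξ _
    have := ((hs ξ).sub_const (S.π b ξ)).norm
    rw [sub_self, norm_zero] at this
    have h2 := (this.eventually (gt_mem_nhds (show 0 < D * δ by positivity)))
    refine h2.mono fun n hn => ?_
    rw [map_sub]; exact hn.le
  obtain ⟨N, hN⟩ := eventually_atTop.1 h1
  refine ⟨N, fun n hn => ?_⟩
  rw [Real.dist_eq, sub_zero, abs_of_nonneg (nrm_nonneg _ _)]
  have h3 := hh (((D⁻¹ : ℝ) : ℂ) • (a n - b)) ?_ ?_
  · rw [nrm_smul, Complex.norm_real, Real.norm_eq_abs, abs_of_pos (by positivity)] at h3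
    rw [inv_mul_le_iff₀ hD0] at h3
    have : D * (ε / (2 * D)) = ε / 2 := by field_simp
    linarith
  · rw [norm_smul, Complex.norm_real, Real.norm_eq_abs, abs_of_pos (by positivity),
      inv_mul_le_iff₀ hD0, mul_one]
    have := norm_sub_le (a n) b
    have := hC n
    linarith
  · intro ξ hξ
    rw [smul_app, norm_smul, Complex.norm_real, Real.norm_eq_abs, abs_of_pos (by positivity),
      inv_mul_le_iff₀ hD0]
    exact hN n hn ξ hξ

lemma re_tendsto_of_nrm {φ : A →ₚ[ℂ] ℂ} {a : ℕ → A} {b : A}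
    (h : Tendsto (fun n => nrm φ (a n - b)) atTop (𝓝 0)) :
    Tendsto (fun n => (φ (a n)).re) atTop (𝓝 (φ b).re) := by
  rw [tendsto_iff_dist_tendsto_zero]
  refine squeeze_zero (fun _ => dist_nonneg) (fun n => ?_) (by simpa using h.const_mul (nrm φ 1))
  rw [Real.dist_eq, ← Complex.sub_re, ← map_sub]
  refine (Complex.abs_re_le_norm _).trans ?_
  have := abs_le φ 1 (a n - b)
  rwa [star_one, one_mul] at this

section K
variable (τ : A →ₚ[ℂ] ℂ)

/-- the normal subspace -/
noncomputable def Ksub : Submodule ℂ τ.GNS where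
  carrier := {κ | HcV S κ}
  zero_mem' := fun ε hε => ⟨∅, 1, one_pos, fun x _ _ => by simp [hε.le]⟩
  add_mem' := by
    classical
    intro κ κ' h h' ε hε
    obtain ⟨Ξ, δ, hδ, hh⟩ := h (ε / 2) (by positivity)
    obtain ⟨Ξ', δ', hδ', hh'⟩ := h' (ε / 2) (by positivity)
    refine ⟨Ξ ∪ Ξ', min δ δ', lt_min hδ hδ', fun x hx hξ => ?_⟩
    have h1 := hh x hx fun ξ hm => (hξ ξ (Finset.mem_union_left _ hm)).trans (min_le_left _ _)
    have h2 := hh' x hx fun ξ hm => (hξ ξ (Finset.mem_union_right _ hm)).trans (min_le_right _ _)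
    rw [map_add]
    exact (norm_add_le _ _).trans (by linarith)
  smul_mem' := by
    intro c κ h ε hε
    obtain ⟨Ξ, δ, hδ, hh⟩ := h (ε / (‖c‖ + 1)) (by positivity)
    refine ⟨Ξ, δ, hδ, fun x hx hξ => ?_⟩
    have h1 := hh x hx hξ
    rw [map_smul, norm_smul]
    rw [le_div_iff₀ (by positivity)] at h1
    nlinarith [norm_nonneg c, norm_nonneg (lam τ x κ)]

lemma Ksub_closed : IsClosed (Ksub S τ : Set τ.GNS) := by
  rw [← isSeqClosed_iff_isClosed]
  intro κn κ hn hlim ε hε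
  obtain ⟨N, hN⟩ := (Metric.tendsto_atTop.1 hlim) (ε / 2) (by positivity)
  obtain ⟨Ξ, δ, hδ, hh⟩ := hn N (ε / 2) (by positivity)
  refine ⟨Ξ, δ, hδ, fun x hx hξ => ?_⟩
  have h1 := hh x hx hξ
  have h2 := hN N le_rfl
  rw [dist_eq_norm, norm_sub_rev] at h2
  have h3 : lam τ x κ = lam τ x (κn N) + lam τ x (κ - κn N) := by rw [map_sub]; abel
  rw [h3]
  have h4 := lam_norm_le τ x (κ - κn N)
  have h5 := mul_le_mul_of_nonneg_right hx (norm_nonneg (κ - κn N))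
  exact (norm_add_le _ _).trans (by linarith)

lemma Ksub_lam (a : A) {κ : τ.GNS} (h : κ ∈ Ksub S τ) : lam τ a κ ∈ Ksub S τ := by
  classical
  intro ε hε
  set D : ℝ := ‖a‖ + 1
  have hD0 : 0 < D := by positivity
  obtain ⟨Ξ, δ, hδ, hh⟩ := h (ε / D) (by positivity)
  refine ⟨Ξ.image (S.π a), D * δ, by positivity, fun x hx hξ => ?_⟩
  have h3 := hh (((D⁻¹ : ℝ) : ℂ) • (x * a)) ?_ ?_
  · rw [map_smul, smul_apply, norm_smul, Complex.norm_real, Real.norm_eq_abs, abs_of_pos (by positivity),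
      map_mul] at h3
    rw [inv_mul_le_iff₀ hD0] at h3
    have : D * (ε / D) = ε := by field_simp
    rw [this] at h3
    exact h3
  · rw [norm_smul, Complex.norm_real, Real.norm_eq_abs, abs_of_pos (by positivity),
      inv_mul_le_iff₀ hD0, mul_one]
    refine (norm_mul_le _ _).trans ?_
    have := mul_le_mul_of_nonneg_right hx (norm_nonneg a)
    simp only [D]; linarith
  · intro ξ hm
    rw [smul_app, norm_smul, Complex.norm_real, Real.norm_eq_abs, abs_of_pos (by positivity),
      inv_mul_le_iff₀ hD0, S.mul_app]
    exact hξ _ (Finset.mem_image_of_mem _ hm)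

variable {τ}
lemma Ksub_rmul (ht : ∀ a b, τ (a * b) = τ (b * a)) (a : A) {κ : τ.GNS} (h : κ ∈ Ksub S τ) :
    rmul τ a κ ∈ Ksub S τ := by
  intro ε hε
  obtain ⟨Ξ, δ, hδ, hh⟩ := h (ε / (‖a‖ + 1)) (by positivity)
  refine ⟨Ξ, δ, hδ, fun x hx hξ => ?_⟩
  have h1 := hh x hx hξ
  rw [← rmul_lam ht]
  refine (rmul_norm_le ht _ _).trans ?_
  rw [le_div_iff₀ (by positivity)] at h1
  nlinarith [norm_nonneg a, norm_nonneg (lam τ x κ)]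

end K

lemma proj_comm {E : Type} [NormedAddCommGroup E] [InnerProductSpace ℂ E] (K : Submodule ℂ E)
    [K.HasOrthogonalProjection] (T T' : E → E) (hT : ∀ u v, T (u - v) = T u - T v)
    (hadj : ∀ u v, ⟪T u, v⟫_ℂ = ⟪u, T' v⟫_ℂ)
    (h : ∀ v ∈ K, T v ∈ K) (h' : ∀ v ∈ K, T' v ∈ K) (v : E) :
    K.starProjection (T v) = T (K.starProjection v) := by
  refine Submodule.eq_starProjection_of_mem_orthogonal (h _ (Submodule.starProjection_apply_mem K v)) ?_
  rw [← hT, Submodule.mem_orthogonal']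
  intro u hu
  rw [hadj]
  exact Submodule.inner_left_of_mem_orthogonal (h' u hu)
    (Submodule.sub_starProjection_mem_orthogonal v)

/-- vector functional -/
noncomputable def vf {τ : A →ₚ[ℂ] ℂ} (v : τ.GNS) : A →ₚ[ℂ] ℂ :=
  PositiveLinearMap.mk₀
    { toFun := fun a => ⟪v, lam τ a v⟫_ℂ
      map_add' := fun a b => by rw [map_add, add_apply, inner_add_right]
      map_smul' := fun c a => by rw [map_smul, smul_apply, inner_smul_right]; rfl }
    (fun a ha => by
      obtain ⟨b, rfl⟩ := CStarAlgebra.nonneg_iff_eq_star_mul_self.1 ha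
      have : ⟪v, lam τ (star b * b) v⟫_ℂ = ⟪lam τ b v, lam τ b v⟫_ℂ := by
        rw [lam_adj, map_mul]; rfl
      change 0 ≤ ⟪v, lam τ (star b * b) v⟫_ℂ
      rw [this, inner_self_eq_norm_sq_to_K]
      norm_cast; positivity)

lemma vf_apply {τ : A →ₚ[ℂ] ℂ} (v : τ.GNS) (a : A) : vf v a = ⟪v, lam τ a v⟫_ℂ := rfl

lemma nrm_vf {τ : A →ₚ[ℂ] ℂ} (v : τ.GNS) (a : A) : nrm (vf v) a = ‖lam τ a v‖ := by
  have : nrm (vf v) a ^ 2 = ‖lam τ a v‖ ^ 2 := by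
    rw [nrm_sq, vf_apply, norm_sq_eq_re_inner (𝕜 := ℂ), lam_adj, map_mul]; rfl
  exact (pow_left_inj₀ (nrm_nonneg _ _) (norm_nonneg _) (by norm_num)).1 this

lemma vf_tr {τ : A →ₚ[ℂ] ℂ} (ht : ∀ a b, τ (a * b) = τ (b * a)) (v : τ.GNS)
    (hv : ∀ a, lam τ a v = rmul τ a v) (a b : A) : vf v (a * b) = vf v (b * a) := by
  have e : ∀ a b, vf v (a * b) = ⟪lam τ (star a) v, lam τ b v⟫_ℂ := fun a b => by
    rw [lam_adj, star_star, vf_apply, map_mul]; rfl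
  rw [e, e, hv b, hv (star b), rmul_adj ht, star_star, rmul_lam ht, lam_adj, star_star]

section faithful
variable (τ : A →ₚ[ℂ] ℂ)

/-- the functional `τ + ω_ξ` -/
noncomputable def addVec (ξ : H) : A →ₚ[ℂ] ℂ :=
  PositiveLinearMap.mk₀
    { toFun := fun a => τ a + ⟪ξ, S.π a ξ⟫_ℂ
      map_add' := fun a b => by rw [map_add, map_add, add_apply, inner_add_right]; ring
      map_smul' := fun c a => by
        rw [map_smul, map_smul, smul_apply, inner_smul_right]
        simp only [smul_eq_mul, RingHom.id_apply]; ring }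
    (fun a ha => by
      refine add_nonneg (map_nonneg τ ha) ?_
      obtain ⟨b, rfl⟩ := CStarAlgebra.nonneg_iff_eq_star_mul_self.1 ha
      rw [S.mul_app, ← S.adj, inner_self_eq_norm_sq_to_K]
      norm_cast; positivity)

lemma nrm_addVec (ξ : H) (a : A) : nrm (addVec S τ ξ) a ^ 2 = nrm τ a ^ 2 + ‖S.π a ξ‖ ^ 2 := by
  rw [nrm_sq, nrm_sq, norm_sq_eq_re_inner (𝕜 := ℂ), S.adj, ← S.mul_app]
  rfl

lemma approx_of_proj_zero [(Ksub S τ).HasOrthogonalProjection] (a : A)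
    (ha : (Ksub S τ).starProjection (hat τ a) = 0) (ξ : H) :
    ∀ ε > 0, ∃ c : A, nrm τ (a - c) < ε ∧ ‖S.π c ξ‖ < ε := by
  set ω := addVec S τ ξ with hω
  have hle : ∀ a, nrm τ a ≤ 1 * nrm ω a := fun a => by
    rw [one_mul]
    refine le_of_sq_le_sq ?_ (nrm_nonneg _ _)
    rw [nrm_addVec]; nlinarith [norm_nonneg (S.π a ξ)]
  obtain ⟨J, hJ, hJn⟩ := exists_ext ω (hat τ) 1 (fun a => by rw [norm_hat]; exact hle a)
  set J' := ContinuousLinearMap.adjoint J with hJ'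
  have adj : ∀ u v, ⟪J u, v⟫_ℂ = ⟪u, J' v⟫_ℂ := fun u v => by
    rw [hJ', ContinuousLinearMap.adjoint_inner_right]
  have adj' : ∀ u v, ⟪J' u, v⟫_ℂ = ⟪u, J v⟫_ℂ := fun u v => by
    rw [hJ', ContinuousLinearMap.adjoint_inner_left]
  have hJl : ∀ x v, J (lam ω x v) = lam τ x (J v) := fun x v => by
    refine hat_induction ω (p := fun v => J (lam ω x v) = lam τ x (J v))
      (isClosed_eq (by fun_prop) (by fun_prop)) (fun c => ?_) v
    rw [lam_hat, hJ, hJ, lam_hat]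
  have hJl' : ∀ x v, J' (lam τ x v) = lam ω x (J' v) := fun x v => by
    refine ext_inner_left ℂ (fun u => ?_)
    rw [← adj]
    have h1 := lam_adj τ (star x) (J u) v
    have h2 := lam_adj ω (star x) u (J' v)
    rw [star_star] at h1 h2
    rw [← h1, ← h2, ← hJl, adj]
  have hJ'n : ∀ v, ‖J' v‖ ≤ ‖v‖ := fun v => by
    have h1 : ‖J' v‖ ^ 2 = (⟪v, J (J' v)⟫_ℂ).re := by
      rw [← adj']; exact norm_sq_eq_re_inner (𝕜 := ℂ) _
    have h2 : (⟪v, J (J' v)⟫_ℂ).re ≤ ‖v‖ * ‖J (J' v)‖ := re_inner_le_norm (𝕜 := ℂ) _ _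
    have h3 := hJn (J' v)
    by_contra hcon
    push Not at hcon
    nlinarith [norm_nonneg v, norm_nonneg (J' v)]
  -- key inequality
  have hsq : ∀ v, ‖v - J' (J v)‖ ^ 2 ≤ ‖v‖ ^ 2 - ‖J v‖ ^ 2 := fun v => by
    rw [norm_sub_sq (𝕜 := ℂ), ← adj, inner_self_eq_norm_sq_to_K]
    have h3 := hJ'n (J v)
    have h4 : ((‖J v‖ : ℂ) ^ 2).re = ‖J v‖ ^ 2 := by rw [← Complex.ofReal_pow, Complex.ofReal_re]
    have h5 : RCLike.re ((RCLike.ofReal ‖J v‖ : ℂ) ^ 2) = ‖J v‖ ^ 2 := h4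
    rw [h5]
    nlinarith [norm_nonneg (J v), norm_nonneg (J' (J v))]
  set κ := hat τ 1 - J (J' (hat τ 1)) with hκ
  have hlk : ∀ x, lam τ x κ = hat τ x - J (J' (hat τ x)) := fun x => by
    rw [hκ, map_sub, ← hJl, ← hJl', lam_hat, mul_one]
  have hkn : ∀ x, ‖lam τ x κ‖ ≤ ‖S.π x ξ‖ := fun x => by
    have e : lam τ x κ = J (hat ω x - J' (J (hat ω x))) := by
      rw [hlk, map_sub, hJ]
    have h1 := hJn (hat ω x - J' (J (hat ω x)))
    have h2 := hsq (hat ω x)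
    rw [hJ, norm_hat, norm_hat, nrm_addVec] at h2
    rw [← e, one_mul] at h1
    rw [hJ] at h1
    refine h1.trans (le_of_sq_le_sq (by linarith) (norm_nonneg _))
  have hκK : κ ∈ Ksub S τ := fun ε hε => ⟨{ξ}, ε, hε, fun x _ h =>
    (hkn x).trans (h ξ (Finset.mem_singleton_self ξ))⟩
  have h0 : ⟪lam τ a κ, hat τ a⟫_ℂ = 0 := by
    refine Submodule.inner_right_of_mem_orthogonal (Ksub_lam S τ a hκK) ?_
    have := Submodule.sub_starProjection_mem_orthogonal (K := Ksub S τ) (hat τ a)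
    rwa [ha, sub_zero] at this
  rw [hlk, inner_sub_left, adj, inner_self_eq_norm_sq_to_K,
    inner_self_eq_norm_sq_to_K] at h0
  have hn : ‖J' (hat τ a)‖ ^ 2 = ‖hat τ a‖ ^ 2 := by
    have := congrArg Complex.re h0
    simp only [Complex.sub_re, map_pow, Complex.zero_re, RCLike.conj_ofReal] at this
    rw [RCLike.ofReal_eq_complex_ofReal, ← Complex.ofReal_pow, ← Complex.ofReal_pow,
      Complex.ofReal_re, Complex.ofReal_re] at this
    linarith
  set v := J' (hat τ a) with hv
  have hJv : J v = hat τ a := by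
    have h1 : ‖hat τ a - J v‖ ^ 2 ≤ 0 := by
      rw [norm_sub_sq (𝕜 := ℂ), ← adj', inner_self_eq_norm_sq_to_K]
      have h4 : RCLike.re ((RCLike.ofReal ‖v‖ : ℂ) ^ 2) = ‖v‖ ^ 2 := by
        rw [RCLike.ofReal_eq_complex_ofReal, ← Complex.ofReal_pow]; exact Complex.ofReal_re _
      rw [← hv, h4]
      have := hJn v
      nlinarith [norm_nonneg (J v), norm_nonneg v]
    have h2 : ‖hat τ a - J v‖ = 0 := by nlinarith [norm_nonneg (hat τ a - J v)]
    exact (sub_eq_zero.1 (norm_eq_zero.1 h2)).symm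
  intro ε hε
  obtain ⟨cn, hcn⟩ : ∃ c : ℕ → A, Tendsto (fun n => hat ω (c n)) atTop (𝓝 v) := by
    have hmem : v ∈ closure (Set.range (hat ω)) := dense_hat ω v
    rw [mem_closure_iff_seq_limit] at hmem
    obtain ⟨w, hw, hwl⟩ := hmem
    choose c hc using hw
    exact ⟨c, by simpa [hc] using hwl⟩
  have t1 : Tendsto (fun n => nrm τ (a - cn n)) atTop (𝓝 0) := by
    have := ((J.continuous.tendsto v).comp hcn)
    rw [hJv] at this
    have := (tendsto_const_nhds (x := hat τ a)).sub this
    rw [sub_self] at this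
    have := this.norm
    simp only [Function.comp_def, hJ, ← map_sub, norm_hat, norm_zero] at this
    exact this
  have t2 : Tendsto (fun n => ‖S.π (cn n) ξ‖ ^ 2) atTop (𝓝 0) := by
    have e1 := (hcn.norm).pow 2
    have e2 := ((J.continuous.tendsto v).comp hcn).norm.pow 2
    have := e1.sub e2
    simp only [Function.comp_def, hJ, norm_hat, hJv, hω, nrm_addVec, add_sub_cancel_left] at this
    rw [← norm_hat, hn, sub_self] at this
    exact this
  have t1' := t1.eventually (gt_mem_nhds hε)
  have t2' := t2.eventually (gt_mem_nhds (show 0 < ε ^ 2 by positivity))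
  obtain ⟨n, h1, h2⟩ := (t1'.and t2').exists
  exact ⟨cn n, h1, lt_of_pow_lt_pow_left₀ 2 hε.le h2⟩

lemma eq_zero_of_proj_zero [(Ksub S τ).HasOrthogonalProjection]
    (ht : ∀ a b, τ (a * b) = τ (b * a)) (hf : ∀ a, nrm τ a = 0 → a = 0) (a : A)
    (ha : (Ksub S τ).starProjection (hat τ a) = 0) : a = 0 := by
  suffices h : star a = 0 by simpa using h
  refine S.eq_zero_of fun ξ0 => ?_
  set ξ := S.π (star a) ξ0 with hξ
  have key : ∀ ε > 0, ‖ξ‖ ^ 2 ≤ ε := by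
    intro ε hε
    have hex : ∀ k : ℕ, ∃ c : A, nrm τ (a - c) ≤ 1 / (k + 1) ∧
        (k + 1 : ℝ) * ‖S.π c ξ‖ ^ 2 ≤ ε / 2 / 2 ^ k := by
      intro k
      obtain ⟨c, h1, h2⟩ := approx_of_proj_zero S τ a ha ξ
        (min (1 / (k + 1)) (√(ε / 2 / 2 ^ k / (k + 1)))) (by positivity)
      refine ⟨c, h1.le.trans (min_le_left _ _), ?_⟩
      have h3 := h2.le.trans (min_le_right _ _)
      rw [Real.le_sqrt (norm_nonneg _) (by positivity), le_div_iff₀ (by positivity)] at h3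
      linarith
    choose c hc1 hc2 using hex
    have hpos : ∀ k : ℕ, 0 ≤ ((k : ℝ) + 1) • (star (c k) * c k) := fun k =>
      rsmul_nonneg _ (by positivity) (star_mul_self_nonneg _)
    obtain ⟨b, hb, hb0, hb1, -, hbr⟩ := KL hpos S
    have hev : S.ev (b 0) ξ ≤ ε := by
      refine ev_KL_le hpos S (hb 0) (fun m => ?_)
      calc ∑ k ∈ Finset.range m, S.ev (((0 + k : ℕ) + 1 : ℝ) • (star (c (0 + k)) * c (0 + k))) ξ
          ≤ ∑ k ∈ Finset.range m, ε / 2 / 2 ^ k := Finset.sum_le_sum fun k _ => by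
            rw [S.ev_smul, S.ev_star_mul, zero_add]; exact hc2 k
        _ ≤ ∑' k : ℕ, ε / 2 / 2 ^ k := Summable.sum_le_tsum _ (fun _ _ => by positivity)
            (summable_geometric_two' ε)
        _ = ε := tsum_geometric_two' ε
    have hz : (τ ((1 - b 0) * (star a * a))).re ≤ 0 := by
      have hk : ∀ k : ℕ, (τ ((1 - b 0) * (star a * a))).re ≤
          2 * ((τ 1).re / (k + 1) + (1 / (k + 1)) ^ 2) := fun k => by
        have h1 := hbr 0 k
        rw [zero_add] at h1
        refine (re_mul_mono ht h1 (star_mul_self_nonneg a)).trans ?_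
        refine (trace_est ht (h := star (a - c k) * (a - c k)) (by positivity)
          (star_mul_self_nonneg (c k)) (star_mul_self_nonneg _) ?_).trans ?_
        · have := two_smul_sq (c k) (a - c k)
          rwa [add_sub_cancel] at this
        · rw [← nrm_sq]
          have := hc1 k
          have := nrm_nonneg τ (a - c k)
          gcongr
      have hlim : Tendsto (fun k : ℕ => 2 * ((τ 1).re / ((k : ℝ) + 1) + (1 / ((k : ℝ) + 1)) ^ 2))
          atTop (𝓝 (2 * (0 + 0 ^ 2))) := by
        refine Tendsto.const_mul _ (Tendsto.add ?_ (Tendsto.pow ?_ 2))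
        · have := (tendsto_one_div_add_atTop_nhds_zero_nat (𝕜 := ℝ)).const_mul (τ 1).re
          simpa [div_eq_mul_inv] using this
        · exact tendsto_one_div_add_atTop_nhds_zero_nat
      have := ge_of_tendsto' hlim hk
      simpa using this
    have hy : (1 - b 0) * star a = 0 := by
      apply hf
      have h1 : nrm τ ((1 - b 0) * star a) ^ 2 ≤ 0 := by
        have h10 : 0 ≤ 1 - b 0 := sub_nonneg.2 (hb1 0)
        have e : (τ (star ((1 - b 0) * star a) * ((1 - b 0) * star a))) =
            τ ((1 - b 0) * (1 - b 0) * (star a * a)) := by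
          rw [star_mul, star_star, (IsSelfAdjoint.of_nonneg h10).star_eq, mul_assoc, ht]
          congr 1; noncomm_ring
        rw [nrm_sq, e]
        exact (re_mul_mono ht (sq_le_self_of_le_one h10 (sub_le_self _ (hb0 0)))
          (star_mul_self_nonneg a)).trans hz
      nlinarith [nrm_nonneg τ ((1 - b 0) * star a)]
    have hbξ : S.π (b 0) ξ = ξ := by
      rw [sub_mul, one_mul, sub_eq_zero] at hy
      rw [hξ, ← S.mul_app, ← hy]
    rw [VNRep.ev, hbξ] at hev
    rw [norm_sq_eq_re_inner (𝕜 := ℂ)]; exact hev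
  have : ‖ξ‖ ^ 2 ≤ 0 := le_of_forall_pos_le_add fun ε hε => by simpa using key ε hε
  exact norm_eq_zero.1 (by nlinarith [norm_nonneg ξ])
end faithful

theorem partI (τ : A →ₚ[ℂ] ℂ) (ht : ∀ a b, τ (a * b) = τ (b * a))
    (hf : ∀ a, nrm τ a = 0 → a = 0) :
    ∃ P Ps : A →ₚ[ℂ] ℂ, (∀ a b, P (a * b) = P (b * a)) ∧ (∀ a b, Ps (a * b) = Ps (b * a)) ∧
      (∀ a, τ a = P a + Ps a) ∧ Hcont S P ∧ (∀ a, nrm P a = 0 → a = 0) ∧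
      ∃ u : ℕ → A, Monotone u ∧ (∀ n, 0 ≤ u n) ∧ (∀ n, u n ≤ 1) ∧ (∀ n, nrm Ps (u n) = 0) ∧
        S.SC u 1 := by
  haveI : CompleteSpace (Ksub S τ) := (Ksub_closed S τ).completeSpace_coe
  set e := (Ksub S τ).starProjection with he
  have el : ∀ a v, e (lam τ a v) = lam τ a (e v) := fun a v =>
    proj_comm (Ksub S τ) (lam τ a) (lam τ (star a)) (fun u v => map_sub _ _ _) (lam_adj τ a)
      (fun v hv => Ksub_lam S τ a hv) (fun v hv => Ksub_lam S τ _ hv) v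
  have er : ∀ a v, e (rmul τ a v) = rmul τ a (e v) := fun a v =>
    proj_comm (Ksub S τ) (rmul τ a) (rmul τ (star a)) (fun u v => map_sub _ _ _) (rmul_adj ht a)
      (fun v hv => Ksub_rmul S ht a hv) (fun v hv => Ksub_rmul S ht _ hv) v
  have l1 : ∀ a, lam τ a (hat τ 1) = hat τ a := fun a => by rw [lam_hat, mul_one]
  have r1 : ∀ a, rmul τ a (hat τ 1) = hat τ a := fun a => by rw [rmul_hat ht, one_mul]
  set v := e (hat τ 1) with hv
  set w := hat τ 1 - e (hat τ 1) with hw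
  have lv : ∀ a, lam τ a v = e (hat τ a) := fun a => by rw [hv, ← el, l1]
  have lw : ∀ a, lam τ a w = hat τ a - e (hat τ a) := fun a => by rw [hw, map_sub, ← el, l1]
  have vr : ∀ a, lam τ a v = rmul τ a v := fun a => by rw [lv, hv, ← er, r1]
  have wr : ∀ a, lam τ a w = rmul τ a w := fun a => by rw [lw, hw, map_sub, ← er, r1]
  have vK : v ∈ Ksub S τ := Submodule.starProjection_apply_mem _ _
  have nP : ∀ a, nrm (vf v) a = ‖e (hat τ a)‖ := fun a => by rw [nrm_vf, lv]
  have nS : ∀ a, nrm (vf w) a = ‖hat τ a - e (hat τ a)‖ := fun a => by rw [nrm_vf, lw]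
  have hH : Hcont S (vf v) := fun ε hε => by
    obtain ⟨Ξ, δ, hδ, h⟩ := vK ε hε
    exact ⟨Ξ, δ, hδ, fun x hx hx' => by rw [nrm_vf]; exact h x hx hx'⟩
  have hPf : ∀ a, nrm (vf v) a = 0 → a = 0 := fun a h => by
    rw [nP] at h
    exact eq_zero_of_proj_zero S τ ht hf a (norm_eq_zero.1 h)
  have htP := vf_tr ht v vr
  have htS := vf_tr ht w wr
  refine ⟨vf v, vf w, htP, htS, ?_, hH, hPf, ?_⟩
  · intro a
    have e1 : τ a = ⟪hat τ 1, lam τ a (hat τ 1)⟫_ℂ := by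
      rw [l1, inner_hat, star_one, one_mul]
    have e2 : hat τ 1 = v + w := by rw [hv, hw]; abel
    have wo : w ∈ (Ksub S τ)ᗮ := Submodule.sub_starProjection_mem_orthogonal _
    have c1 : ⟪w, lam τ a v⟫_ℂ = 0 :=
      Submodule.inner_left_of_mem_orthogonal (Ksub_lam S τ a vK) wo
    have c2 : ⟪v, lam τ a w⟫_ℂ = 0 := by
      have := lam_adj τ (star a) v w
      rw [star_star] at this
      rw [← this]
      exact Submodule.inner_right_of_mem_orthogonal (Ksub_lam S τ _ vK) wo
    rw [e1, e2, map_add, inner_add_left, inner_add_right, inner_add_right, c1, c2, vf_apply,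
      vf_apply]
    ring
  · have hex : ∀ k : ℕ, ∃ c : A, (k + 1 : ℝ) * nrm (vf v) (1 - c) ^ 2 ≤ 1 / 2 / 2 ^ k ∧
        nrm (vf w) c ≤ 1 / (k + 1) := by
      intro k
      set δ : ℝ := min (1 / (k + 1)) (√(1 / 2 / 2 ^ k / (k + 1))) with hδ
      have hδ0 : 0 < δ := by positivity
      obtain ⟨c, hc⟩ := (dense_hat τ).exists_dist_lt v hδ0
      rw [dist_eq_norm] at hc
      have hev : e v = v := Submodule.starProjection_eq_self_iff.2 vK
      have h1 : nrm (vf v) (1 - c) ≤ δ := by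
        rw [nP, map_sub, map_sub, ← hv, ← hev, ← map_sub]
        exact (Submodule.norm_starProjection_apply_le (Ksub S τ) _).trans hc.le
      have h2 : nrm (vf w) c ≤ δ := by
        rw [nS]
        have e1 : hat τ c - e (hat τ c) = (Ksub S τ)ᗮ.starProjection (hat τ c - v) := by
          rw [Submodule.starProjection_orthogonal', ← he, sub_apply, ContinuousLinearMap.one_apply, map_sub e, hev]; abel
        rw [e1]
        refine (Submodule.norm_starProjection_apply_le _ _).trans ?_
        rw [norm_sub_rev]; exact hc.le
      refine ⟨c, ?_, h2.trans (min_le_left _ _)⟩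
      have h3 := h1.trans (min_le_right _ _)
      rw [Real.le_sqrt (nrm_nonneg _ _) (by positivity), le_div_iff₀ (by positivity)] at h3
      linarith
    choose c hc1 hc2 using hex
    have hpos : ∀ k : ℕ, 0 ≤ ((k : ℝ) + 1) • (star (1 - c k) * (1 - c k)) := fun k =>
      rsmul_nonneg _ (by positivity) (star_mul_self_nonneg _)
    obtain ⟨b, hb, hb0, hb1, hbanti, hbr⟩ := KL hpos S
    have hbb : ∀ n m, ‖bb (fun k : ℕ => ((k : ℝ) + 1) • (star (1 - c k) * (1 - c k))) n m‖ ≤ 1 :=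
      fun n m => norm_le_of_le_one (bb_nonneg hpos _ _) (bb_le_one hpos _ _)
    have hPb : ∀ n, (vf v (b n)).re ≤ 1 / 2 ^ n := by
      intro n
      refine le_of_tendsto (re_tendsto_of_nrm (hH.tendsto S (hbb n) (hb n)))
        (Eventually.of_forall fun m => ?_)
      refine (re_mono _ (bb_le_sum hpos n m)).trans ?_
      rw [re_sum]
      calc _ ≤ ∑ k ∈ Finset.range m, (1 / 2 ^ n) / 2 / 2 ^ k := Finset.sum_le_sum fun k _ => by
            rw [re_smul, ← nrm_sq]
            refine (hc1 (n + k)).trans (le_of_eq ?_)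
            rw [pow_add]; field_simp
        _ ≤ ∑' k : ℕ, (1 / 2 ^ n : ℝ) / 2 / 2 ^ k := Summable.sum_le_tsum _
            (fun _ _ => by positivity) (summable_geometric_two' _)
        _ = 1 / 2 ^ n := tsum_geometric_two' _
    have hu0 : ∀ n, 0 ≤ 1 - b n := fun n => sub_nonneg.2 (hb1 n)
    have hu1 : ∀ n, 1 - b n ≤ 1 := fun n => sub_le_self _ (hb0 n)
    have hum : Monotone (fun n => 1 - b n) := fun m n h => sub_le_sub_left (hbanti h) _
    refine ⟨fun n => 1 - b n, hum, hu0, hu1, fun n => ?_, ?_⟩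
    · have hz : (vf w (1 - b n)).re ≤ 0 := by
        have hk : ∀ k : ℕ, (vf w (1 - b n)).re ≤
            2 * ((vf w 1).re / ((n + k : ℕ) + 1) + (1 / ((n + k : ℕ) + 1)) ^ 2) := fun k => by
          refine (re_mono _ (hbr n k)).trans ?_
          have := trace_est htS (a := 1) (d := star (1 - c (n + k)) * (1 - c (n + k)))
            (h := star (c (n + k)) * c (n + k)) (C := ((n + k : ℕ) : ℝ) + 1)
            (by positivity) (star_mul_self_nonneg _) (star_mul_self_nonneg _)
            (by have := two_smul_sq (1 - c (n + k)) (c (n + k)); simpa using this)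
          rw [mul_one] at this
          refine this.trans ?_
          rw [← nrm_sq]
          have := hc2 (n + k)
          have := nrm_nonneg (vf w) (c (n + k))
          gcongr
        have hlim : Tendsto (fun k : ℕ => 2 * ((vf w 1).re / ((k : ℝ) + 1) +
            (1 / ((k : ℝ) + 1)) ^ 2)) atTop (𝓝 (2 * (0 + 0 ^ 2))) := by
          refine Tendsto.const_mul _ (Tendsto.add ?_ (Tendsto.pow ?_ 2))
          · have := (tendsto_one_div_add_atTop_nhds_zero_nat (𝕜 := ℝ)).const_mul (vf w 1).re
            simpa [div_eq_mul_inv] using this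
          · exact tendsto_one_div_add_atTop_nhds_zero_nat
        have hlim' := hlim.comp (tendsto_add_atTop_nat n)
        have := ge_of_tendsto' hlim' (fun k => by
          have := hk k
          rw [add_comm n k] at this
          exact this)
        simpa using this
      have := (nrm_sq_le_of_le_one (vf w) (hu0 n) (hu1 n)).trans hz
      nlinarith [nrm_nonneg (vf w) (1 - b n)]
    · obtain ⟨u, hu, hun, hu0', hu1'⟩ := S.monotone_sc hum hu0 hu1
      have : 1 - u = 0 := by
        apply hPf
        have h10 : 0 ≤ 1 - u := sub_nonneg.2 hu1'
        have h2 : (vf v (1 - u)).re ≤ 0 := by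
          refine ge_of_tendsto' (x := atTop) (f := fun n : ℕ => (1 / 2 : ℝ) ^ n)
            (tendsto_pow_atTop_nhds_zero_of_lt_one (by norm_num) (by norm_num)) (fun n => ?_)
          have h3 : 1 - u ≤ b n := by
            have := hun n
            rw [sub_le_comm]; exact this
          refine (re_mono _ h3).trans ((hPb n).trans (le_of_eq ?_))
          rw [one_div_pow]
        have := (nrm_sq_le_of_le_one (vf v) h10 (sub_le_self _ hu0')).trans h2
        nlinarith [nrm_nonneg (vf v) (1 - u)]
      rw [sub_eq_zero] at this
      have hu2 : u = 1 := this.symm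
      rw [hu2] at hu; exact hu

end TailProof

namespace TailProof
section inv
variable {A H : Type} [CStarAlgebra A] [PartialOrder A] [StarOrderedRing A]
    [NormedAddCommGroup H] [InnerProductSpace ℂ H] [CompleteSpace H] (S : VNRep A H)

lemma hom_nonneg (θ : A →⋆ₐ[ℂ] A) {a : A} (h : 0 ≤ a) : 0 ≤ θ a := by
  obtain ⟨b, rfl⟩ := CStarAlgebra.nonneg_iff_eq_star_mul_self.1 h
  rw [map_mul, map_star]; exact star_mul_self_nonneg _

lemma hom_mono (θ : A →⋆ₐ[ℂ] A) {a b : A} (h : a ≤ b) : θ a ≤ θ b := by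
  rw [← sub_nonneg, ← map_sub]; exact hom_nonneg θ (sub_nonneg.2 h)

lemma hom_le_one (θ : A →⋆ₐ[ℂ] A) {a : A} (h : a ≤ 1) : θ a ≤ 1 := by
  simpa using hom_mono θ h

lemma inv_le (P Ps τ : A →ₚ[ℂ] ℂ) (hP : ∀ a b, P (a * b) = P (b * a))
    (hτ : ∀ a, τ a = P a + Ps a) (hc : Hcont S P) (u : ℕ → A) (hm : Monotone u)
    (h0 : ∀ n, 0 ≤ u n) (h1 : ∀ n, u n ≤ 1) (hPs : ∀ n, nrm Ps (u n) = 0)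
    (hPst : ∀ a b, Ps (a * b) = Ps (b * a)) (hu : S.SC u 1)
    (θ ψ : A →⋆ₐ[ℂ] A) (hθψ : ∀ a, ψ (θ a) = a) (hψθ : ∀ a, θ (ψ a) = a)
    (hinv : ∀ a, τ (θ a) = τ a) (a : A) : nrm P (θ a) ≤ nrm P a := by
  -- strong limit of `θ (u k)` is one
  obtain ⟨b, hb, hbu, hb0, hb1⟩ := S.monotone_sc (a := fun n => θ (u n))
    (fun _ _ h => hom_mono θ (hm h)) (fun n => hom_nonneg θ (h0 n)) (fun n => hom_le_one θ (h1 n))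
  have hb' : b = 1 := by
    have h2 : 1 ≤ ψ b := by
      refine hu.le_of_le S (fun n => (h0 n).isSelfAdjoint) (hom_nonneg ψ hb0).isSelfAdjoint
        (Eventually.of_forall fun n => ?_)
      have := hom_mono ψ (hbu n)
      rwa [hθψ] at this
    have h3 := hom_mono θ h2
    rw [hψθ, map_one] at h3
    exact le_antisymm hb1 h3
  subst hb'
  have hbd : ∀ n, ‖θ (u n)‖ ≤ 1 := fun n =>
    norm_le_of_le_one (hom_nonneg θ (h0 n)) (hom_le_one θ (h1 n))
  have hlim := hc.tendsto S (a := fun n => θ (u n) * θ a) (b := 1 * θ a) (C := 1 * ‖θ a‖)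
    (fun n => (norm_mul_le _ _).trans (mul_le_mul_of_nonneg_right (hbd n) (norm_nonneg _)))
    (hb.mul_right S _)
  have key : ∀ n, nrm P (θ (u n) * θ a) ≤ nrm P a := by
    intro n
    have e1 : nrm Ps (u n * a) = 0 := by
      refine le_antisymm ((nrm_mul_le' hPst _ _).trans ?_) (nrm_nonneg _ _)
      rw [hPs, zero_mul]
    have e2 : nrm P (θ (u n) * θ a) ^ 2 ≤ nrm P (u n * a) ^ 2 := by
      rw [← map_mul θ, nrm_sq, nrm_sq, ← map_star θ, ← map_mul θ]
      have h1 := hinv (star (u n * a) * (u n * a))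
      have h2 := congrArg Complex.re h1
      rw [hτ, hτ, Complex.add_re, Complex.add_re, ← nrm_sq Ps (u n * a), e1] at h2
      have h3 := re_nonneg Ps (hom_nonneg θ (star_mul_self_nonneg (u n * a)))
      linarith
    have e3 : nrm P (u n * a) ≤ nrm P a := (nrm_mul_le P _ _).trans (by
      have := norm_le_of_le_one (h0 n) (h1 n)
      nlinarith [nrm_nonneg P a])
    exact (abs_le_of_sq_le_sq' e2 (nrm_nonneg _ _)).2.trans e3
  have h4 : ∀ n, nrm P (θ a) ≤ nrm P (θ (u n) * θ a - 1 * θ a) + nrm P a := by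
    intro n
    have : θ a = θ (u n) * θ a - (θ (u n) * θ a - 1 * θ a) := by simp
    have h5 := nrm_sub_le P (θ (u n) * θ a) (θ (u n) * θ a - 1 * θ a)
    rw [← this] at h5
    linarith [key n]
  have h5 := hlim.add_const (nrm P a)
  rw [zero_add] at h5
  exact ge_of_tendsto' h5 h4

end inv
end TailProof

namespace TailProof
section F3
variable {A H : Type} [CStarAlgebra A] [PartialOrder A] [StarOrderedRing A]
    [NormedAddCommGroup H] [InnerProductSpace ℂ H] [CompleteSpace H] (S : VNRep A H)

lemma norm_sq_le_of_KL {d D : A} {r : ℝ} (hr : 0 < r) (hD0 : 0 ≤ D) (hD1 : D ≤ 1)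
    (hD : D ≤ res (r • (star d * d))) : ‖d * D‖ ^ 2 ≤ 1 / r := by
  have hc : 0 ≤ r • (star d * d) := rsmul_nonneg r hr.le (star_mul_self_nonneg d)
  set c := r • (star d * d) with hcd
  have h1 : ‖d * D‖ ^ 2 = ‖d * (D * D) * star d‖ := by
    rw [sq, ← CStarRing.norm_self_mul_star (x := d * D), star_mul, hD0.isSelfAdjoint.star_eq]
    simp only [mul_assoc]
  have hx0 : 0 ≤ d * res c * star d := star_right_conjugate_nonneg (res_nonneg hc) d
  have h2 : d * (D * D) * star d ≤ d * res c * star d :=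
    star_right_conjugate_le_conjugate ((sq_le_self_of_le_one hD0 hD1).trans hD) d
  have h20 : 0 ≤ d * (D * D) * star d := by
    refine star_right_conjugate_nonneg ?_ d
    have := star_mul_self_nonneg D
    rwa [hD0.isSelfAdjoint.star_eq] at this
  have h3 := CStarAlgebra.norm_le_norm_of_nonneg_of_le h20 h2
  rw [h1]
  refine h3.trans ?_
  set x := d * res c * star d with hx
  have h4 : r • (x * x) = d * (res c * (1 - res c)) * star d := by
    rw [← mul_res_eq hc, hx]
    generalize res c = R
    rw [hcd]
    simp only [mul_smul_comm, smul_mul_assoc, mul_assoc]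
  have h5 : r • (x * x) ≤ x := by
    rw [h4]
    refine star_right_conjugate_le_conjugate ?_ d
    have h6 : res c * (1 - res c) = res c - res c * res c := by rw [mul_sub, mul_one]
    rw [h6]
    refine sub_le_self _ ?_
    have := star_mul_self_nonneg (res c)
    rwa [star_res hc] at this
  have hxx : 0 ≤ x * x := by
    have := star_mul_self_nonneg x
    rwa [hx0.isSelfAdjoint.star_eq] at this
  have h6 := CStarAlgebra.norm_le_norm_of_nonneg_of_le (rsmul_nonneg r hr.le hxx) h5
  rw [norm_smul, Real.norm_eq_abs, abs_of_pos hr] at h6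
  have h7 : ‖x * x‖ = ‖x‖ * ‖x‖ := by
    have := CStarRing.norm_star_mul_self (x := x)
    rwa [hx0.isSelfAdjoint.star_eq] at this
  rw [h7] at h6
  rw [le_div_iff₀ hr]
  by_contra hcon
  push Not at hcon
  have : 0 < ‖x‖ := by
    by_contra h0
    have : ‖x‖ = 0 := le_antisymm (not_lt.1 h0) (norm_nonneg _)
    rw [this] at hcon; linarith
  nlinarith

theorem F3 {P : A →ₚ[ℂ] ℂ} (hP : Hcont S P) (hf : ∀ a, nrm P a = 0 → a = 0)
    {b : ℕ → A} {C : ℝ} (hC : ∀ n, ‖b n‖ ≤ C)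
    (hb : ∀ j, nrm P (b (j + 1) - b j) ≤ (1 / 4) ^ (j + 1)) : ∃ a, S.SC b a := by
  set d : ℕ → A := fun j => b (j + 1) - b j with hd
  have hpos : ∀ k : ℕ, 0 ≤ ((4 : ℝ) ^ k) • (star (d k) * d k) := fun k =>
    rsmul_nonneg _ (by positivity) (star_mul_self_nonneg _)
  obtain ⟨B, hB, hB0, hB1, hBanti, hBr⟩ := KL hpos S
  have hbb : ∀ n m, ‖bb (fun k : ℕ => ((4 : ℝ) ^ k) • (star (d k) * d k)) n m‖ ≤ 1 :=
    fun n m => norm_le_of_le_one (bb_nonneg hpos _ _) (bb_le_one hpos _ _)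
  have hPb : ∀ n, (P (B n)).re ≤ 1 / 2 ^ n := by
    intro n
    refine le_of_tendsto (re_tendsto_of_nrm (hP.tendsto S (hbb n) (hB n)))
      (Eventually.of_forall fun m => ?_)
    refine (re_mono _ (bb_le_sum hpos n m)).trans ?_
    rw [re_sum]
    calc _ ≤ ∑ k ∈ Finset.range m, (1 / 2 ^ n) / 2 / 2 ^ k := Finset.sum_le_sum fun k _ => by
          rw [re_smul, ← nrm_sq]
          have h1 := hb (n + k)
          have h2 : nrm P (d (n + k)) ^ 2 ≤ ((1 / 4) ^ (n + k + 1)) ^ 2 :=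
            pow_le_pow_left₀ (nrm_nonneg _ _) h1 2
          refine (mul_le_mul_of_nonneg_left h2 (by positivity)).trans ?_
          have h3 : (1 / 2 ^ n) / 2 / 2 ^ k = (1 / 2 : ℝ) ^ (n + k + 1) := by
            rw [one_div_pow, pow_succ, pow_add]; field_simp
          have h4 : (4 : ℝ) ^ (n + k) * ((1 / 4) ^ (n + k + 1)) ^ 2 =
              (1 / 4) ^ (n + k + 1) * (1 / 4) := by
            simp only [one_div_pow, pow_succ]; field_simp
          rw [h3, h4]
          have h5 : (1 / 4 : ℝ) ^ (n + k + 1) ≤ (1 / 2) ^ (n + k + 1) :=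
            pow_le_pow_left₀ (by norm_num) (by norm_num) _
          have : (0 : ℝ) ≤ (1 / 4) ^ (n + k + 1) := by positivity
          linarith
      _ ≤ ∑' k : ℕ, (1 / 2 ^ n : ℝ) / 2 / 2 ^ k := Summable.sum_le_tsum _
          (fun _ _ => by positivity) (summable_geometric_two' _)
      _ = 1 / 2 ^ n := tsum_geometric_two' _
  have hu0 : ∀ n, 0 ≤ 1 - B n := fun n => sub_nonneg.2 (hB1 n)
  have hu1 : ∀ n, 1 - B n ≤ 1 := fun n => sub_le_self _ (hB0 n)
  have hum : Monotone (fun n => 1 - B n) := fun m n h => sub_le_sub_left (hBanti h) _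
  have hSC : S.SC (fun n => 1 - B n) 1 := by
    obtain ⟨u, hu, hun, hu0', hu1'⟩ := S.monotone_sc hum hu0 hu1
    have : 1 - u = 0 := by
      apply hf
      have h10 : 0 ≤ 1 - u := sub_nonneg.2 hu1'
      have h2 : (P (1 - u)).re ≤ 0 := by
        refine ge_of_tendsto' (x := atTop) (f := fun n : ℕ => (1 / 2 : ℝ) ^ n)
          (tendsto_pow_atTop_nhds_zero_of_lt_one (by norm_num) (by norm_num)) (fun n => ?_)
        have h3 : 1 - u ≤ B n := by
          have := hun n
          rw [sub_le_comm]; exact this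
        refine (re_mono _ h3).trans ((hPb n).trans (le_of_eq ?_))
        rw [one_div_pow]
      have := (nrm_sq_le_of_le_one P h10 (sub_le_self _ hu0')).trans h2
      nlinarith [nrm_nonneg P (1 - u)]
    rw [sub_eq_zero] at this
    have hu2 : u = 1 := this.symm
    rw [hu2] at hu; exact hu
  have hdB : ∀ n k, ‖d (n + k) * (1 - B n)‖ ≤ (1 / 2) ^ k := by
    intro n k
    have h1 := norm_sq_le_of_KL (d := d (n + k)) (r := (4 : ℝ) ^ (n + k)) (by positivity)
      (hu0 n) (hu1 n) (hBr n k)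
    have h2 : (1 : ℝ) / 4 ^ (n + k) = ((1 / 2) ^ (n + k)) ^ 2 := by
      rw [← pow_mul, mul_comm, pow_mul]; norm_num [one_div_pow]
    rw [h2] at h1
    refine (abs_le_of_sq_le_sq' h1 (by positivity)).2.trans ?_
    exact pow_le_pow_of_le_one (by norm_num) (by norm_num) (by omega)
  refine S.closed b C hC (fun ξ => ?_)
  refine cauchySeq_tendsto_of_complete ?_
  rw [Metric.cauchySeq_iff']
  intro ε hε
  have hC0 : 0 ≤ C := (norm_nonneg _).trans (hC 0)
  obtain ⟨n, hn⟩ := ((Metric.tendsto_atTop.1 (hSC ξ)) (ε / (4 * (C + 1))) (by positivity))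
  have hn := hn n le_rfl
  set η := S.π (1 - B n) ξ with hη
  have hcau : CauchySeq (fun k => S.π (b (n + k)) η) := by
    refine cauchySeq_of_le_geometric (1 / 2) ‖ξ‖ (by norm_num) (fun k => ?_)
    rw [dist_comm, dist_eq_norm, ← ContinuousLinearMap.sub_apply, ← map_sub, hη, ← S.mul_app]
    refine (S.norm_le _ _).trans ?_
    rw [mul_comm]
    exact mul_le_mul_of_nonneg_left (hdB n k) (norm_nonneg _)
  obtain ⟨N, hN⟩ := Metric.cauchySeq_iff'.1 hcau (ε / 4) (by positivity)
  have hclose : ∀ m, dist (S.π (b m) ξ) (S.π (b m) η) ≤ ε / 4 := by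
    intro m
    rw [dist_eq_norm, ← map_sub]
    rw [dist_comm, dist_eq_norm, map_one] at hn
    refine (S.norm_le _ _).trans ?_
    have h1 : ‖ξ - η‖ ≤ ε / (4 * (C + 1)) := hn.le
    calc ‖b m‖ * ‖ξ - η‖ ≤ (C + 1) * (ε / (4 * (C + 1))) :=
          mul_le_mul ((hC m).trans (by linarith)) h1 (norm_nonneg _) (by positivity)
      _ = ε / 4 := by field_simp
  refine ⟨n + N, fun m hm => ?_⟩
  obtain ⟨k, rfl⟩ := Nat.exists_eq_add_of_le hm
  have h1 := hN (N + k) (by omega)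
  have h2 := hclose (n + N + k)
  have h3 := hclose (n + N)
  rw [dist_comm] at h3
  rw [← add_assoc] at h1
  have h4 := dist_triangle4 (S.π (b (n + N + k)) ξ) (S.π (b (n + N + k)) η) (S.π (b (n + N)) η)
    (S.π (b (n + N)) ξ)
  linarith

/-- bounded limits in the `P`-norm come from elements -/
theorem F3' {P : A →ₚ[ℂ] ℂ} (hP : Hcont S P) (hf : ∀ a, nrm P a = 0 → a = 0)
    {b : ℕ → A} {C : ℝ} (hC : ∀ n, ‖b n‖ ≤ C) {v : P.GNS}
    (hb : Tendsto (fun n => hat P (b n)) atTop (𝓝 v)) :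
    ∃ a, hat P a = v ∧ ∃ f : ℕ → ℕ, S.SC (fun n => b (f n)) a := by
  have h1 : ∀ j : ℕ, ∃ n, ‖hat P (b n) - v‖ ≤ (1 / 4) ^ (j + 1) / 2 := fun j => by
    obtain ⟨n, hn⟩ := Metric.tendsto_atTop.1 hb ((1 / 4) ^ (j + 1) / 2) (by positivity)
    exact ⟨n, by rw [← dist_eq_norm]; exact (hn n le_rfl).le⟩
  choose f hf' using h1
  obtain ⟨a, ha⟩ := F3 S hP hf (b := fun n => b (f n)) (fun n => hC (f n)) (fun j => by
    rw [← norm_hat, map_sub]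
    have e : hat P (b (f (j + 1))) - hat P (b (f j)) =
      (hat P (b (f (j + 1))) - v) - (hat P (b (f j)) - v) := by abel
    rw [e]
    refine (norm_sub_le _ _).trans ?_
    have h2 := hf' (j + 1)
    have h3 := hf' j
    have h4 : (1 / 4 : ℝ) ^ (j + 1 + 1) ≤ (1 / 4) ^ (j + 1) :=
      pow_le_pow_of_le_one (by norm_num) (by norm_num) (by omega)
    linarith)
  refine ⟨a, ?_, f, ha⟩
  have h2 := hP.tendsto S (fun n => hC (f n)) ha
  have h3 : Tendsto (fun n => hat P (b (f n))) atTop (𝓝 (hat P a)) := by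
    rw [tendsto_iff_norm_sub_tendsto_zero]
    simpa only [← map_sub, norm_hat] using h2
  refine tendsto_nhds_unique h3 ?_
  rw [tendsto_iff_norm_sub_tendsto_zero]
  refine squeeze_zero (fun _ => norm_nonneg _) hf' ?_
  have := (tendsto_pow_atTop_nhds_zero_of_lt_one (r := (1 / 4 : ℝ)) (by norm_num)
    (by norm_num)).comp (tendsto_add_atTop_nat 1)
  simpa using this.div_const 2

end F3
end TailProof

namespace TailProof
section dc
variable {H : Type} [NormedAddCommGroup H] [InnerProductSpace ℂ H] [CompleteSpace H]
variable {ι : Type} [Fintype ι]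

/-- diagonal operator -/
noncomputable def dg (ι : Type) [Fintype ι] (t : H →L[ℂ] H) :
    PiLp 2 (fun _ : ι => H) →L[ℂ] PiLp 2 (fun _ : ι => H) :=
  ((PiLp.continuousLinearEquiv 2 ℂ (fun _ : ι => H)).symm : (ι → H) →L[ℂ] PiLp 2 (fun _ : ι => H)) ∘L
    (ContinuousLinearMap.pi fun i => t ∘L ContinuousLinearMap.proj i) ∘L
    ((PiLp.continuousLinearEquiv 2 ℂ (fun _ : ι => H)) : PiLp 2 (fun _ : ι => H) →L[ℂ] (ι → H))

lemma dg_apply (t : H →L[ℂ] H) (v : PiLp 2 (fun _ : ι => H)) (i : ι) : dg ι t v i = t (v i) := rfl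

lemma dg_adj (t : H →L[ℂ] H) (u v : PiLp 2 (fun _ : ι => H)) :
    ⟪dg ι t u, v⟫_ℂ = ⟪u, dg ι (star t) v⟫_ℂ := by
  rw [PiLp.inner_apply, PiLp.inner_apply]
  refine Finset.sum_congr rfl fun i _ => ?_
  rw [dg_apply, dg_apply, ContinuousLinearMap.star_eq_adjoint, ContinuousLinearMap.adjoint_inner_right]

variable [DecidableEq ι]

lemma dg_comm {X : Set (H →L[ℂ] H)} {a : H →L[ℂ] H}
    (ha : a ∈ Set.centralizer (Set.centralizer X))
    (p : PiLp 2 (fun _ : ι => H) →L[ℂ] PiLp 2 (fun _ : ι => H))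
    (hp : ∀ x ∈ X, ∀ v, p (dg ι x v) = dg ι x (p v)) (v) : p (dg ι a v) = dg ι a (p v) := by
  let In : ι → (H →L[ℂ] PiLp 2 (fun _ : ι => H)) := fun j =>
    ((PiLp.continuousLinearEquiv 2 ℂ (fun _ : ι => H)).symm : (ι → H) →L[ℂ] PiLp 2 (fun _ : ι => H)) ∘L
      (ContinuousLinearMap.single ℂ (fun _ : ι => H) j)
  let Pr : ι → (PiLp 2 (fun _ : ι => H) →L[ℂ] H) := fun j =>
    (ContinuousLinearMap.proj (R := ℂ) (φ := fun _ : ι => H) j) ∘L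
      ((PiLp.continuousLinearEquiv 2 ℂ (fun _ : ι => H)) : PiLp 2 (fun _ : ι => H) →L[ℂ] (ι → H))
  have hIn : ∀ (t : H →L[ℂ] H) j h, dg ι t (In j h) = In j (t h) := by
    intro t j h
    ext i
    rw [dg_apply]
    change t ((Pi.single j h : ι → H) i) = (Pi.single j (t h) : ι → H) i
    by_cases hij : i = j
    · subst hij; simp
    · simp [hij]
  have hPr : ∀ (t : H →L[ℂ] H) j w, Pr j (dg ι t w) = t (Pr j w) := fun t j w => rfl
  have hv : v = ∑ j, In j (v j) := by
    ext i
    have : (∑ j, In j (v j)) i = ∑ j, (In j (v j)) i := by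
      change Pr i (∑ j, In j (v j)) = _
      rw [map_sum]; rfl
    rw [this]
    change v i = ∑ j, (Pi.single j (v j) : ι → H) i
    rw [Finset.sum_pi_single]; simp
  have hc : ∀ i j, (Pr i ∘L p ∘L In j) ∈ Set.centralizer X := by
    intro i j x hx
    ext h
    change x (Pr i (p (In j h))) = Pr i (p (In j (x h)))
    rw [← hIn, hp x hx, hPr]
  have hm : ∀ i j h, Pr i (p (In j (a h))) = a (Pr i (p (In j h))) := by
    intro i j h
    have := ha _ (hc i j)
    exact congrArg (fun T : H →L[ℂ] H => T h) this
  rw [hv]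
  simp only [map_sum]
  refine Finset.sum_congr rfl fun j _ => ?_
  ext i
  rw [hIn]
  exact hm i j _

end dc

section dc2
variable {A H : Type} [CStarAlgebra A] [PartialOrder A] [StarOrderedRing A]
    [NormedAddCommGroup H] [InnerProductSpace ℂ H] [CompleteSpace H] (S : VNRep A H)

def InVN (X : Set A) (a : A) : Prop := S.π a ∈ Set.centralizer (Set.centralizer (S.π '' X))

lemma dc_approx {X : Set A} (hX : ∀ x ∈ X, star x ∈ X) {a : A} (ha : InVN S X a)
    (ι : Type) [Fintype ι] (ξ : ι → H) {δ : ℝ} (hδ : 0 < δ) :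
    ∃ b ∈ Algebra.adjoin ℂ X, ∀ i, ‖S.π (b - a) (ξ i)‖ < δ := by
  classical
  set v : PiLp 2 (fun _ : ι => H) := WithLp.toLp 2 ξ with hv
  let K0 : Submodule ℂ (PiLp 2 (fun _ : ι => H)) :=
    { carrier := {w | ∃ b ∈ Algebra.adjoin ℂ X, w = dg ι (S.π b) v}
      zero_mem' := ⟨0, zero_mem _, by ext i; rw [dg_apply]; simp⟩
      add_mem' := by
        rintro _ _ ⟨b, hb, rfl⟩ ⟨c, hc, rfl⟩
        exact ⟨b + c, add_mem hb hc, by ext i; simp [dg_apply]⟩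
      smul_mem' := by
        rintro r _ ⟨b, hb, rfl⟩
        exact ⟨r • b, Subalgebra.smul_mem _ hb r, by ext i; simp [dg_apply]⟩ }
  have hK0 : ∀ x ∈ X, ∀ w ∈ K0, dg ι (S.π x) w ∈ K0 := by
    rintro x hx _ ⟨b, hb, rfl⟩
    exact ⟨x * b, mul_mem (Algebra.subset_adjoin hx) hb, by ext i; simp [dg_apply]⟩
  set K := K0.topologicalClosure with hK
  have hK1 : ∀ x ∈ X, ∀ w ∈ K, dg ι (S.π x) w ∈ K := by
    intro x hx w hw
    exact map_mem_closure (dg ι (S.π x)).continuous hw (fun w hw => hK0 x hx w hw)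
  haveI : CompleteSpace K := (Submodule.isClosed_topologicalClosure K0).completeSpace_coe
  have hvK : v ∈ K := Submodule.le_topologicalClosure _ ⟨1, one_mem _, by ext i; simp [dg_apply]⟩
  have hpc : ∀ w, K.starProjection (dg ι (S.π a) w) = dg ι (S.π a) (K.starProjection w) := by
    refine dg_comm ha _ ?_
    rintro _ ⟨x, hx, rfl⟩ w
    exact proj_comm K (dg ι (S.π x)) (dg ι (S.π (star x)))
      (by intro u w; rw [map_sub]) (by intro u w; rw [dg_adj, map_star])
      (hK1 x hx) (hK1 _ (hX x hx)) w
  have haK : dg ι (S.π a) v ∈ K := by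
    have := hpc v
    rw [Submodule.starProjection_eq_self_iff.2 hvK] at this
    exact Submodule.starProjection_eq_self_iff.1 this
  obtain ⟨w, ⟨b, hb, rfl⟩, hw⟩ := Metric.mem_closure_iff.1 haK δ hδ
  refine ⟨b, hb, fun i => ?_⟩
  rw [dist_comm, dist_eq_norm] at hw
  refine lt_of_le_of_lt ?_ hw
  refine le_trans (le_of_eq ?_) (PiLp.norm_apply_le _ i)
  simp [dg_apply, hv]

end dc2
end TailProof

namespace TailProof
section kap
variable {A H : Type} [CStarAlgebra A] [PartialOrder A] [StarOrderedRing A]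
    [NormedAddCommGroup H] [InnerProductSpace ℂ H] [CompleteSpace H] (S : VNRep A H)

lemma sa_approx {X : Set A} (hX : ∀ x ∈ X, star x ∈ X) {a : A} (ha : InVN S X a)
    (hsa : IsSelfAdjoint a)
    (ι : Type) [Fintype ι] (ξ : ι → H) {δ : ℝ} (hδ : 0 < δ) :
    ∃ b ∈ StarAlgebra.adjoin ℂ X, IsSelfAdjoint b ∧ ∀ i, ‖S.π (b - a) (ξ i)‖ < δ := by
  set v : PiLp 2 (fun _ : ι => H) := WithLp.toLp 2 ξ with hv
  set L : Set (PiLp 2 (fun _ : ι => H)) :=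
    {w | ∃ b ∈ StarAlgebra.adjoin ℂ X, IsSelfAdjoint b ∧ w = dg ι (S.π b) v} with hL
  have hsm : ∀ (r : ℝ) (b : A), S.π (r • b) = r • S.π b := fun r b => by
    ext ζ
    have : r • b = (r : ℂ) • b := (Complex.coe_smul r b).symm
    rw [this, smul_app]; simp
  have hmem : ∀ (r : ℝ) {b : A}, b ∈ StarAlgebra.adjoin ℂ X → r • b ∈ StarAlgebra.adjoin ℂ X := by
    intro r b hb
    have : r • b = (r : ℂ) • b := (Complex.coe_smul r b).symm
    rw [this]
    exact SMulMemClass.smul_mem _ hb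
  have hconv : Convex ℝ L := by
    rintro _ ⟨b, hb, hbs, rfl⟩ _ ⟨c, hc, hcs, rfl⟩ r t _ _ _
    refine ⟨r • b + t • c, add_mem (hmem r hb) (hmem t hc),
      ((IsSelfAdjoint.all r).smul hbs).add ((IsSelfAdjoint.all t).smul hcs), ?_⟩
    ext i
    simp [dg_apply, hsm]
  have key : dg ι (S.π a) v ∈ closure L := by
    by_contra hcon
    obtain ⟨f, u, hf1, hf2⟩ := RCLike.geometric_hahn_banach_closed_point (𝕜 := ℂ)
      hconv.closure isClosed_closure hcon
    set η := (InnerProductSpace.toDual ℂ (PiLp 2 (fun _ : ι => H))).symm f with hη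
    have hfη : ∀ w, f w = ⟪η, w⟫_ℂ := fun w => by
      rw [hη, InnerProductSpace.toDual_symm_apply]
    have hz : ∀ b ∈ StarAlgebra.adjoin ℂ X, IsSelfAdjoint b →
        (f (dg ι (S.π b) v)).re = 0 := by
      intro b hb hbs
      have h1 : ∀ r : ℝ, r * (f (dg ι (S.π b) v)).re < u := by
        intro r
        have h2 := hf1 (dg ι (S.π (r • b)) v) (subset_closure ⟨r • b, hmem r hb,
          (IsSelfAdjoint.all r).smul hbs, rfl⟩)
        have h3 : dg ι (S.π (r • b)) v = (r : ℂ) • dg ι (S.π b) v := by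
          ext i
          simp [dg_apply, hsm]
        rw [h3, map_smul] at h2
        simpa using h2
      by_contra h0
      have h2 := h1 (u / (f (dg ι (S.π b) v)).re)
      rw [div_mul_cancel₀ _ h0] at h2
      exact lt_irrefl _ h2
    have hu : 0 < u := by
      have := hf1 (dg ι (S.π 0) v) (subset_closure ⟨0, zero_mem _, IsSelfAdjoint.zero _, rfl⟩)
      rw [show RCLike.re (f (dg ι (S.π 0) v)) = (f (dg ι (S.π 0) v)).re from rfl,
        hz 0 (zero_mem _) (IsSelfAdjoint.zero _)] at this
      exact this
    have hω : 0 < (f (dg ι (S.π a) v)).re := hu.trans hf2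
    -- approximate
    set R : ℝ := ‖η‖ + ‖v‖ + 1 with hR
    have hR0 : 0 < R := by positivity
    set N : ℝ := √(Fintype.card ι + 1) with hN
    have hN0 : 0 < N := by positivity
    set r := (f (dg ι (S.π a) v)).re with hr
    obtain ⟨b, hb, hbξ⟩ := dc_approx S hX ha (ι ⊕ ι) (Sum.elim ξ (fun i => η i))
      (δ := r / (R * N)) (by positivity)
    have hb' : b ∈ StarAlgebra.adjoin ℂ X := by
      have : Algebra.adjoin ℂ X ≤ (StarAlgebra.adjoin ℂ X).toSubalgebra :=
        Algebra.adjoin_le (StarAlgebra.subset_adjoin ℂ X)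
      exact this hb
    have hnn : ∀ w : PiLp 2 (fun _ : ι => H), (∀ i, ‖S.π (b - a) (w i)‖ < r / (R * N)) →
        ‖dg ι (S.π (b - a)) w‖ ≤ r / R := by
      intro w hw
      rw [PiLp.norm_eq_of_L2]
      refine Real.sqrt_le_iff.2 ⟨by positivity, ?_⟩
      calc _ ≤ ∑ i : ι, (r / (R * N)) ^ 2 := Finset.sum_le_sum fun i _ =>
            pow_le_pow_left₀ (norm_nonneg _) (hw i).le 2
        _ = Fintype.card ι * (r / (R * N)) ^ 2 := by simp
        _ ≤ (N ^ 2) * (r / (R * N)) ^ 2 := by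
            refine mul_le_mul_of_nonneg_right ?_ (by positivity)
            rw [hN, Real.sq_sqrt (by positivity)]; linarith
        _ = (r / R) ^ 2 := by field_simp
    have h1 := hnn v (fun i => hbξ (Sum.inl i))
    have h2 := hnn η (fun i => hbξ (Sum.inr i))
    have h3 : (f (dg ι (S.π (b + star b)) v)).re = 0 := hz _ (add_mem hb' (star_mem hb'))
      (IsSelfAdjoint.add_star_self b)
    have h4 : f (dg ι (S.π (b + star b)) v) = f (dg ι (S.π a) v) + f (dg ι (S.π a) v)
        + ⟪η, dg ι (S.π (b - a)) v⟫_ℂ + ⟪dg ι (S.π (b - a)) η, v⟫_ℂ := by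
      have e1 : dg ι (S.π (b + star b)) v = dg ι (S.π a) v + dg ι (S.π a) v +
          dg ι (S.π (b - a)) v + dg ι (S.π (star (b - a))) v := by
        ext i
        simp [dg_apply, hsa.star_eq]
        abel
      rw [e1, map_add, map_add, map_add, hfη (dg ι (S.π (b - a)) v), dg_adj, ← map_star,
        hfη (dg ι (S.π (star (b - a))) v)]
    rw [h4] at h3
    simp only [Complex.add_re] at h3
    have h5 : |(⟪η, dg ι (S.π (b - a)) v⟫_ℂ).re| ≤ ‖η‖ * (r / R) :=
      (Complex.abs_re_le_norm _).trans ((norm_inner_le_norm _ _).trans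
        (mul_le_mul_of_nonneg_left h1 (norm_nonneg _)))
    have h6 : |(⟪dg ι (S.π (b - a)) η, v⟫_ℂ).re| ≤ (r / R) * ‖v‖ :=
      (Complex.abs_re_le_norm _).trans ((norm_inner_le_norm _ _).trans
        (mul_le_mul_of_nonneg_right h2 (norm_nonneg _)))
    have h7 : (‖η‖ + ‖v‖) * (r / R) ≤ r := by
      rw [mul_div_assoc', div_le_iff₀ hR0, mul_comm]
      exact mul_le_mul_of_nonneg_left (by linarith) hω.le
    have h8 := (_root_.abs_le.1 h5).1
    have h9 := (_root_.abs_le.1 h6).1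
    nlinarith
  obtain ⟨w, ⟨b, hb, hbs, rfl⟩, hw⟩ := Metric.mem_closure_iff.1 key δ hδ
  refine ⟨b, hb, hbs, fun i => ?_⟩
  rw [dist_comm, dist_eq_norm] at hw
  refine lt_of_le_of_lt ?_ hw
  refine le_trans (le_of_eq ?_) (PiLp.norm_apply_le _ i)
  simp [dg_apply, hv]
end kap
end TailProof

namespace TailProof
section kap2
variable {A H : Type} [CStarAlgebra A] [PartialOrder A] [StarOrderedRing A]
    [NormedAddCommGroup H] [InnerProductSpace ℂ H] [CompleteSpace H] (S : VNRep A H)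

/-- truncation -/
noncomputable def tr (s : ℝ) (b : A) : A := b * res (s • (star b * b))

lemma tr_arg {s : ℝ} (hs : 0 < s) (b : A) : 0 ≤ s • (star b * b) :=
  rsmul_nonneg s hs.le (star_mul_self_nonneg b)

lemma tr_norm {s : ℝ} (hs : 0 < s) (b : A) : ‖tr s b‖ ≤ 1 / √s := by
  have h := norm_sq_le_of_KL hs (res_nonneg (tr_arg hs b)) (res_le_one (tr_arg hs b)) le_rfl
  have h2 : 1 / s = (1 / √s) ^ 2 := by rw [div_pow, Real.sq_sqrt hs.le]; simp
  rw [h2] at h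
  exact (abs_le_of_sq_le_sq' h (by positivity)).2

lemma norm_res_le {d : A} (hd : 0 ≤ d) : ‖res d‖ ≤ 1 :=
  norm_le_of_le_one (res_nonneg hd) (res_le_one hd)

lemma tr_sub {s : ℝ} (hs : 0 < s) (b : A) : ‖tr s b - b‖ ≤ s * ‖b‖ ^ 3 := by
  have h : b - tr s b = b * (s • (star b * b)) * res (s • (star b * b)) := by
    rw [mul_assoc, mul_res_eq (tr_arg hs b), mul_sub, mul_one, tr]
  rw [norm_sub_rev, h]
  refine (norm_mul_le _ _).trans ?_
  have h1 : ‖b * (s • (star b * b))‖ ≤ s * ‖b‖ ^ 3 := by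
    refine (norm_mul_le _ _).trans ?_
    rw [norm_smul, CStarRing.norm_star_mul_self, Real.norm_eq_abs, abs_of_pos hs]
    exact le_of_eq (by ring)
  have h2 := norm_res_le (tr_arg hs b)
  nlinarith [norm_nonneg (res (s • (star b * b))), norm_nonneg (b * (s • (star b * b)))]

lemma tr_comm {s : ℝ} (hs : 0 < s) {b : A} (hb : IsSelfAdjoint b) :
    res (s • (star b * b)) * b = tr s b := by
  have : Commute b (res (s • (star b * b))) := by
    refine res_comm (tr_arg hs b) ?_
    rw [hb.star_eq]
    exact ((Commute.refl b).mul_right (Commute.refl b)).smul_right s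
  exact this.eq.symm

lemma tr_diff {s : ℝ} (hs : 0 < s) {a b : A} (ha : IsSelfAdjoint a) (hb : IsSelfAdjoint b) :
    tr s b - tr s a = res (s • (star b * b)) * ((b - a) * res (s • (star a * a)))
      - s • (tr s b * ((b - a) * tr s a)) := by
  have hA := mul_res (tr_arg hs a)
  have hB := res_mul (tr_arg hs b)
  have e1 : tr s b = res (s • (star b * b)) * b * ((1 + s • (star a * a)) * res (s • (star a * a))) := by
    rw [hA, mul_one, tr_comm hs hb]
  have e2 : tr s a = (res (s • (star b * b)) * (1 + s • (star b * b))) * a * res (s • (star a * a)) := by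
    rw [hB, one_mul, tr]
  have e3 : tr s b * ((b - a) * tr s a) = res (s • (star b * b)) * b * ((b - a) * (a * res (s • (star a * a)))) := by
    rw [tr_comm hs hb]; rfl
  rw [e3, e1, e2, ha.star_eq, hb.star_eq]
  simp only [mul_add, add_mul, mul_sub, sub_mul, mul_one, one_mul, smul_mul_assoc, mul_smul_comm,
    mul_assoc, smul_sub]
  abel

lemma nrm_tr_diff {P : A →ₚ[ℂ] ℂ} (hP : ∀ a b, P (a * b) = P (b * a)) {s : ℝ} (hs : 0 < s)
    {a b : A} (ha : IsSelfAdjoint a) (hb : IsSelfAdjoint b) :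
    nrm P (tr s b - tr s a) ≤ 2 * nrm P (b - a) := by
  rw [tr_diff hs ha hb]
  refine (nrm_sub_le P _ _).trans ?_
  have h1 : nrm P (res (s • (star b * b)) * ((b - a) * res (s • (star a * a)))) ≤ nrm P (b - a) := by
    refine (nrm_mul_le P _ _).trans ?_
    have := nrm_mul_le' hP (b - a) (res (s • (star a * a)))
    have h2 := norm_res_le (tr_arg hs a)
    have h3 := norm_res_le (tr_arg hs b)
    have h4 := nrm_nonneg P (b - a)
    have h5 : nrm P ((b - a) * res (s • (star a * a))) ≤ nrm P (b - a) := by nlinarith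
    nlinarith [nrm_nonneg P ((b - a) * res (s • (star a * a))), norm_nonneg (res (s • (star b * b)))]
  have h2 : nrm P (s • (tr s b * ((b - a) * tr s a))) ≤ nrm P (b - a) := by
    rw [← Complex.coe_smul, nrm_smul]
    have e1 : nrm P (tr s b * ((b - a) * tr s a)) ≤ 1 / √s * (nrm P (b - a) * (1 / √s)) := by
      refine (nrm_mul_le P _ _).trans ?_
      refine mul_le_mul (tr_norm hs b) ?_ (nrm_nonneg _ _) (by positivity)
      exact (nrm_mul_le' hP _ _).trans (mul_le_mul_of_nonneg_left (tr_norm hs a) (nrm_nonneg _ _))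
    have e2 : ‖(s : ℂ)‖ = √s * √s := by
      rw [Complex.norm_real, Real.norm_eq_abs, abs_of_pos hs, Real.mul_self_sqrt hs.le]
    rw [e2]
    have : 0 < √s := Real.sqrt_pos.2 hs
    refine (mul_le_mul_of_nonneg_left e1 (by positivity)).trans (le_of_eq ?_)
    field_simp
  linarith

lemma res_mem (B : StarSubalgebra ℂ A) (hB : IsClosed (B : Set A)) {d : A} (hd : 0 ≤ d)
    (h : d ∈ B) : res d ∈ B := by
  haveI := hB
  have hu : IsUnit ((⟨1 + d, add_mem (one_mem _) h⟩ : B) : A) := unit_one_add hd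
  obtain ⟨u, hu'⟩ := B.coe_isUnit.1 hu
  have : res d = ((↑u⁻¹ : B) : A) := by
    have h1 : ((↑u⁻¹ : B) : A) * (1 + d) = 1 := by
      have h2 : (↑u⁻¹ : B) * (u : B) = 1 := u.inv_mul
      have h3 := congrArg (Subtype.val) h2
      rw [hu'] at h3
      exact h3
    calc res d = (((↑u⁻¹ : B) : A) * (1 + d)) * res d := by rw [h1, one_mul]
      _ = _ := by rw [mul_assoc, mul_res hd, mul_one]
  rw [this]; exact SetLike.coe_mem _

lemma rsmul_mem' (B : StarSubalgebra ℂ A) {b : A} (r : ℝ) (h : b ∈ B) : r • b ∈ B := by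
  rw [← Complex.coe_smul]; exact SMulMemClass.smul_mem _ h

lemma tr_mem (B : StarSubalgebra ℂ A) (hB : IsClosed (B : Set A)) {s : ℝ} (hs : 0 < s) {b : A}
    (h : b ∈ B) : tr s b ∈ B :=
  mul_mem h (res_mem B hB (tr_arg hs b) (rsmul_mem' B s (mul_mem (star_mem h) h)))

/-- density for self-adjoint elements -/
lemma dens_sa {P : A →ₚ[ℂ] ℂ} (hP : Hcont S P) {X : Set A} (hX : ∀ x ∈ X, star x ∈ X) {a : A}
    (ha : InVN S X a) (hsa : IsSelfAdjoint a) {ε : ℝ} (hε : 0 < ε) :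
    ∃ b ∈ StarAlgebra.adjoin ℂ X, nrm P (a - b) < ε := by
  set N := nrm P 1 + 1 with hN
  have hN0 : 0 < N := by have := nrm_nonneg P 1; linarith
  set s : ℝ := ε / (4 * N * (‖a‖ ^ 3 + 1)) with hs'
  have hs : 0 < s := by positivity
  have h1 : nrm P (tr s a - a) ≤ ε / 4 := by
    refine (nrm_le_norm P _).trans ?_
    have := tr_sub hs a
    calc _ ≤ (s * ‖a‖ ^ 3) * N := mul_le_mul this (by linarith) (nrm_nonneg _ _) (by positivity)
      _ ≤ (s * (‖a‖ ^ 3 + 1)) * N := by gcongr; linarith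
      _ = ε / 4 := by rw [hs']; field_simp
  have hq : 0 < √s := Real.sqrt_pos.2 hs
  set C : ℝ := 2 / √s with hC
  have hC0 : 0 < C := by positivity
  obtain ⟨Ξ, δ, hδ, hΞ⟩ := hP (ε / (4 * C)) (by positivity)
  set κ : ℝ := C * δ / (1 + √s) with hκ
  obtain ⟨b, hb, hbs, hbξ⟩ := sa_approx S hX ha hsa (Ξ ⊕ Ξ)
    (Sum.elim (fun ξ => S.π (res (s • (star a * a))) ξ) (fun ξ => S.π (tr s a) ξ)) (δ := κ)
    (by positivity)
  have h2 : nrm P (tr s b - tr s a) ≤ ε / 4 := by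
    have hn : ‖((C⁻¹ : ℝ) : ℂ) • (tr s b - tr s a)‖ ≤ 1 := by
      rw [norm_smul, Complex.norm_real, Real.norm_eq_abs, abs_of_pos (by positivity)]
      have := (norm_sub_le (tr s b) (tr s a)).trans (add_le_add (tr_norm hs b) (tr_norm hs a))
      calc _ ≤ C⁻¹ * (1 / √s + 1 / √s) := by gcongr
        _ = 1 := by rw [hC]; field_simp; norm_num
    have h3 := hΞ _ hn (fun ξ hξ => by
      rw [smul_app, norm_smul, Complex.norm_real, Real.norm_eq_abs, abs_of_pos (by positivity)]
      have e1 := hbξ (Sum.inl ⟨ξ, hξ⟩)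
      have e2 := hbξ (Sum.inr ⟨ξ, hξ⟩)
      simp only [Sum.elim_inl, Sum.elim_inr] at e1 e2
      have e3 : ‖S.π (tr s b - tr s a) ξ‖ ≤ κ + √s * κ := by
        rw [tr_diff hs hsa hbs, map_sub, sub_apply]
        refine (norm_sub_le _ _).trans (add_le_add ?_ ?_)
        · rw [S.mul_app, S.mul_app]
          refine (S.norm_le _ _).trans ?_
          have := norm_res_le (tr_arg hs b)
          nlinarith [norm_nonneg (S.π (b - a) (S.π (res (s • (star a * a))) ξ))]
        · rw [← Complex.coe_smul, smul_app, norm_smul, Complex.norm_real, Real.norm_eq_abs,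
            abs_of_pos hs, S.mul_app, S.mul_app]
          have e4 : ‖S.π (tr s b) (S.π (b - a) (S.π (tr s a) ξ))‖ ≤ 1 / √s * κ :=
            (S.norm_le _ _).trans (mul_le_mul (tr_norm hs b) e2.le (norm_nonneg _) (by positivity))
          calc _ ≤ s * (1 / √s * κ) := by gcongr
            _ = (√s * √s) * (1 / √s * κ) := by rw [Real.mul_self_sqrt hs.le]
            _ = √s * κ := by field_simp
      calc _ ≤ C⁻¹ * (κ + √s * κ) := by gcongr
        _ = δ := by rw [hκ]; field_simp)
    rw [nrm_smul, Complex.norm_real, Real.norm_eq_abs, abs_of_pos (by positivity)] at h3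
    calc nrm P (tr s b - tr s a) = C * (C⁻¹ * nrm P (tr s b - tr s a)) := by field_simp
      _ ≤ C * (ε / (4 * C)) := by gcongr
      _ = ε / 4 := by field_simp
  have h4 : tr s b ∈ (StarAlgebra.adjoin ℂ X).topologicalClosure :=
    tr_mem _ (StarSubalgebra.isClosed_topologicalClosure _) hs
      (StarSubalgebra.le_topologicalClosure _ hb)
  obtain ⟨c, hc, hcd⟩ := Metric.mem_closure_iff.1 h4 (ε / (4 * N)) (by positivity)
  refine ⟨c, hc, ?_⟩
  rw [dist_eq_norm] at hcd
  have h5 : nrm P (tr s b - c) ≤ ε / 4 := by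
    refine (nrm_le_norm P _).trans ?_
    calc _ ≤ ε / (4 * N) * N := mul_le_mul hcd.le (by linarith) (nrm_nonneg _ _) (by positivity)
      _ = ε / 4 := by field_simp
  have h6 : a - c = (tr s b - c) - (tr s b - tr s a) - (tr s a - a) := by abel
  rw [h6]
  have h7 := nrm_sub_le P (tr s b - c - (tr s b - tr s a)) (tr s a - a)
  have h8 := nrm_sub_le P (tr s b - c) (tr s b - tr s a)
  linarith

lemma InVN_iff {X : Set A} {a : A} : InVN S X a ↔
    ∀ T : H →L[ℂ] H, (∀ x ∈ X, ∀ ξ, T (S.π x ξ) = S.π x (T ξ)) → ∀ ξ, T (S.π a ξ) = S.π a (T ξ) := by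
  constructor
  · intro h T hT ξ
    have := h T (by
      rintro _ ⟨x, hx, rfl⟩
      ext ζ
      exact (hT x hx ζ).symm)
    exact congrArg (fun T : H →L[ℂ] H => T ξ) this
  · intro h T hT
    ext ξ
    refine h T (fun x hx ζ => ?_) ξ
    exact (congrArg (fun T : H →L[ℂ] H => T ζ) (hT _ ⟨x, hx, rfl⟩)).symm

lemma InVN_SC {X : Set A} {b : ℕ → A} {a : A} (hb : ∀ n, InVN S X (b n)) (h : S.SC b a) :
    InVN S X a := by
  rw [InVN_iff]
  intro T hT ξ
  have h1 := (T.continuous.tendsto _).comp (h ξ)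
  have h2 := h (T ξ)
  refine tendsto_nhds_unique h1 (h2.congr fun n => ?_)
  exact ((InVN_iff S).1 (hb n) T hT ξ).symm

lemma SC_of_norm {b : ℕ → A} {a : A} (h : Tendsto (fun n => ‖b n - a‖) atTop (𝓝 0)) : S.SC b a := by
  intro ξ
  rw [tendsto_iff_norm_sub_tendsto_zero]
  refine squeeze_zero (fun _ => norm_nonneg _) (fun n => ?_) (by simpa using h.mul_const ‖ξ‖)
  rw [← sub_apply, ← map_sub]
  exact S.norm_le _ _

/-- generated von Neumann algebra as a star subalgebra -/
def VNs {X : Set A} (hX : ∀ x ∈ X, star x ∈ X) : StarSubalgebra ℂ A where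
  carrier := {a | InVN S X a}
  mul_mem' {a b} ha hb := by
    have ha' := (InVN_iff S).1 ha
    have hb' := (InVN_iff S).1 hb
    refine (InVN_iff S).2 (fun T hT ξ => ?_)
    rw [S.mul_app, S.mul_app, ha' T hT, hb' T hT]
  add_mem' {a b} ha hb := by
    have ha' := (InVN_iff S).1 ha
    have hb' := (InVN_iff S).1 hb
    refine (InVN_iff S).2 (fun T hT ξ => ?_)
    rw [map_add, ContinuousLinearMap.add_apply, ContinuousLinearMap.add_apply, map_add, ha' T hT,
      hb' T hT]
  algebraMap_mem' r := by
    refine (InVN_iff S).2 (fun T hT ξ => ?_)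
    rw [Algebra.algebraMap_eq_smul_one, smul_app, smul_app, map_one]
    simp
  star_mem' {a} ha := by
    have ha' := (InVN_iff S).1 ha
    refine (InVN_iff S).2 (fun T hT ξ => ?_)
    refine ext_inner_left ℂ fun η => ?_
    have key := ha' (ContinuousLinearMap.adjoint T) (fun x hx ζ => by
      refine ext_inner_right ℂ fun η => ?_
      rw [ContinuousLinearMap.adjoint_inner_left, S.adj, S.adj,
        ContinuousLinearMap.adjoint_inner_left, hT _ (hX x hx)]) η
    rw [← ContinuousLinearMap.adjoint_inner_left, ← S.adj, ← key,
      ContinuousLinearMap.adjoint_inner_left, S.adj]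

lemma mem_VNs {X : Set A} (hX : ∀ x ∈ X, star x ∈ X) {a : A} : a ∈ VNs S hX ↔ InVN S X a := Iff.rfl

lemma dens {P : A →ₚ[ℂ] ℂ} (hP : Hcont S P) {X : Set A} (hX : ∀ x ∈ X, star x ∈ X) {a : A}
    (ha : InVN S X a) {ε : ℝ} (hε : 0 < ε) :
    ∃ b ∈ StarAlgebra.adjoin ℂ X, nrm P (a - b) < ε := by
  have h1 : InVN S X (a + star a) := add_mem (S := StarSubalgebra ℂ A) (s := VNs S hX) ha
    (star_mem (s := VNs S hX) ha)
  have h2 : InVN S X (Complex.I • (star a - a)) := SMulMemClass.smul_mem (s := VNs S hX) _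
    (sub_mem (star_mem (s := VNs S hX) ha) ha)
  have h2s : IsSelfAdjoint (Complex.I • (star a - a)) := by
    rw [IsSelfAdjoint, star_smul, star_sub, star_star]
    simp [smul_sub]
    abel
  obtain ⟨b, hb, hb'⟩ := dens_sa S hP hX h1 (IsSelfAdjoint.add_star_self a) (half_pos hε)
  obtain ⟨c, hc, hc'⟩ := dens_sa S hP hX h2 h2s (half_pos hε)
  refine ⟨(1 / 2 : ℂ) • (b + Complex.I • c), SMulMemClass.smul_mem _
    (add_mem hb (SMulMemClass.smul_mem _ hc)), ?_⟩
  have e : a - (1 / 2 : ℂ) • (b + Complex.I • c) = (1 / 2 : ℂ) • ((a + star a - b) +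
      Complex.I • (Complex.I • (star a - a) - c)) := by
    simp only [smul_add, smul_sub, smul_smul]
    ring_nf
    simp only [Complex.I_sq]
    module
  rw [e, nrm_smul]
  have h3 := nrm_add_le P (a + star a - b) (Complex.I • (Complex.I • (star a - a) - c))
  rw [nrm_smul, Complex.norm_I, one_mul] at h3
  have : ‖(1 / 2 : ℂ)‖ = 1 / 2 := by norm_num
  rw [this]; linarith

/-- `P`-closedness of generated von Neumann algebras -/
lemma closedP_sa {P : A →ₚ[ℂ] ℂ} (hP : Hcont S P) (hf : ∀ a, nrm P a = 0 → a = 0)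
    (ht : ∀ a b, P (a * b) = P (b * a)) {X : Set A} (hX : ∀ x ∈ X, star x ∈ X) {a : A}
    (hsa : IsSelfAdjoint a) {b : ℕ → A} (hb : ∀ n, InVN S X (b n)) (hbs : ∀ n, IsSelfAdjoint (b n))
    (hlim : Tendsto (fun n => nrm P (b n - a)) atTop (𝓝 0)) : InVN S X a := by
  have hcl : IsClosed (VNs S hX : Set A) := by
    refine isClosed_of_closure_subset fun c hc => ?_
    obtain ⟨u, hu, hu'⟩ := mem_closure_iff_seq_limit.1 hc
    exact InVN_SC S hu (SC_of_norm S (tendsto_iff_norm_sub_tendsto_zero.1 hu'))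
  have h1 : ∀ s : ℝ, 0 < s → InVN S X (tr s a) := by
    intro s hs
    obtain ⟨c, hc, f, hcf⟩ := F3' S hP hf (b := fun n => tr s (b n)) (fun n => tr_norm hs (b n))
      (v := hat P (tr s a)) (by
        rw [tendsto_iff_norm_sub_tendsto_zero]
        refine squeeze_zero (fun _ => norm_nonneg _) (fun n => ?_) (by simpa using hlim.const_mul 2)
        rw [← map_sub, norm_hat]
        exact nrm_tr_diff ht hs hsa (hbs n))
    have : c = tr s a := by
      rw [← sub_eq_zero]
      apply hf
      rw [← norm_hat, map_sub, hc, sub_self, norm_zero]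
    rw [← this]
    exact InVN_SC S (fun n => tr_mem (VNs S hX) hcl hs (hb (f n))) hcf
  refine InVN_SC S (b := fun n : ℕ => tr (1 / ((n : ℝ) + 1)) a) (fun n => h1 _ (by positivity))
    (SC_of_norm S ?_)
  refine squeeze_zero (fun _ => norm_nonneg _) (fun n => tr_sub (by positivity) a) ?_
  simpa using (tendsto_one_div_add_atTop_nhds_zero_nat (𝕜 := ℝ)).mul_const (‖a‖ ^ 3)

lemma closedP {P : A →ₚ[ℂ] ℂ} (hP : Hcont S P) (hf : ∀ a, nrm P a = 0 → a = 0)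
    (ht : ∀ a b, P (a * b) = P (b * a)) {X : Set A} (hX : ∀ x ∈ X, star x ∈ X) {a : A}
    {b : ℕ → A} (hb : ∀ n, InVN S X (b n))
    (hlim : Tendsto (fun n => nrm P (b n - a)) atTop (𝓝 0)) : InVN S X a := by
  have hs : ∀ c : A, IsSelfAdjoint (Complex.I • (star c - c)) := fun c => by
    rw [IsSelfAdjoint, star_smul, star_sub, star_star]
    simp [smul_sub]
    abel
  have h1 : InVN S X (a + star a) := by
    refine closedP_sa S hP hf ht hX (IsSelfAdjoint.add_star_self a) (b := fun n => b n + star (b n))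
      (fun n => add_mem (S := StarSubalgebra ℂ A) (s := VNs S hX) (hb n)
        (star_mem (s := VNs S hX) (hb n))) (fun n => IsSelfAdjoint.add_star_self _) ?_
    refine squeeze_zero (fun _ => nrm_nonneg _ _) (fun n => ?_) (by simpa using hlim.const_mul 2)
    have e : b n + star (b n) - (a + star a) = (b n - a) + star (b n - a) := by
      rw [star_sub]; abel
    rw [e]
    refine (nrm_add_le P _ _).trans ?_
    rw [nrm_star ht]; linarith
  have h2 : InVN S X (Complex.I • (star a - a)) := by
    refine closedP_sa S hP hf ht hX (hs a) (b := fun n => Complex.I • (star (b n) - b n))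
      (fun n => SMulMemClass.smul_mem (s := VNs S hX) _ (sub_mem (star_mem (s := VNs S hX) (hb n))
        (hb n))) (fun n => hs _) ?_
    refine squeeze_zero (fun _ => nrm_nonneg _ _) (fun n => ?_) (by simpa using hlim.const_mul 2)
    have e : Complex.I • (star (b n) - b n) - Complex.I • (star a - a) =
        Complex.I • (star (b n - a) - (b n - a)) := by
      rw [← smul_sub, star_sub]; congr 1; abel
    rw [e, nrm_smul, Complex.norm_I, one_mul]
    refine (nrm_sub_le P _ _).trans ?_
    rw [nrm_star ht]; linarith
  have e : a = (1 / 2 : ℂ) • ((a + star a) + Complex.I • (Complex.I • (star a - a))) := by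
    simp only [smul_add, smul_sub, smul_smul]
    ring_nf
    simp only [Complex.I_sq]
    module
  rw [e]
  exact SMulMemClass.smul_mem (s := VNs S hX) _ (add_mem (S := StarSubalgebra ℂ A) h1
    (SMulMemClass.smul_mem (s := VNs S hX) _ h2))

end kap2
end TailProof

namespace TailProof
section setup
variable {A H : Type} [CStarAlgebra A] [PartialOrder A] [StarOrderedRing A]
    [NormedAddCommGroup H] [InnerProductSpace ℂ H] [CompleteSpace H]

/-- all the data of the problem -/
structure BS (S : VNRep A H) (G : Type) [Group G] where
  P : A →ₚ[ℂ] ℂ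
  Ps : A →ₚ[ℂ] ℂ
  τ : A →ₚ[ℂ] ℂ
  hτ : ∀ a, τ a = P a + Ps a
  Pt : ∀ a b, P (a * b) = P (b * a)
  Pst : ∀ a b, Ps (a * b) = Ps (b * a)
  Pc : Hcont S P
  Pf : ∀ a, nrm P a = 0 → a = 0
  u : ℕ → A
  um : Monotone u
  u0 : ∀ n, 0 ≤ u n
  u1 : ∀ n, u n ≤ 1
  uz : ∀ n, nrm Ps (u n) = 0
  us : S.SC u 1
  th : G → (A →⋆ₐ[ℂ] A)
  th1 : ∀ a, th 1 a = a
  thm : ∀ g h a, th (g * h) a = th g (th h a)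
  thτ : ∀ g a, τ (th g a) = τ a
  σ : ℕ → G
  br : ∀ i, σ i * σ (i + 1) * σ i = σ (i + 1) * σ i * σ (i + 1)
  cm : ∀ i j, i + 1 < j → σ i * σ j = σ j * σ i
  x : ℕ → A
  hx0 : ∀ i, 1 ≤ i → th (σ i) (x 0) = x 0
  hx1 : ∀ n, x (n + 1) = th (σ n) (x n)
  hgen : ∀ a, InVN S {y | ∃ n, y = x n ∨ y = star (x n)} a
  α : A →⋆ₐ[ℂ] A
  ατ : ∀ a, τ (α a) = τ a
  hα : ∀ n, α (x n) = x (n + 1)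

namespace BS
variable {S : VNRep A H} {G : Type} [Group G] (D : BS S G)

lemma th_inv (g : G) (a : A) : D.th g⁻¹ (D.th g a) = a := by rw [← D.thm, inv_mul_cancel, D.th1]
lemma th_inv' (g : G) (a : A) : D.th g (D.th g⁻¹ a) = a := by rw [← D.thm, mul_inv_cancel, D.th1]

lemma thP_le (g : G) (a : A) : nrm D.P (D.th g a) ≤ nrm D.P a :=
  inv_le S D.P D.Ps D.τ D.Pt D.hτ D.Pc D.u D.um D.u0 D.u1 D.uz D.Pst D.us (D.th g) (D.th g⁻¹)
    (D.th_inv g) (D.th_inv' g) (D.thτ g) a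

lemma thP (g : G) (a : A) : nrm D.P (D.th g a) = nrm D.P a :=
  le_antisymm (D.thP_le g a) (by have := D.thP_le g⁻¹ (D.th g a); rwa [D.th_inv] at this)

lemma nrmτ_sq (a : A) : nrm D.τ a ^ 2 = nrm D.P a ^ 2 + nrm D.Ps a ^ 2 := by
  rw [nrm_sq, nrm_sq, nrm_sq, D.hτ, Complex.add_re]

lemma nrmτ_hom {θ : A →⋆ₐ[ℂ] A} (h : ∀ a, D.τ (θ a) = D.τ a) (a : A) :
    nrm D.τ (θ a) = nrm D.τ a := by
  have : nrm D.τ (θ a) ^ 2 = nrm D.τ a ^ 2 := by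
    rw [nrm_sq, nrm_sq, ← map_star, ← map_mul, h]
  exact (pow_left_inj₀ (nrm_nonneg _ _) (nrm_nonneg _ _) two_ne_zero).1 this

lemma thPs (g : G) (a : A) : nrm D.Ps (D.th g a) = nrm D.Ps a := by
  have h1 := D.nrmτ_sq a
  have h2 := D.nrmτ_sq (D.th g a)
  rw [D.nrmτ_hom (D.thτ g), D.thP] at h2
  exact (pow_left_inj₀ (nrm_nonneg _ _) (nrm_nonneg _ _) two_ne_zero).1 (by linarith)

lemma P_le_τ (a : A) : nrm D.P a ≤ nrm D.τ a := by
  refine (pow_le_pow_iff_left₀ (nrm_nonneg _ _) (nrm_nonneg _ _) two_ne_zero).1 ?_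
  rw [D.nrmτ_sq]; nlinarith [sq_nonneg (nrm D.Ps a)]

lemma τ_eq_P {a : A} (h : nrm D.Ps a = 0) : nrm D.τ a = nrm D.P a := by
  refine (pow_left_inj₀ (nrm_nonneg _ _) (nrm_nonneg _ _) two_ne_zero).1 ?_
  rw [D.nrmτ_sq, h]; ring

lemma reP_eq (a : A) : (D.P a).re = (nrm D.P (1 + a) ^ 2 - nrm D.P (1 - a) ^ 2) / 4 := by
  have h : D.P (star a) = star (D.P a) := by
    have h1 := inner_hat D.P a 1
    have h2 := inner_hat D.P 1 a
    rw [mul_one] at h1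
    rw [star_one, one_mul] at h2
    rw [← h1, ← h2, ← inner_conj_symm]; rfl
  have h' : (D.P (star a)).re = (D.P a).re := by rw [h]; simp
  rw [nrm_sq, nrm_sq, star_add, star_sub, star_one]
  simp only [mul_add, add_mul, mul_sub, sub_mul, map_add, map_sub, one_mul, mul_one,
    Complex.add_re, Complex.sub_re, h']
  ring

lemma thPre (g : G) (a : A) : (D.P (D.th g a)).re = (D.P a).re := by
  rw [reP_eq, reP_eq, ← D.thP g (1 + a), ← D.thP g (1 - a), map_add, map_sub, map_one]

/-- braid sequences -/
def IsBr (w : ℕ → A) : Prop :=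
  (∀ i, 1 ≤ i → D.th (D.σ i) (w 0) = w 0) ∧ ∀ n, w (n + 1) = D.th (D.σ n) (w n)

lemma isBr_x : D.IsBr D.x := ⟨D.hx0, D.hx1⟩
variable {D}

lemma IsBr.hi {w : ℕ → A} (h : D.IsBr w) {n k : ℕ} (hk : n + 1 ≤ k) :
    D.th (D.σ k) (w n) = w n := by
  induction n generalizing k with
  | zero => exact h.1 k hk
  | succ n ih =>
    rw [h.2, ← D.thm, ← D.cm n k (by omega), D.thm, ih (by omega)]

lemma IsBr.lo {w : ℕ → A} (h : D.IsBr w) {m k : ℕ} (hk : k + 2 ≤ m) :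
    D.th (D.σ k) (w m) = w m := by
  induction m, hk using Nat.le_induction with
  | base =>
    rw [h.2, h.2, ← D.thm, ← D.thm, D.br, D.thm, D.thm, h.hi le_rfl]
  | succ m hm ih => rw [h.2, ← D.thm, D.cm k m (by omega), D.thm, ih]

variable (D)
/-- the partial shift word -/
def s : ℕ → G
  | 0 => 1
  | m + 1 => s m * D.σ m
variable {D}

lemma s_fix {a : A} (m : ℕ) (h : ∀ k < m, D.th (D.σ k) a = a) : D.th (D.s m) a = a := by
  induction m with
  | zero => exact D.th1 a
  | succ m ih =>
    rw [s, D.thm, h m (by omega), ih fun k hk => h k (by omega)]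

lemma IsBr.shift {w : ℕ → A} (h : D.IsBr w) {m n : ℕ} (hn : n < m) :
    D.th (D.s m) (w n) = w (n + 1) := by
  induction m with
  | zero => omega
  | succ m ih =>
    rw [s, D.thm]
    rcases Nat.lt_succ_iff_lt_or_eq.1 hn with h1 | rfl
    · rw [h.hi (by omega), ih h1]
    · rw [← h.2]; exact s_fix n fun k hk => h.lo (Nat.succ_le_succ hk)

variable (D)
/-- algebra generated by `x_i` with `N ≤ i < m` -/
def B (N m : ℕ) : StarSubalgebra ℂ A := StarAlgebra.adjoin ℂ {y | ∃ n, N ≤ n ∧ n < m ∧ y = D.x n}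

lemma eqOn {X : Set A} {f g : A →⋆ₐ[ℂ] A} (h : ∀ y ∈ X, f y = g y) {b : A}
    (hb : b ∈ StarAlgebra.adjoin ℂ X) : f b = g b :=
  (StarAlgebra.adjoin_le (S := StarAlgHom.equalizer f g) h) hb

lemma mapsTo {X Y : Set A} {f : A →⋆ₐ[ℂ] A} (h : ∀ y ∈ X, f y ∈ Y) {b : A}
    (hb : b ∈ StarAlgebra.adjoin ℂ X) : f b ∈ StarAlgebra.adjoin ℂ Y :=
  (StarAlgebra.adjoin_le (S := (StarAlgebra.adjoin ℂ Y).comap f)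
    fun y hy => StarAlgebra.subset_adjoin ℂ Y (h y hy)) hb

variable {D}
lemma α_eq {N m : ℕ} {b : A} (hb : b ∈ D.B N m) : D.α b = D.th (D.s m) b := by
  refine eqOn ?_ hb
  rintro y ⟨n, h1, h2, rfl⟩
  rw [D.hα, D.isBr_x.shift h2]

lemma α_mem {N m : ℕ} {b : A} (hb : b ∈ D.B N m) : D.α b ∈ D.B (N + 1) (m + 1) := by
  refine mapsTo ?_ hb
  rintro y ⟨n, h1, h2, rfl⟩
  exact ⟨n + 1, by omega, by omega, D.hα n⟩

lemma B_fix {k m : ℕ} {b : A} (hb : b ∈ D.B (k + 2) m) : D.th (D.σ k) b = b := by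
  refine eqOn (g := StarAlgHom.id ℂ A) ?_ hb
  rintro y ⟨n, h1, h2, rfl⟩
  exact D.isBr_x.lo h1

lemma B_mono {N N' m m' : ℕ} (h : N' ≤ N) (h' : m ≤ m') : D.B N m ≤ D.B N' m' :=
  StarAlgebra.adjoin_mono (by rintro y ⟨n, h1, h2, rfl⟩; exact ⟨n, by omega, by omega, rfl⟩)

lemma adjoin_B {N : ℕ} {b : A}
    (hb : b ∈ StarAlgebra.adjoin ℂ {y | ∃ n, y = D.x (N + n) ∨ y = star (D.x (N + n))}) :
    ∃ m, b ∈ D.B N m := by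
  induction hb using StarAlgebra.adjoin_induction with
  | mem y hy =>
    obtain ⟨n, hn⟩ := hy
    have : D.x (N + n) ∈ D.B N (N + n + 1) :=
      StarAlgebra.subset_adjoin ℂ _ ⟨N + n, by omega, by omega, rfl⟩
    rcases hn with rfl | rfl
    · exact ⟨_, this⟩
    · exact ⟨_, star_mem this⟩
  | algebraMap r => exact ⟨0, algebraMap_mem _ r⟩
  | add a b _ _ h1 h2 =>
    obtain ⟨m, hm⟩ := h1; obtain ⟨m', hm'⟩ := h2
    exact ⟨max m m', add_mem (B_mono le_rfl (le_max_left _ _) hm)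
      (B_mono le_rfl (le_max_right _ _) hm')⟩
  | mul a b _ _ h1 h2 =>
    obtain ⟨m, hm⟩ := h1; obtain ⟨m', hm'⟩ := h2
    exact ⟨max m m', mul_mem (B_mono le_rfl (le_max_left _ _) hm)
      (B_mono le_rfl (le_max_right _ _) hm')⟩
  | star a _ h =>
    obtain ⟨m, hm⟩ := h
    exact ⟨m, star_mem hm⟩

lemma X_star (N : ℕ) : ∀ y ∈ {y | ∃ n, y = D.x (N + n) ∨ y = star (D.x (N + n))},
    star y ∈ {y | ∃ n, y = D.x (N + n) ∨ y = star (D.x (N + n))} := by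
  rintro y ⟨n, rfl | rfl⟩
  · exact ⟨n, Or.inr rfl⟩
  · exact ⟨n, Or.inl (star_star _)⟩

lemma densN {N : ℕ} {a : A} (ha : InVN S {y | ∃ n, y = D.x (N + n) ∨ y = star (D.x (N + n))} a)
    {ε : ℝ} (hε : 0 < ε) : ∃ m, ∃ b ∈ D.B N m, nrm D.P (a - b) < ε := by
  obtain ⟨b, hb, h⟩ := dens S D.Pc (X_star N) ha hε
  obtain ⟨m, hm⟩ := adjoin_B hb
  exact ⟨m, b, hm, h⟩

lemma dens0 (a : A) {ε : ℝ} (hε : 0 < ε) : ∃ m, ∃ b ∈ D.B 0 m, nrm D.P (a - b) < ε := by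
  refine densN ?_ hε
  have := D.hgen a
  simpa only [zero_add] using this

lemma eq_of_close {a b : A} (h : ∀ ε > 0, nrm D.P (a - b) ≤ ε) : a = b :=
  sub_eq_zero.1 (D.Pf _ (le_antisymm (le_of_forall_pos_le_add fun ε hε => by
    simpa using h ε hε) (nrm_nonneg _ _)))

lemma tri {a b c : A} : nrm D.P (a - c) ≤ nrm D.P (a - b) + nrm D.P (b - c) := by
  have := nrm_add_le D.P (a - b) (b - c)
  simpa using this

lemma fix_of_approx {a : A} (h : ∀ N, ∀ ε > 0, ∃ m, ∃ b ∈ D.B N m, nrm D.P (a - b) < ε) (k : ℕ) :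
    D.th (D.σ k) a = a := by
  refine eq_of_close (D := D) fun ε hε => ?_
  obtain ⟨m, b, hb, h1⟩ := h (k + 2) (ε / 2) (by linarith)
  have h2 := tri (D := D) (a := D.th (D.σ k) a) (b := b) (c := a)
  have e := B_fix hb
  rw [show D.th (D.σ k) a - b = D.th (D.σ k) (a - b) by rw [map_sub, e]] at h2
  rw [D.thP, nrm_sub_rev D.P b] at h2
  linarith

lemma tail_fix {a : A} (h : ∀ N, InVN S {y | ∃ n, y = D.x (N + n) ∨ y = star (D.x (N + n))} a)
    (k : ℕ) : D.th (D.σ k) a = a :=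
  fix_of_approx (fun N ε hε => densN (h N) hε) k

lemma approx_of_shift {a : A} (h : ∀ m, ∀ b ∈ D.B 0 m, nrm D.P (a - D.α b) ≤ nrm D.P (a - b))
    (N : ℕ) : ∀ ε > 0, ∃ m, ∃ b ∈ D.B N m, nrm D.P (a - b) < ε := by
  induction N with
  | zero => exact fun ε hε => dens0 a hε
  | succ N ih =>
    intro ε hε
    obtain ⟨m, b, hb, h1⟩ := ih ε hε
    exact ⟨m + 1, D.α b, α_mem hb, (h m b (B_mono (by omega) le_rfl hb)).trans_lt h1⟩

lemma fix_shift {a : A} (h : ∀ k, D.th (D.σ k) a = a) {m : ℕ} {b : A} (hb : b ∈ D.B 0 m) :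
    nrm D.P (a - D.α b) = nrm D.P (a - b) := by
  nth_rewrite 1 [α_eq hb, ← s_fix (D := D) m fun k _ => h k, ← map_sub, D.thP]
  rfl

lemma fix_tail {a : A} (h : ∀ k, D.th (D.σ k) a = a) (N : ℕ) :
    InVN S {y | ∃ n, y = D.x (N + n) ∨ y = star (D.x (N + n))} a := by
  have h1 := approx_of_shift (D := D) (a := a) (fun m b hb => (fix_shift h hb).le) N
  have h2 : ∀ n : ℕ, ∃ b : A, (∃ m, b ∈ D.B N m) ∧ nrm D.P (a - b) < 1 / ((n : ℝ) + 1) := fun n => by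
    obtain ⟨m, b, hb, h3⟩ := h1 (1 / ((n : ℝ) + 1)) (by positivity)
    exact ⟨b, ⟨m, hb⟩, h3⟩
  choose b hb hb' using h2
  refine closedP S D.Pc D.Pf D.Pt (X_star N) (b := b) (fun n => ?_) ?_
  · obtain ⟨m, hm⟩ := hb n
    refine (StarAlgebra.adjoin_le (S := VNs S (X_star N)) ?_) hm
    rintro y ⟨n, h1, h2, rfl⟩
    obtain ⟨k, rfl⟩ := Nat.exists_eq_add_of_le h1
    refine (InVN_iff S).2 fun T hT ξ => ?_
    exact hT _ ⟨k, Or.inl rfl⟩ ξ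
  · refine squeeze_zero (fun _ => nrm_nonneg _ _) (fun n => ?_)
      (tendsto_one_div_add_atTop_nhds_zero_nat (𝕜 := ℝ))
    rw [nrm_sub_rev]; exact (hb' n).le

lemma fix_α (hs : ∀ a, nrm D.P (D.α a) ≤ nrm D.P a) {a : A} (h : ∀ k, D.th (D.σ k) a = a) :
    D.α a = a := by
  refine eq_of_close (D := D) fun ε hε => ?_
  obtain ⟨m, b, hb, h1⟩ := dens0 (D := D) a (half_pos hε)
  have h2 := tri (D := D) (a := D.α a) (b := D.α b) (c := a)
  rw [← map_sub, nrm_sub_rev D.P (D.α b), fix_shift h hb] at h2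
  linarith [hs (a - b)]

lemma α_fix (hs : ∀ a, nrm D.P (D.α a) ≤ nrm D.P a) {a : A} (h : D.α a = a) (k : ℕ) :
    D.th (D.σ k) a = a := by
  refine fix_of_approx (approx_of_shift fun m b _ => ?_) k
  have := hs (a - b)
  rwa [map_sub, h] at this

end BS
end setup
end TailProof

namespace TailProof
section setup
variable {A H : Type} [CStarAlgebra A] [PartialOrder A] [StarOrderedRing A]
    [NormedAddCommGroup H] [InnerProductSpace ℂ H] [CompleteSpace H]
namespace BS
variable {S : VNRep A H} {G : Type} [Group G] (D : BS S G)

/-- properties of the support projection -/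
structure IsZ (z : A) : Prop where
  h0 : 0 ≤ z
  h1 : z ≤ 1
  sq : z * z = z
  comm : ∀ a, D.α a * z = z * D.α a
  j : ∀ a, nrm D.Ps a = 0 → D.α a * z = D.α a
  le : ∀ a, nrm D.P (D.α a * z) ≤ nrm D.P a

lemma P_lim {b : ℕ → A} {c d : A} (h1 : Tendsto (fun n => nrm D.P (b n - c)) atTop (𝓝 0))
    (h2 : Tendsto (fun n => nrm D.P (b n - d)) atTop (𝓝 0)) : c = d := by
  refine sub_eq_zero.1 (D.Pf _ (le_antisymm (le_of_tendsto_of_tendsto' tendsto_const_nhds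
    (by simpa using h1.add h2) fun n => ?_) (nrm_nonneg _ _)))
  have := tri (D := D) (a := c) (b := b n) (c := d)
  rwa [nrm_sub_rev D.P c (b n)] at this

lemma ideal_left {j : A} (h : nrm D.Ps j = 0) (a : A) : nrm D.Ps (a * j) = 0 :=
  le_antisymm ((nrm_mul_le D.Ps a j).trans (by rw [h, mul_zero])) (nrm_nonneg _ _)
lemma ideal_right {j : A} (h : nrm D.Ps j = 0) (a : A) : nrm D.Ps (j * a) = 0 :=
  le_antisymm ((nrm_mul_le' D.Pst j a).trans (by rw [h, zero_mul])) (nrm_nonneg _ _)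

lemma un (n : ℕ) : ‖D.u n‖ ≤ 1 := norm_le_of_le_one (D.u0 n) (D.u1 n)

lemma exists_z : ∃ z, D.IsZ z := by
  obtain ⟨z, hz, hzu, h0, h1⟩ := S.monotone_sc (a := fun n => D.α (D.u n))
    (fun _ _ h => hom_mono D.α (D.um h)) (fun n => hom_nonneg D.α (D.u0 n))
    (fun n => hom_le_one D.α (D.u1 n))
  have an : ∀ a n, ‖D.α a * D.α (D.u n)‖ ≤ ‖D.α a‖ * 1 := fun a n =>
    (norm_mul_le _ _).trans (mul_le_mul_of_nonneg_left
      ((NonUnitalStarAlgHom.norm_apply_le D.α _).trans (D.un n)) (norm_nonneg _))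
  have hl : ∀ a, Tendsto (fun n => nrm D.P (D.α a * D.α (D.u n) - D.α a * z)) atTop (𝓝 0) :=
    fun a => D.Pc.tendsto S (an a) (hz.mul_left S (D.α a))
  have hj : ∀ a, nrm D.Ps a = 0 → D.α a * z = D.α a := by
    intro a ha
    refine D.P_lim (hl a) ?_
    have h2 : Tendsto (fun n => nrm D.P (a * D.u n - a * 1)) atTop (𝓝 0) :=
      D.Pc.tendsto S (C := ‖a‖ * 1) (fun n => (norm_mul_le _ _).trans
        (mul_le_mul_of_nonneg_left (D.un n) (norm_nonneg _))) (D.us.mul_left S a)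
    refine squeeze_zero (fun _ => nrm_nonneg _ _) (fun n => ?_) h2
    have e : D.α a * D.α (D.u n) - D.α a = D.α (a * D.u n - a * 1) := by
      rw [map_sub, map_mul, mul_one]
    rw [e]
    refine (D.P_le_τ _).trans ?_
    rw [D.nrmτ_hom D.ατ, D.τ_eq_P]
    rw [← mul_sub]; exact D.ideal_right ha _
  have hsa : star z = z := (IsSelfAdjoint.of_nonneg h0).star_eq
  have sq : z * z = z := (hz.mul_right S z).unique S (by
    have : (fun n => D.α (D.u n) * z) = fun n => D.α (D.u n) := funext fun n => hj _ (D.uz n)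
    rw [this]; exact hz)
  have hc : ∀ a, z * D.α a * z = z * D.α a := by
    intro a
    have h2 := hz.mul_right S (D.α a * z)
    have h3 := hz.mul_right S (D.α a)
    have : (fun n => D.α (D.u n) * (D.α a * z)) = fun n => D.α (D.u n) * D.α a := funext fun n => by
      rw [← mul_assoc, ← map_mul, hj _ (D.ideal_right (D.uz n) a)]
    rw [this] at h2
    rw [mul_assoc]; exact h2.unique S h3
  refine ⟨z, h0, h1, sq, fun a => ?_, hj, fun a => ?_⟩
  · have h2 := congrArg star (hc (star a))
    simp only [star_mul, map_star, star_star, hsa] at h2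
    rw [← h2, ← mul_assoc, hc]
  · refine le_of_tendsto (x := atTop) (f := fun n => nrm D.P (D.α a * z) -
      nrm D.P (D.α a * D.α (D.u n) - D.α a * z)) (by simpa using (hl a).const_sub _)
      (Eventually.of_forall fun n => ?_)
    have h2 : nrm D.P (D.α a * D.α (D.u n)) ≤ nrm D.P a := by
      rw [← map_mul]
      refine (D.P_le_τ _).trans ?_
      rw [D.nrmτ_hom D.ατ, D.τ_eq_P (D.ideal_left (D.uz n) a)]
      refine (nrm_mul_le' D.Pt _ _).trans ?_
      nlinarith [D.un n, nrm_nonneg D.P a]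
    have h3 := nrm_sub_le D.P (D.α a * D.α (D.u n)) (D.α a * D.α (D.u n) - D.α a * z)
    rw [sub_sub_cancel] at h3
    linarith

variable {D}
lemma IsZ.fix {z : A} (hz : D.IsZ z) {t : A} (h : ∀ k, D.th (D.σ k) t = t) : D.α t * z = t * z := by
  refine eq_of_close (D := D) fun ε hε => ?_
  obtain ⟨m, b, hb, h1⟩ := dens0 (D := D) t (half_pos hε)
  have h2 := tri (D := D) (a := D.α t * z) (b := D.α b * z) (c := t * z)
  rw [← sub_mul (D.α t) (D.α b), ← sub_mul (D.α b), ← map_sub] at h2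
  have h3 := nrm_mul_le' D.Pt (D.α b - t) z
  rw [nrm_sub_rev D.P (D.α b), fix_shift h hb] at h3
  have h4 := norm_le_of_le_one hz.h0 hz.h1
  nlinarith [hz.le (t - b), nrm_nonneg D.P (t - b)]

/-- separability -/
lemma sep (D : BS S G) : TopologicalSpace.SeparableSpace D.P.GNS := by
  rw [← TopologicalSpace.isSeparable_univ_iff]
  set X : Set A := {y | ∃ n, y = D.x n ∨ y = star (D.x n)} with hX
  have hXs : ∀ y ∈ X, star y ∈ X := by
    rintro y ⟨n, rfl | rfl⟩
    · exact ⟨n, Or.inr rfl⟩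
    · exact ⟨n, Or.inl (star_star _)⟩
  have hXc : X.Countable := by
    have : X = Set.range D.x ∪ Set.range fun n => star (D.x n) := by
      ext y; simp only [hX, Set.mem_setOf_eq, Set.mem_union, Set.mem_range]
      constructor
      · rintro ⟨n, h | h⟩
        exacts [Or.inl ⟨n, h.symm⟩, Or.inr ⟨n, h.symm⟩]
      · rintro (⟨n, h⟩ | ⟨n, h⟩)
        exacts [⟨n, Or.inl h.symm⟩, ⟨n, Or.inr h.symm⟩]
    rw [this]
    exact (Set.countable_range _).union (Set.countable_range _)
  have hss : X ∪ star X = X := Set.union_eq_left.2 fun y hy => by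
    have := hXs _ (Set.mem_star.1 hy); rwa [star_star] at this
  have hmc : (Submonoid.closure X : Set A).Countable := by
    haveI := hXc.to_subtype
    have := FreeMonoid.mrange_lift ((↑) : X → A)
    rw [Subtype.range_coe] at this
    rw [← this, MonoidHom.coe_mrange]
    haveI : Countable (FreeMonoid X) := inferInstanceAs (Countable (List X))
    exact Set.countable_range _
  have h1 : TopologicalSpace.IsSeparable (hat D.P '' (StarAlgebra.adjoin ℂ X : Set A)) := by
    have e : (StarAlgebra.adjoin ℂ X : Set A) = (Submodule.span ℂ (Submonoid.closure X : Set A) : Set A) := by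
      rw [← Algebra.adjoin_eq_span]
      have : ((StarAlgebra.adjoin ℂ X).toSubalgebra : Set A) = Algebra.adjoin ℂ (X ∪ star X) := rfl
      rw [hss] at this
      exact this
    rw [e, ← Submodule.map_coe, Submodule.map_span]
    exact ((hmc.image _).isSeparable).span
  refine h1.closure.mono ?_
  rintro v -
  rw [Metric.mem_closure_iff]
  intro ε hε
  obtain ⟨a, ha⟩ := (dense_hat D.P).exists_dist_lt v (half_pos hε)
  obtain ⟨b, hb, h⟩ := dens S D.Pc hXs (D.hgen a) (half_pos hε)
  refine ⟨_, ⟨b, hb, rfl⟩, ?_⟩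
  refine (dist_triangle _ (hat D.P a) _).trans_lt ?_
  rw [dist_eq_norm (hat D.P a), ← map_sub, norm_hat]
  linarith

/-- the invariant seminorm -/
structure IsN (D : BS S G) (z : A) (N : A → ℝ) : Prop where
  nn : ∀ a, 0 ≤ N a
  add : ∀ a b, N (a + b) ≤ N a + N b
  smul : ∀ (c : ℂ) a, N (c • a) = ‖c‖ * N a
  le : ∀ a, N a ≤ nrm D.τ a
  inv : ∀ g a, N (D.th g a) = N a
  mull : ∀ a b, N (a * b) ≤ ‖a‖ * N b
  mulr : ∀ a b, N (b * a) ≤ ‖a‖ * N b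
  j : ∀ a, nrm D.Ps a = 0 → N a = 0
  zero : ∀ a, N a = 0 → D.α a * (1 - z) = 0
  sep : ∀ {ι : Type} [Uncountable ι] (F : ι → A) (ε : ℝ), 0 < ε → ∃ i i', i ≠ i' ∧ N (F i - F i') < ε

theorem exists_N [Countable G] {z : A} (hz : D.IsZ z) : ∃ N, D.IsN z N := by
  set q := 1 - z with hq
  have τt : ∀ a b, D.τ (a * b) = D.τ (b * a) := fun a b => by rw [D.hτ, D.hτ, D.Pt, D.Pst]
  have q0 : 0 ≤ q := sub_nonneg.2 hz.h1
  have qn : ‖q‖ ≤ 1 := norm_le_of_le_one q0 (sub_le_self _ hz.h0)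
  have qc : ∀ a, D.α a * q = q * D.α a := fun a => by
    rw [hq, mul_sub, sub_mul, hz.comm, mul_one, one_mul]
  -- the operators
  have hV : ∀ g : G, ∃ V : D.τ.GNS →L[ℂ] D.P.GNS, ∀ a, V (hat D.τ a) = hat D.P (D.α (D.th g a) * q) := by
    intro g
    obtain ⟨V, hV, -⟩ := exists_ext D.τ (hat D.P ∘ₗ LinearMap.mulRight ℂ q ∘ₗ
      D.α.toAlgHom.toLinearMap ∘ₗ (D.th g).toAlgHom.toLinearMap) 1 (fun a => by
        show ‖hat D.P (D.α (D.th g a) * q)‖ ≤ _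
        rw [norm_hat, one_mul]
        refine (nrm_mul_le' D.Pt _ _).trans ?_
        have h1 := D.P_le_τ (D.α (D.th g a))
        rw [D.nrmτ_hom D.ατ, D.nrmτ_hom (D.thτ g)] at h1
        nlinarith [nrm_nonneg D.P (D.α (D.th g a)), norm_nonneg q])
    exact ⟨V, hV⟩
  choose V hV using hV
  have hU : ∀ g : G, ∃ U : D.τ.GNS →L[ℂ] D.τ.GNS, (∀ a, U (hat D.τ a) = hat D.τ (D.th g a)) ∧
      ∀ v, ‖U v‖ ≤ 1 * ‖v‖ := by
    intro g
    exact exists_ext D.τ (hat D.τ ∘ₗ (D.th g).toAlgHom.toLinearMap) 1 (fun a => by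
        show ‖hat D.τ (D.th g a)‖ ≤ _
        rw [norm_hat, one_mul, D.nrmτ_hom (D.thτ g)])
  choose U hU hUn using hU
  set Va := fun g => ContinuousLinearMap.adjoint (V g) with hVa
  set L : Submodule ℂ D.τ.GNS := (Submodule.span ℂ (⋃ g, Set.range (Va g))).topologicalClosure with hL
  haveI : CompleteSpace L := (Submodule.isClosed_topologicalClosure _).completeSpace_coe
  have Lsep : TopologicalSpace.IsSeparable (L : Set D.τ.GNS) := by
    haveI := D.sep
    rw [hL, Submodule.topologicalClosure_coe]
    refine TopologicalSpace.IsSeparable.closure (TopologicalSpace.IsSeparable.span ?_)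
    exact TopologicalSpace.IsSeparable.iUnion fun g =>
      TopologicalSpace.isSeparable_range (Va g).continuous
  have Lmem : ∀ g ξ, Va g ξ ∈ L := fun g ξ => Submodule.le_topologicalClosure _
    (Submodule.subset_span (Set.mem_iUnion.2 ⟨g, ξ, rfl⟩))
  have Linv : ∀ T : D.τ.GNS →L[ℂ] D.τ.GNS, (∀ g ξ, T (Va g ξ) ∈ L) → ∀ v ∈ L, T v ∈ L := by
    intro T hT v hv
    have h1 : Submodule.span ℂ (⋃ g, Set.range (Va g)) ≤ L.comap (T : D.τ.GNS →ₗ[ℂ] D.τ.GNS) := by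
      rw [Submodule.span_le]
      rintro _ hw
      obtain ⟨g, ξ, rfl⟩ := Set.mem_iUnion.1 hw
      exact hT g ξ
    have h2 : IsClosed ((T : D.τ.GNS → D.τ.GNS) ⁻¹' (L : Set D.τ.GNS)) :=
      (Submodule.isClosed_topologicalClosure _).preimage T.continuous
    exact closure_minimal h1 h2 hv
  have ext : ∀ v w : D.τ.GNS, (∀ a, ⟪hat D.τ a, v⟫_ℂ = ⟪hat D.τ a, w⟫_ℂ) → v = w := fun v w h =>
    ext_inner_left ℂ fun y => hat_induction D.τ (p := fun y => ⟪y, v⟫_ℂ = ⟪y, w⟫_ℂ)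
      (isClosed_eq (by fun_prop) (by fun_prop)) h y
  have Ll : ∀ a, ∀ v ∈ L, lam D.τ a v ∈ L := fun a => Linv _ fun g ξ => by
    have : lam D.τ a (Va g ξ) = Va g (lam D.P (D.α (D.th g a)) ξ) := ext _ _ fun b => by
      have h1 := lam_adj D.τ (star a) (hat D.τ b) (Va g ξ)
      have h2 := lam_adj D.P (star (D.α (D.th g a))) (V g (hat D.τ b)) ξ
      rw [star_star] at h1 h2
      rw [← h1, ContinuousLinearMap.adjoint_inner_right, ContinuousLinearMap.adjoint_inner_right,
        ← h2, lam_hat, hV, hV, lam_hat, map_mul (D.th g), map_mul D.α, map_star, map_star, mul_assoc]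
    rw [this]; exact Lmem _ _
  have Lr : ∀ a, ∀ v ∈ L, rmul D.τ a v ∈ L := fun a => Linv _ fun g ξ => by
    have : rmul D.τ a (Va g ξ) = Va g (rmul D.P (D.α (D.th g a)) ξ) := ext _ _ fun b => by
      have h1 := rmul_adj τt (star a) (hat D.τ b) (Va g ξ)
      have h2 := rmul_adj D.Pt (star (D.α (D.th g a))) (V g (hat D.τ b)) ξ
      rw [star_star] at h1 h2
      rw [← h1, ContinuousLinearMap.adjoint_inner_right, ContinuousLinearMap.adjoint_inner_right,
        ← h2, rmul_hat τt, hV, hV, rmul_hat D.Pt, map_mul (D.th g), map_mul D.α, mul_assoc, qc, map_star, map_star,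
        mul_assoc]
    rw [this]; exact Lmem _ _
  have Uadj : ∀ g v w, ⟪U g v, w⟫_ℂ = ⟪v, U g⁻¹ w⟫_ℂ := by
    intro g v w
    refine hat_induction D.τ (p := fun v => ⟪U g v, w⟫_ℂ = ⟪v, U g⁻¹ w⟫_ℂ)
      (isClosed_eq (by fun_prop) (by fun_prop)) (fun a => ?_) v
    refine hat_induction D.τ (p := fun w => ⟪U g (hat D.τ a), w⟫_ℂ = ⟪hat D.τ a, U g⁻¹ w⟫_ℂ)
      (isClosed_eq (by fun_prop) (by fun_prop)) (fun b => ?_) w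
    rw [hU, hU, inner_hat, inner_hat, ← D.thτ g⁻¹, map_mul, map_star, D.th_inv]
  have LU : ∀ h, ∀ v ∈ L, U h v ∈ L := fun h => Linv _ fun g ξ => by
    have : U h (Va g ξ) = Va (g * h⁻¹) ξ := ext _ _ fun b => by
      have h1 := Uadj h⁻¹ (hat D.τ b) (Va g ξ)
      rw [inv_inv] at h1
      rw [← h1, ContinuousLinearMap.adjoint_inner_right, ContinuousLinearMap.adjoint_inner_right,
        hU, hV, hV, D.thm]
    rw [this]; exact Lmem _ _
  set e := L.starProjection with he
  have el : ∀ a v, e (lam D.τ a v) = lam D.τ a (e v) := fun a v =>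
    proj_comm L (lam D.τ a) (lam D.τ (star a)) (fun u v => map_sub _ _ _) (lam_adj D.τ a)
      (Ll a) (Ll _) v
  have er : ∀ a v, e (rmul D.τ a v) = rmul D.τ a (e v) := fun a v =>
    proj_comm L (rmul D.τ a) (rmul D.τ (star a)) (fun u v => map_sub _ _ _) (rmul_adj τt a)
      (Lr a) (Lr _) v
  have eU : ∀ g v, e (U g v) = U g (e v) := fun g v =>
    proj_comm L (U g) (U g⁻¹) (fun u v => map_sub _ _ _) (Uadj g) (LU g) (LU _) v
  have inv1 : ∀ g a, ‖e (hat D.τ (D.th g a))‖ ≤ ‖e (hat D.τ a)‖ := fun g a => by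
    rw [← hU, eU]; simpa using hUn g (e (hat D.τ a))
  refine ⟨fun a => ‖e (hat D.τ a)‖, fun a => norm_nonneg _, fun a b => ?_, fun c a => ?_, fun a => ?_,
    fun g a => le_antisymm (inv1 g a) ?_, fun a b => ?_, fun a b => ?_, fun a ha => ?_, fun a ha => ?_,
    fun {ι} _ F ε hε => ?_⟩
  · rw [map_add, map_add]; exact norm_add_le _ _
  · rw [map_smul, map_smul, norm_smul]
  · rw [← norm_hat]; exact L.norm_starProjection_apply_le _
  · have := inv1 g⁻¹ (D.th g a); rwa [D.th_inv] at this
  · rw [← lam_hat, el]; exact lam_norm_le _ _ _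
  · rw [← rmul_hat τt, er]; exact rmul_norm_le τt _ _
  · rw [norm_eq_zero, he, Submodule.starProjection_apply_eq_zero_iff, hL, Submodule.orthogonal_closure,
      Submodule.mem_orthogonal]
    intro w hw
    refine Submodule.span_induction (p := fun w _ => ⟪w, hat D.τ a⟫_ℂ = 0) ?_ (by simp)
      (fun x y _ _ h1 h2 => by rw [inner_add_left, h1, h2, add_zero])
      (fun c x _ h => by rw [inner_smul_left, h, mul_zero]) hw
    intro w hw
    obtain ⟨g, ξ, rfl⟩ := Set.mem_iUnion.1 hw
    rw [ContinuousLinearMap.adjoint_inner_left, hV, hq, mul_sub, mul_one,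
      hz.j _ ((D.thPs g a).trans ha), sub_self, map_zero, inner_zero_right]
  · rw [norm_eq_zero, he, Submodule.starProjection_apply_eq_zero_iff, Submodule.mem_orthogonal] at ha
    have h1 : V 1 (hat D.τ a) = 0 := ext_inner_left ℂ fun ξ => by
      rw [← ContinuousLinearMap.adjoint_inner_left, inner_zero_right]
      exact ha _ (Lmem 1 ξ)
    rw [hV, D.th1] at h1
    exact D.Pf _ (by rw [← norm_hat, h1, norm_zero])
  · obtain ⟨C, hC, hC'⟩ := Lsep
    have h1 : ∀ i, ∃ c : C, dist (e (hat D.τ (F i))) c < ε / 2 := fun i => by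
      obtain ⟨c, hc, h⟩ := Metric.mem_closure_iff.1 (hC' (L.starProjection_apply_mem (hat D.τ (F i))))
        (ε / 2) (half_pos hε)
      exact ⟨⟨c, hc⟩, h⟩
    choose c hc using h1
    haveI := hC.to_subtype
    have h2 : ¬ Function.Injective c := fun h => not_countable (α := ι) h.countable
    rw [Function.not_injective_iff] at h2
    obtain ⟨i, i', h3, h4⟩ := h2
    refine ⟨i, i', h4, ?_⟩
    show ‖e (hat D.τ (F i - F i'))‖ < ε
    rw [map_sub, map_sub, ← dist_eq_norm]
    refine (dist_triangle_right _ _ (c i : D.τ.GNS)).trans_lt ?_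
    have := hc i'
    rw [← h3] at this
    linarith [hc i]

end BS
end setup
end TailProof

namespace TailProof
section setup
variable {A H : Type} [CStarAlgebra A] [PartialOrder A] [StarOrderedRing A]
    [NormedAddCommGroup H] [InnerProductSpace ℂ H] [CompleteSpace H]

/-- resolvent -/
noncomputable def Rs (a : A) : A := Ring.inverse (1 - Complex.I • a)
/-- Cayley transform -/
noncomputable def Ky (a : A) : A := (2 : ℂ) • Rs a - 1

lemma norm_one_le : ‖(1 : A)‖ ≤ 1 := norm_le_of_le_one zero_le_one le_rfl

lemma unit_norm {a : A} (h : star a * a = 1) : ‖a‖ ≤ 1 := by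
  have h1 := CStarRing.norm_star_mul_self (x := a)
  rw [h] at h1
  nlinarith [norm_one_le (A := A), norm_nonneg a]

section cay
variable {a : A} (ha : IsSelfAdjoint a)
include ha
lemma Rs_unit : IsUnit (1 - Complex.I • a) := by
  have h0 : 0 ≤ a * a := by
    have := star_mul_self_nonneg a; rwa [ha.star_eq] at this
  have e1 : (1 - Complex.I • a) * (1 + Complex.I • a) = 1 + a * a := by
    simp only [sub_mul, mul_add, one_mul, mul_one, smul_mul_smul_comm, Complex.I_mul_I]
    rw [neg_one_smul]; abel
  have e2 : (1 + Complex.I • a) * (1 - Complex.I • a) = 1 + a * a := by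
    simp only [mul_sub, add_mul, one_mul, mul_one, smul_mul_smul_comm, Complex.I_mul_I]
    rw [neg_one_smul]; abel
  have h1 : (1 - Complex.I • a) * ((1 + Complex.I • a) * res (a * a)) = 1 := by
    rw [← mul_assoc, e1, mul_res h0]
  have h2 : (res (a * a) * (1 + Complex.I • a)) * (1 - Complex.I • a) = 1 := by
    rw [mul_assoc, e2, res_mul h0]
  exact ⟨⟨_, _, h1, by rw [← left_inv_eq_right_inv h2 h1, h2]⟩, rfl⟩

lemma Rs_mul : Rs a * (1 - Complex.I • a) = 1 := Ring.inverse_mul_cancel _ (Rs_unit ha)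
lemma mul_Rs : (1 - Complex.I • a) * Rs a = 1 := Ring.mul_inverse_cancel _ (Rs_unit ha)

lemma Rs_hom (θ : A →⋆ₐ[ℂ] A) : θ (Rs a) = Rs (θ a) := by
  have h1 : θ (Rs a) * (1 - Complex.I • θ a) = 1 := by
    rw [← map_smul, ← map_one θ, ← map_sub, ← map_mul, Rs_mul ha]
  exact left_inv_eq_right_inv h1 (mul_Rs (ha.map θ))

lemma Ky_hom (θ : A →⋆ₐ[ℂ] A) : θ (Ky a) = Ky (θ a) := by
  rw [Ky, map_sub, map_smul, Rs_hom ha, map_one, Ky]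

lemma Ky_unit : star (Ky a) * Ky a = 1 ∧ Ky a * star (Ky a) = 1 := by
  have hs : (1 + Complex.I • a) * star (Rs a) = 1 ∧ star (Rs a) * (1 + Complex.I • a) = 1 := by
    have h1 := congrArg star (Rs_mul ha)
    have h2 := congrArg star (mul_Rs ha)
    simp only [star_mul, star_sub, star_one, star_smul, ha.star_eq, Complex.star_def,
      Complex.conj_I, neg_smul, sub_neg_eq_add] at h1 h2
    exact ⟨h1, h2⟩
  have e1 : (1 + Complex.I • a) = 2 - (1 - Complex.I • a) := by
    rw [show (2 : A) = 1 + 1 from one_add_one_eq_two.symm]; abel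
  rw [e1] at hs
  have r1 := Rs_mul ha
  have r2 := mul_Rs ha
  generalize 1 - Complex.I • a = y at *
  have k : Ky a = 2 * Rs a - 1 := by rw [Ky, two_smul, two_mul]
  have k' : star (Ky a) = 2 * star (Rs a) - 1 := by rw [k]; simp [star_mul, mul_two, two_mul]
  rw [k', k]
  generalize Rs a = r at *
  generalize star r = s at *
  have h1 : s * y = 2 * s - 1 := by
    have := hs.2; rw [mul_sub] at this; rw [two_mul, ← mul_two, ← this]; abel
  have h2 : y * s = 2 * s - 1 := by
    have := hs.1; rw [sub_mul] at this; rw [← this]; abel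
  rw [← h1]
  constructor
  · rw [mul_sub, mul_one, mul_assoc, ← mul_assoc y, (Commute.ofNat_right y 2).eq, mul_assoc 2, r2, mul_one, ← mul_sub, ← hs.2]
  · rw [h1, ← h2, sub_mul, one_mul, mul_assoc, ← mul_assoc r, r1, one_mul, ← sub_mul, hs.1]

lemma Rs_norm : ‖Rs a‖ ≤ 1 := by
  have h : Rs a = (1 / 2 : ℂ) • (Ky a + 1) := by rw [Ky]; module
  rw [h, norm_smul]
  have := norm_add_le (Ky a) 1
  have h1 := unit_norm (Ky_unit ha).1
  have h2 := norm_one_le (A := A)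
  have : ‖(1 / 2 : ℂ)‖ = 1 / 2 := by norm_num
  rw [this]; linarith

lemma Ky_sub_one : Ky a - 1 = (2 * Complex.I) • (a * Rs a) := by
  have h := mul_Rs ha
  rw [sub_mul, one_mul, smul_mul_assoc] at h
  rw [Ky, mul_smul]
  have : Complex.I • (a * Rs a) = Rs a - 1 := by rw [← h]; abel
  rw [this]; module

lemma Ky_taylor : ‖Ky a - 1 - (2 * Complex.I) • a‖ ≤ 2 * ‖a‖ ^ 2 := by
  have h := mul_Rs ha
  rw [sub_mul, one_mul, smul_mul_assoc] at h
  have h1 : Rs a - 1 = Complex.I • (a * Rs a) := by rw [← h]; abel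
  have e : Ky a - 1 - (2 * Complex.I) • a = (-2 : ℂ) • (a * (a * Rs a)) := by
    rw [Ky_sub_one ha, ← smul_sub, ← mul_sub_one, h1, mul_smul_comm, smul_smul, mul_assoc,
      Complex.I_mul_I]; simp
  rw [e, norm_smul]
  have h2 := norm_mul_le a (a * Rs a)
  have h3 := norm_mul_le a (Rs a)
  have h4 := Rs_norm ha
  have : ‖(-2 : ℂ)‖ = 2 := by norm_num
  rw [this]
  have h5 : ‖a * Rs a‖ ≤ ‖a‖ := by nlinarith [norm_nonneg a]
  nlinarith [norm_nonneg a]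

lemma Ky_diff {b : A} (hb : IsSelfAdjoint b) :
    Ky a - Ky b = (2 * Complex.I) • (Rs a * (a - b) * Rs b) := by
  have e : Rs a - Rs b = Complex.I • (Rs a * (a - b) * Rs b) := by
    have h1 : Rs a * ((1 - Complex.I • b) - (1 - Complex.I • a)) * Rs b = Rs a - Rs b := by
      rw [mul_sub, sub_mul, mul_assoc, mul_Rs hb, Rs_mul ha, mul_one, one_mul]
    rw [← h1, ← smul_mul_assoc, ← mul_smul_comm, smul_sub]; congr 2; abel
  rw [Ky, Ky, mul_smul, ← e]; module

lemma Ky_diff_norm {b : A} (hb : IsSelfAdjoint b) : ‖Ky a - Ky b‖ ≤ 2 * ‖a - b‖ := by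
  rw [Ky_diff ha hb, norm_smul]
  have : ‖(2 * Complex.I : ℂ)‖ = 2 := by norm_num
  rw [this]
  have h1 := norm_mul_le (Rs a * (a - b)) (Rs b)
  have h2 := norm_mul_le (Rs a) (a - b)
  have h3 := Rs_norm ha
  have h4 := Rs_norm hb
  have h5 : ‖Rs a * (a - b)‖ ≤ ‖a - b‖ := by nlinarith [norm_nonneg (a - b)]
  have := norm_nonneg (Rs a * (a - b))
  nlinarith

end cay

namespace BS
variable {S : VNRep A H} {G : Type} [Group G] {D : BS S G}

/-- congruence modulo the ideal -/
def Eqv (D : BS S G) (a b : A) : Prop := nrm D.Ps (a - b) = 0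

lemma Eqv.of_le {a b : A} (h : nrm D.Ps (a - b) ≤ 0) : D.Eqv a b := le_antisymm h (nrm_nonneg _ _)
lemma Eqv.refl (a : A) : D.Eqv a a := by rw [Eqv, sub_self, nrm_zero]
lemma Eqv.symm {a b : A} (h : D.Eqv a b) : D.Eqv b a := by rw [Eqv, nrm_sub_rev]; exact h
lemma Eqv.trans {a b c : A} (h : D.Eqv a b) (h' : D.Eqv b c) : D.Eqv a c := Eqv.of_le (by
  have := nrm_add_le D.Ps (a - b) (b - c)
  rw [h, h'] at this; simpa using this)
lemma Eqv.add {a b c d : A} (h : D.Eqv a b) (h' : D.Eqv c d) : D.Eqv (a + c) (b + d) :=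
  Eqv.of_le (by
    have := nrm_add_le D.Ps (a - b) (c - d)
    rw [h, h'] at this; rw [add_sub_add_comm]; simpa using this)
lemma Eqv.mul {a b c d : A} (h : D.Eqv a b) (h' : D.Eqv c d) : D.Eqv (a * c) (b * d) :=
  Eqv.of_le (by
    have := nrm_add_le D.Ps ((a - b) * c) (b * (c - d))
    rw [D.ideal_right h, D.ideal_left h', sub_mul, mul_sub] at this; simpa using this)
lemma Eqv.sub {a b c d : A} (h : D.Eqv a b) (h' : D.Eqv c d) : D.Eqv (a - c) (b - d) :=
  Eqv.of_le (by
    have := nrm_sub_le D.Ps (a - b) (c - d)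
    rw [h, h'] at this; rw [sub_sub_sub_comm]; simpa using this)
lemma Eqv.th {a b : A} (h : D.Eqv a b) (g : G) : D.Eqv (D.th g a) (D.th g b) := by
  rw [Eqv, ← map_sub, D.thPs]; exact h
lemma Eqv.Ky {a b : A} (h : D.Eqv a b) (ha : IsSelfAdjoint a) (hb : IsSelfAdjoint b) :
    D.Eqv (TailProof.Ky a) (TailProof.Ky b) := by
  rw [Eqv, Ky_diff ha hb, nrm_smul, D.ideal_right (D.ideal_left h _), mul_zero]

/-- good cutoffs -/
structure Good (D : BS S G) (δ : ℝ) (c : A) : Prop where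
  h0 : 0 ≤ c
  h1 : c ≤ 1
  e : D.Eqv c 1
  p : (D.P c).re ≤ δ

lemma good_exists (D : BS S G) {δ : ℝ} (hδ : 0 < δ) : ∃ c, D.Good δ c := by
  have h1 := (D.Pc.tendsto S D.un D.us).const_mul (nrm D.P 1)
  rw [mul_zero] at h1
  obtain ⟨n, hn⟩ := (h1.eventually (gt_mem_nhds hδ)).exists
  refine ⟨1 - D.u n, sub_nonneg.2 (D.u1 n), sub_le_self _ (D.u0 n), ?_, ?_⟩
  · have := D.uz n
    rw [Eqv, sub_sub_cancel_left, ← neg_one_smul ℂ, nrm_smul, this, mul_zero]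
  · refine (re_le_nrm D.P _).trans ?_
    rw [nrm_sub_rev]; exact hn.le

lemma Good.th {δ : ℝ} {c : A} (h : D.Good δ c) (g : G) : D.Good δ (D.th g c) :=
  ⟨hom_nonneg _ h.h0, hom_le_one _ h.h1, by have := h.e.th g; rwa [map_one] at this,
    by rw [D.thPre]; exact h.p⟩

lemma Good.avg {δ : ℝ} {c : ℕ → A} (h : ∀ n, D.Good δ (c n)) (M : ℕ) :
    D.Good δ ((1 / ((M : ℝ) + 1)) • ∑ n ∈ Finset.range (M + 1), c n) := by
  have hM : (0 : ℝ) < (M : ℝ) + 1 := by positivity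
  have hs : ∀ a : A, a = (1 / ((M : ℝ) + 1)) • ∑ n ∈ Finset.range (M + 1), a := fun a => by
    rw [Finset.sum_const, Finset.card_range, ← Nat.cast_smul_eq_nsmul ℝ, smul_smul]
    push_cast; rw [one_div, inv_mul_cancel₀ hM.ne', one_smul]
  refine ⟨rsmul_nonneg _ (by positivity) (Finset.sum_nonneg fun n _ => (h n).h0), ?_, ?_, ?_⟩
  · rw [hs 1, ← sub_nonneg, ← smul_sub, ← Finset.sum_sub_distrib]
    exact rsmul_nonneg _ (by positivity) (Finset.sum_nonneg fun n _ => sub_nonneg.2 (h n).h1)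
  · have h1 : ∀ k, nrm D.Ps (∑ n ∈ Finset.range k, (c n - 1)) ≤ 0 := by
      intro k
      induction k with
      | zero => simp [nrm_zero]
      | succ k ih =>
        rw [Finset.sum_range_succ]
        refine (nrm_add_le _ _ _).trans ?_
        have := (h k).e
        rw [Eqv] at this; linarith
    rw [hs 1]
    refine Eqv.of_le ?_
    rw [← smul_sub, ← Finset.sum_sub_distrib, ← Complex.coe_smul, nrm_smul,
      le_antisymm (h1 _) (nrm_nonneg _ _), mul_zero]
  · rw [re_smul, re_sum]
    have h2 := Finset.sum_le_card_nsmul (Finset.range (M + 1)) (fun n => (D.P (c n)).re) δ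
      fun n _ => (h n).p
    rw [Finset.card_range, nsmul_eq_mul] at h2
    push_cast at h2
    rw [one_div, inv_mul_le_iff₀ hM]; exact h2

lemma folner (D : BS S G) {δ ε : ℝ} (hδ : 0 < δ) (hε : 0 < ε) (k : ℕ) :
    ∃ c, D.Good δ c ∧ ∀ i < k, ‖D.th (D.σ (2 * i)) c - c‖ ≤ ε := by
  induction k with
  | zero =>
    obtain ⟨c, hc⟩ := D.good_exists hδ
    exact ⟨c, hc, by simp⟩
  | succ k ih =>
    obtain ⟨c, hc, h⟩ := ih
    obtain ⟨M, hM⟩ := exists_nat_gt (2 / ε)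
    have hM0 : (0 : ℝ) < (M : ℝ) + 1 := by positivity
    refine ⟨_, Good.avg (fun n => hc.th (D.σ (2 * k) ^ n)) M, fun i hi => ?_⟩
    rw [← Complex.coe_smul, map_smul, Complex.coe_smul, Complex.coe_smul, ← smul_sub, map_sum,
      ← Finset.sum_sub_distrib, norm_smul, Real.norm_of_nonneg (by positivity), one_div,
      inv_mul_le_iff₀ hM0]
    rcases Nat.lt_succ_iff_lt_or_eq.1 hi with h1 | rfl
    · refine (norm_sum_le _ _).trans ?_
      have h2 := Finset.sum_le_card_nsmul (Finset.range (M + 1)) (fun n => ‖D.th (D.σ (2 * i))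
        (D.th (D.σ (2 * k) ^ n) c) - D.th (D.σ (2 * k) ^ n) c‖) ε fun n _ => by
          have hcm : Commute (D.σ (2 * i)) (D.σ (2 * k)) := D.cm _ _ (by omega)
          rw [← D.thm, (hcm.pow_right n).eq, D.thm, ← map_sub]
          exact (NonUnitalStarAlgHom.norm_apply_le _ _).trans (h i h1)
      rw [Finset.card_range, nsmul_eq_mul] at h2
      push_cast at h2; exact h2
    · have e : ∀ n, D.th (D.σ (2 * i)) (D.th (D.σ (2 * i) ^ n) c) - D.th (D.σ (2 * i) ^ n) c =
          D.th (D.σ (2 * i) ^ (n + 1)) c - D.th (D.σ (2 * i) ^ n) c := fun n => by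
        rw [pow_succ', D.thm]
      rw [Finset.sum_congr rfl fun n _ => e n,
        Finset.sum_range_sub (fun n => D.th (D.σ (2 * i) ^ n) c)]
      refine (norm_sub_le _ _).trans ?_
      have h1 := fun g => (NonUnitalStarAlgHom.norm_apply_le (D.th g) c).trans
        (norm_le_of_le_one hc.h0 hc.h1)
      have h2 : 2 ≤ (M : ℝ) * ε := ((div_lt_iff₀ hε).1 hM).le
      nlinarith [h1 (D.σ (2 * i) ^ (M + 1)), h1 (D.σ (2 * i) ^ 0)]

end BS
end setup
end TailProof

namespace TailProof
section setup
variable {A H : Type} [CStarAlgebra A] [PartialOrder A] [StarOrderedRing A]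
    [NormedAddCommGroup H] [InnerProductSpace ℂ H] [CompleteSpace H]
namespace BS
variable {S : VNRep A H} {G : Type} [Group G] {D : BS S G}

/-- unitarity -/
def Un (a : A) : Prop := star a * a = 1 ∧ a * star a = 1

lemma Un.norm {a : A} (h : Un a) : ‖a‖ ≤ 1 := unit_norm h.1
lemma Un.one : Un (1 : A) := by simp [Un]
lemma Un.mul {a b : A} (h : Un a) (h' : Un b) : Un (a * b) := by
  constructor
  · rw [star_mul, mul_assoc, ← mul_assoc (star a), h.1, one_mul, h'.1]
  · rw [star_mul, mul_assoc, ← mul_assoc b, h'.2, one_mul, h.2]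
lemma Un.star {a : A} (h : Un a) : Un (star a) := by
  rw [Un, star_star]; exact ⟨h.2, h.1⟩

/-- finite products -/
def Q (E : ℕ → A) : ℕ → ℕ → A
  | _, 0 => 1
  | k, n + 1 => E k * Q E (k + 1) n

lemma Q_succ (E : ℕ → A) (n k : ℕ) : Q E k (n + 1) = Q E k n * E (k + n) := by
  induction n generalizing k with
  | zero => simp [Q]
  | succ n ih =>
    rw [Q, ih (k + 1), Q, mul_assoc]; congr 3; ring

lemma Q_un {E : ℕ → A} (hE : ∀ j, Un (E j)) (n k : ℕ) : Un (Q E k n) := by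
  induction n generalizing k with
  | zero => exact Un.one
  | succ n ih => exact (hE k).mul (ih _)

/-- infinite products -/
lemma prodlim (D : BS S G) {E : ℕ → A} {C : ℝ} (hE : ∀ j, Un (E j))
    (hP : ∀ j, nrm D.P (E j - 1) ≤ C * (1 / 2) ^ j) :
    ∃ T : ℕ → A, (∀ k, Un (T k)) ∧ (∀ k, T k = E k * T (k + 1)) ∧
      ∀ g k, (∀ j ≥ k, ‖D.th g (E j) - E j‖ ≤ C * (1 / 2) ^ j) →
        ‖D.th g (T k) - T k‖ ≤ 2 * C * (1 / 2) ^ k := by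
  have hlim : ∀ k, ∃ a, Tendsto (fun n => nrm D.P (Q E k n - a)) atTop (𝓝 0) := by
    intro k
    have hc : CauchySeq fun n => hat D.P (Q E k n) := by
      refine cauchySeq_of_le_geometric (1 / 2) (C * (1 / 2) ^ k) (by norm_num) fun n => ?_
      rw [dist_eq_norm, ← map_sub, norm_hat, Q_succ, nrm_sub_rev,
        show Q E k n * E (k + n) - Q E k n = Q E k n * (E (k + n) - 1) by rw [mul_sub, mul_one]]
      refine (nrm_mul_le _ _ _).trans ?_
      have h1 := (Q_un hE n k).norm
      have h2 := hP (k + n)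
      rw [pow_add, ← mul_assoc] at h2
      nlinarith [nrm_nonneg D.P (E (k + n) - 1)]
    obtain ⟨v, hv⟩ := cauchySeq_tendsto_of_complete hc
    obtain ⟨a, ha, -⟩ := F3' S D.Pc D.Pf (fun n => (Q_un hE n k).norm) hv
    refine ⟨a, ?_⟩
    rw [← ha, tendsto_iff_norm_sub_tendsto_zero] at hv
    simpa only [← map_sub, norm_hat] using hv
  choose T hT using hlim
  have un : ∀ k, Un (T k) := by
    intro k
    have key : ∀ (b : ℕ → A) (a : A), (∀ n, Un (b n)) →
        Tendsto (fun n => nrm D.P (b n - a)) atTop (𝓝 0) → star a * a = 1 := by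
      intro b a hb ht
      refine eq_of_close (D := D) fun ε hε => ?_
      have h1 : Tendsto (fun n => (‖a‖ + 1) * nrm D.P (b n - a)) atTop (𝓝 0) := by
        simpa using ht.const_mul (‖a‖ + 1)
      obtain ⟨n, hn⟩ := (h1.eventually (gt_mem_nhds hε)).exists
      have e : star a * a - 1 = -(star a * (b n - a) + star (b n - a) * b n) := by
        rw [← (hb n).1, star_sub, mul_sub, sub_mul]; abel
      rw [e, ← neg_one_smul ℂ, nrm_smul, norm_neg, norm_one, one_mul]
      have h2 := nrm_add_le D.P (star a * (b n - a)) (star (b n - a) * b n)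
      have h3 := nrm_mul_le D.P (star a) (b n - a)
      have h4 := nrm_mul_le' D.Pt (star (b n - a)) (b n)
      rw [nrm_star D.Pt] at h4
      rw [norm_star] at h3
      have h5 := (hb n).norm
      nlinarith [nrm_nonneg D.P (b n - a)]
    refine ⟨key _ _ (fun n => Q_un hE n k) (hT k), ?_⟩
    have := key (fun n => star (Q E k n)) (star (T k)) (fun n => (Q_un hE n k).star) (by
      simpa only [← star_sub, nrm_star D.Pt] using hT k)
    rwa [star_star] at this
  refine ⟨T, un, fun k => ?_, fun g k hg => ?_⟩
  · refine D.P_lim ((tendsto_add_atTop_iff_nat 1).2 (hT k)) ?_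
    refine squeeze_zero (fun _ => nrm_nonneg _ _) (fun n => ?_) (hT (k + 1))
    rw [Q, ← mul_sub]
    refine (nrm_mul_le _ _ _).trans ?_
    nlinarith [(hE k).norm, nrm_nonneg D.P (Q E (k + 1) n - T (k + 1))]
  · have hC : 0 ≤ C := by have := (nrm_nonneg _ _).trans (hP 0); simpa using this
    have hq : ∀ n k, (∀ j ≥ k, ‖D.th g (E j) - E j‖ ≤ C * (1 / 2) ^ j) →
        ‖D.th g (Q E k n) - Q E k n‖ ≤ 2 * C * (1 / 2) ^ k := by
      intro n
      induction n with
      | zero => intro k _; rw [Q, map_one, sub_self, norm_zero]; positivity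
      | succ n ih =>
        intro k hk
        have h1 := ih (k + 1) fun j hj => hk j (by omega)
        have h2 := hk k le_rfl
        have e : D.th g (Q E k (n + 1)) - Q E k (n + 1) = (D.th g (E k) - E k) *
            D.th g (Q E (k + 1) n) + E k * (D.th g (Q E (k + 1) n) - Q E (k + 1) n) := by
          rw [Q, map_mul, sub_mul, mul_sub]; abel
        rw [e]
        refine (norm_add_le _ _).trans ?_
        have h3 := norm_mul_le (D.th g (E k) - E k) (D.th g (Q E (k + 1) n))
        have h4 := norm_mul_le (E k) (D.th g (Q E (k + 1) n) - Q E (k + 1) n)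
        have h5 := (NonUnitalStarAlgHom.norm_apply_le (D.th g) (Q E (k + 1) n)).trans
          (Q_un hE n (k + 1)).norm
        have h6 := (hE k).norm
        rw [pow_succ] at h1
        nlinarith [norm_nonneg (D.th g (E k) - E k),
          norm_nonneg (D.th g (Q E (k + 1) n) - Q E (k + 1) n)]
    obtain ⟨a, ha, f, hf⟩ := F3' S D.Pc D.Pf (b := fun n => D.th g (Q E k n) - Q E k n)
      (fun n => hq n k hg) (v := hat D.P (D.th g (T k) - T k)) (by
        rw [tendsto_iff_norm_sub_tendsto_zero]
        refine squeeze_zero (fun _ => norm_nonneg _) (fun n => ?_)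
          (by simpa using (hT k).const_mul 2)
        rw [← map_sub, norm_hat, sub_sub_sub_comm, ← map_sub]
        refine (nrm_sub_le _ _ _).trans ?_
        rw [D.thP]; linarith)
    have : a = D.th g (T k) - T k := by
      rw [← sub_eq_zero]; apply D.Pf
      rw [← norm_hat, map_sub, ha, sub_self, norm_zero]
    rw [← this]
    exact hf.norm_le S fun n => hq (f n) k hg

lemma modT {E T : ℕ → A} {C : ℝ} {g : G} {i : ℕ} (hE : ∀ j, Un (E j))
    (h1 : ∀ k, T k = E k * T (k + 1))
    (h2 : ∀ k > i, ‖D.th g (T k) - T k‖ ≤ 2 * C * (1 / 2) ^ k) (k : ℕ)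
    (h3 : ∀ j ≥ k, D.Eqv (D.th g (E j)) (E j)) : D.Eqv (D.th g (T k)) (T k) := by
  have step : ∀ n, nrm D.Ps (D.th g (T k) - T k) ≤ nrm D.Ps (D.th g (T (k + n)) - T (k + n)) := by
    intro n
    induction n with
    | zero => exact le_rfl
    | succ n ih =>
      refine ih.trans ?_
      have e : D.th g (T (k + n)) - T (k + n) = (D.th g (E (k + n)) - E (k + n)) *
          D.th g (T (k + n + 1)) + E (k + n) * (D.th g (T (k + n + 1)) - T (k + n + 1)) := by
        rw [h1 (k + n), map_mul, sub_mul, mul_sub]; abel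
      rw [e]
      refine (nrm_add_le _ _ _).trans ?_
      rw [D.ideal_right (h3 (k + n) (by omega)), zero_add]
      refine (nrm_mul_le _ _ _).trans ?_
      have := (hE (k + n)).norm
      have h5 := nrm_nonneg D.Ps (D.th g (T (k + n + 1)) - T (k + n + 1))
      rw [← add_assoc k n 1]
      nlinarith
  refine Eqv.of_le (ge_of_tendsto (x := atTop) (f := fun n : ℕ => 2 * C * (1 / 2) ^ n * nrm D.Ps 1)
    ?_ ?_)
  · have := ((tendsto_pow_atTop_nhds_zero_of_lt_one (r := (1 / 2 : ℝ)) (by norm_num)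
      (by norm_num)).const_mul (2 * C)).mul_const (nrm D.Ps 1)
    simpa using this
  · filter_upwards [eventually_gt_atTop (i + k)] with n hn
    have h4 := step (n - k)
    rw [Nat.add_sub_cancel' (by omega)] at h4
    refine (h4.trans (nrm_le_norm _ _)).trans ?_
    exact mul_le_mul_of_nonneg_right (h2 n (by omega)) (nrm_nonneg _ _)

lemma IsN.sub {z : A} {N : A → ℝ} (hN : D.IsN z N) (a b : A) : N (a - b) ≤ N a + N b := by
  have := hN.add a ((-1 : ℂ) • b)
  rw [hN.smul, neg_one_smul, ← sub_eq_add_neg] at this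
  simpa using this

lemma IsN.eqv {z : A} {N : A → ℝ} (hN : D.IsN z N) {a b : A} (h : D.Eqv a b) : N a ≤ N b := by
  have := hN.add (a - b) b
  rwa [sub_add_cancel, hN.j _ h, zero_add] at this

lemma IsN.unl {z : A} {N : A → ℝ} (hN : D.IsN z N) {a : A} (h : Un a) (b : A) : N b ≤ N (a * b) := by
  have h1 := hN.mull (star a) (a * b)
  rw [← mul_assoc, h.1, one_mul] at h1
  nlinarith [hN.nn (a * b), h.star.norm]

lemma IsN.unr {z : A} {N : A → ℝ} (hN : D.IsN z N) {a : A} (h : Un a) (b : A) : N b ≤ N (b * a) := by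
  have h1 := hN.mulr (star a) (b * a)
  rw [mul_assoc, h.2, mul_one] at h1
  nlinarith [hN.nn (b * a), h.star.norm]

/-- the basic unitaries -/
lemma exists_e (D : BS S G) {h : ℕ → A} (hb : D.IsBr h) (hs : ∀ n, IsSelfAdjoint (h n)) {C : ℝ}
    (hC : ∀ n, ‖h n‖ ≤ C) : ∃ e : ℕ → A, (∀ j, Un (e j)) ∧
      (∀ j, nrm D.P (e j - 1) ≤ 4 * C * (1 / 2) ^ j) ∧
      (∀ i j, i ≠ j → D.Eqv (D.th (D.σ (2 * i)) (e j)) (e j)) ∧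
      (∀ i j, i < j → ‖D.th (D.σ (2 * i)) (e j) - e j‖ ≤ 4 * C * (1 / 2) ^ j) ∧
      (∀ j, D.Eqv (D.th (D.σ (2 * j)) (e j)) (Ky (h (2 * j + 1)))) ∧
      (∀ j, D.Eqv (e j) (Ky (h (2 * j)))) := by
  have hc : ∀ j : ℕ, ∃ c, D.Good ((1 / 2) ^ j * (1 / 2) ^ j) c ∧
      ∀ i < j, ‖D.th (D.σ (2 * i)) c - c‖ ≤ (1 / 2) ^ j := fun j =>
    D.folner (by positivity) (by positivity) j
  choose c hg hcs using hc
  have cn : ∀ j, ‖c j‖ ≤ 1 := fun j => norm_le_of_le_one (hg j).h0 (hg j).h1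
  have csa : ∀ j, IsSelfAdjoint (c j) := fun j => IsSelfAdjoint.of_nonneg (hg j).h0
  have hC0 : 0 ≤ C := (norm_nonneg _).trans (hC 0)
  have sa : ∀ j, IsSelfAdjoint (c j * h (2 * j) * c j) := fun j => by
    have := (hs (2 * j)).conjugate (c j)
    rwa [(csa j).star_eq] at this
  have ev : ∀ j, D.Eqv (c j * h (2 * j) * c j) (h (2 * j)) := fun j => by
    have := ((hg j).e.mul (Eqv.refl (h (2 * j)))).mul (hg j).e
    simpa using this
  have fixh : ∀ i j, i ≠ j → D.th (D.σ (2 * i)) (h (2 * j)) = h (2 * j) := fun i j hij => by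
    rcases Nat.lt_or_gt_of_ne hij with h1 | h1
    · exact hb.lo (by omega)
    · exact hb.hi (by omega)
  have ke : ∀ j, D.Eqv (Ky (c j * h (2 * j) * c j)) (Ky (h (2 * j))) := fun j =>
    (ev j).Ky (sa j) (hs _)
  refine ⟨fun j => Ky (c j * h (2 * j) * c j), fun j => Ky_unit (sa j), fun j => ?_,
    fun i j hij => ?_, fun i j hij => ?_, fun j => ?_, ke⟩
  · rw [Ky_sub_one (sa j), nrm_smul]
    have h1 := nrm_mul_le' D.Pt (c j * h (2 * j) * c j) (Rs (c j * h (2 * j) * c j))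
    have h2 := Rs_norm (sa j)
    have h3 := nrm_mul_le D.P (c j * h (2 * j)) (c j)
    have h4 := norm_mul_le (c j) (h (2 * j))
    have h5 : nrm D.P (c j) ≤ (1 / 2) ^ j := by
      refine (pow_le_pow_iff_left₀ (nrm_nonneg _ _) (by positivity) two_ne_zero).1 ?_
      rw [sq ((1 / 2 : ℝ) ^ j)]
      exact (nrm_sq_le_of_le_one D.P (hg j).h0 (hg j).h1).trans (hg j).p
    have h6 : ‖c j * h (2 * j)‖ ≤ C := by
      nlinarith [cn j, hC (2 * j), norm_nonneg (c j), norm_nonneg (h (2 * j))]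
    have h7 : nrm D.P (c j * h (2 * j) * c j) ≤ C * (1 / 2) ^ j :=
      h3.trans (mul_le_mul h6 h5 (nrm_nonneg _ _) hC0)
    have : ‖(2 * Complex.I : ℂ)‖ = 2 := by norm_num
    rw [this]
    have h8 : 0 ≤ C * (1 / 2 : ℝ) ^ j := by positivity
    nlinarith [nrm_nonneg D.P (c j * h (2 * j) * c j)]
  · refine (((ke j).th _).trans ?_).trans (ke j).symm
    rw [Ky_hom (hs _), fixh i j hij]; exact Eqv.refl _
  · rw [Ky_hom (sa j)]
    refine (Ky_diff_norm ((sa j).map _) (sa j)).trans ?_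
    rw [map_mul, map_mul, fixh i j hij.ne]
    set d := D.th (D.σ (2 * i)) (c j) with hd
    have e : d * h (2 * j) * d - c j * h (2 * j) * c j = (d - c j) * h (2 * j) * d +
        c j * h (2 * j) * (d - c j) := by rw [sub_mul, sub_mul, mul_sub]; abel
    have dn : ‖d‖ ≤ 1 := (NonUnitalStarAlgHom.norm_apply_le _ _).trans (cn j)
    have b1 : ‖(d - c j) * h (2 * j) * d‖ ≤ ‖d - c j‖ * C * 1 := (norm_mul₃_le).trans (by
      gcongr; exact hC _)
    have b2 : ‖c j * h (2 * j) * (d - c j)‖ ≤ 1 * C * ‖d - c j‖ := (norm_mul₃_le).trans (by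
      gcongr; exacts [cn j, hC _])
    have b3 := norm_add_le ((d - c j) * h (2 * j) * d) (c j * h (2 * j) * (d - c j))
    have b4 := hcs j i hij
    rw [e]
    nlinarith
  · refine ((ke j).th _).trans ?_
    rw [Ky_hom (hs _), ← hb.2]; exact Eqv.refl _

lemma main1 {z : A} {N : A → ℝ} (hN : D.IsN z N) {h : ℕ → A} (hb : D.IsBr h)
    (hs : ∀ n, IsSelfAdjoint (h n)) : N (Ky (h 1) - Ky (h 0)) = 0 := by
  classical
  have hC : ∀ n, ‖h n‖ ≤ ‖h 0‖ := fun n => by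
    induction n with
    | zero => exact le_rfl
    | succ n ih => rw [hb.2]; exact (NonUnitalStarAlgHom.norm_apply_le _ _).trans ih
  obtain ⟨e, eu, eP, e1, e2, e3, e4⟩ := D.exists_e hb hs hC
  set C := 4 * ‖h 0‖ with hCd
  have hC0 : 0 ≤ C := by positivity
  set E : Set ℕ → ℕ → A := fun X j => if j ∈ X then e j else 1 with hE
  have Eu : ∀ X j, Un (E X j) := fun X j => by
    simp only [hE]; split_ifs; exacts [eu j, Un.one]
  have EP : ∀ X j, nrm D.P (E X j - 1) ≤ C * (1 / 2) ^ j := fun X j => by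
    simp only [hE]; split_ifs
    · exact eP j
    · rw [sub_self, nrm_zero]; positivity
  choose T Tu Ts Tn using fun X => D.prodlim (Eu X) (EP X)
  have E1 : ∀ X i j, (i ≠ j ∨ j ∉ X) → D.Eqv (D.th (D.σ (2 * i)) (E X j)) (E X j) := fun X i j hij => by
    simp only [hE]; split_ifs with hj
    · exact e1 i j (hij.resolve_right (not_not.2 hj))
    · rw [map_one]; exact Eqv.refl _
  have E2 : ∀ X i, ∀ k > i, ‖D.th (D.σ (2 * i)) (T X k) - T X k‖ ≤ 2 * C * (1 / 2) ^ k := by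
    intro X i k hk
    refine Tn X _ k fun j hj => ?_
    simp only [hE]; split_ifs
    · exact e2 i j (by omega)
    · rw [map_one, sub_self, norm_zero]; positivity
  have inv : ∀ n, N (Ky (h 1) - Ky (h 0)) = N (Ky (h (n + 1)) - Ky (h n)) := fun n => by
    induction n with
    | zero => rfl
    | succ n ih =>
      rw [ih, ← hN.inv (D.s (n + 2)), map_sub, Ky_hom (hs _), Ky_hom (hs _), hb.shift (by omega),
        hb.shift (by omega)]
  have low : ∀ X i, i ∈ X → N (Ky (h 1) - Ky (h 0)) ≤ N (D.th (D.σ (2 * i)) (T X 0) - T X 0) := by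
    intro X i hi
    set g := D.σ (2 * i) with hg
    have a1 : ∀ k ≤ i, N (D.th g (T X k) - T X k) ≤ N (D.th g (T X 0) - T X 0) := by
      intro k
      induction k with
      | zero => exact fun _ => le_rfl
      | succ k ih =>
        intro hk
        refine le_trans ?_ (ih (by omega))
        refine (hN.unl (Eu X k) _).trans (hN.eqv ?_)
        have := (((E1 X i k (Or.inl (by omega))).symm).mul (Eqv.refl (D.th g (T X (k + 1))))).sub
          (Eqv.refl (E X k * T X (k + 1)))
        rw [Ts X k, map_mul, mul_sub]; exact this
    refine le_trans ?_ (a1 i le_rfl)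
    have hT : D.Eqv (D.th g (T X (i + 1))) (T X (i + 1)) :=
      modT (Eu X) (Ts X) (E2 X i) (i + 1) fun j hj => E1 X i j (Or.inl (by omega))
    have hEi : E X i = e i := by simp [hE, hi]
    rw [inv (2 * i)]
    refine (hN.unr (Tu X (i + 1)) _).trans (hN.eqv ?_)
    rw [Ts X i, map_mul, hEi, sub_mul]
    exact ((e3 i).symm.mul hT.symm).sub ((e4 i).symm.mul (Eqv.refl _))
  have up : ∀ X i, i ∉ X → N (D.th (D.σ (2 * i)) (T X 0) - T X 0) = 0 := fun X i hi =>
    hN.j _ (modT (Eu X) (Ts X) (E2 X i) 0 fun j _ => E1 X i j (by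
      by_cases hij : i = j
      · subst hij; exact Or.inr hi
      · exact Or.inl hij))
  have fin : ∀ X Y i, i ∈ X → i ∉ Y → N (Ky (h 1) - Ky (h 0)) ≤ 2 * N (T X 0 - T Y 0) := by
    intro X Y i hi hi'
    refine (low X i hi).trans ?_
    set g := D.σ (2 * i) with hg
    have e : D.th g (T X 0) - T X 0 = (D.th g (T X 0 - T Y 0) - (T X 0 - T Y 0)) +
        (D.th g (T Y 0) - T Y 0) := by rw [map_sub]; abel
    rw [e]
    refine (hN.add _ _).trans ?_
    rw [up Y i hi']
    have := hN.sub (D.th g (T X 0 - T Y 0)) (T X 0 - T Y 0)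
    rw [hN.inv] at this
    linarith
  haveI : Uncountable (Set ℕ) := by
    rw [← not_countable_iff]; intro hc
    obtain ⟨f, hf⟩ := exists_injective_nat (Set ℕ)
    exact Function.cantor_injective f hf
  refine le_antisymm (le_of_forall_pos_le_add fun ε hε => ?_) (hN.nn _)
  obtain ⟨X, Y, hne, hXY⟩ := hN.sep (fun X => T X 0) (ε / 2) (half_pos hε)
  rw [zero_add]
  have : ∃ i, (i ∈ X ∧ i ∉ Y) ∨ (i ∈ Y ∧ i ∉ X) := by
    by_contra hcon
    push Not at hcon
    exact hne (Set.ext fun i => ⟨(hcon i).1, (hcon i).2⟩)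
  obtain ⟨i, ⟨h1, h2⟩ | ⟨h1, h2⟩⟩ := this
  · linarith [fin X Y i h1 h2]
  · have h3 := fin Y X i h1 h2
    have h4 : N (T Y 0 - T X 0) = N (T X 0 - T Y 0) := by
      rw [← neg_sub, ← neg_one_smul ℂ, hN.smul]; simp
    linarith

lemma main2 {z : A} {N : A → ℝ} (hN : D.IsN z N) {h : ℕ → A} (hb : D.IsBr h)
    (hs : ∀ n, IsSelfAdjoint (h n)) : N (h 1 - h 0) = 0 := by
  set C := (2 * ‖h 1‖ ^ 2 + 2 * ‖h 0‖ ^ 2) * nrm D.τ 1 with hC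
  have hC0 : 0 ≤ C := mul_nonneg (by positivity) (nrm_nonneg _ _)
  have key : ∀ t : ℝ, 0 < t → N (h 1 - h 0) ≤ t * C := by
    intro t ht
    have sa : ∀ n, IsSelfAdjoint ((t : ℂ) • h n) := fun n => (Complex.coe_smul t (h n)) ▸
      (IsSelfAdjoint.smul (IsSelfAdjoint.all t) (hs n))
    have h1 := main1 hN (h := fun n => (t : ℂ) • h n) ⟨fun i hi => by
      rw [map_smul, hb.1 i hi], fun n => by rw [map_smul, ← hb.2]⟩ sa
    have e : (2 * Complex.I) • ((t : ℂ) • (h 1 - h 0)) = (Ky ((t : ℂ) • h 1) - Ky ((t : ℂ) • h 0)) -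
        ((Ky ((t : ℂ) • h 1) - 1 - (2 * Complex.I) • ((t : ℂ) • h 1)) -
        (Ky ((t : ℂ) • h 0) - 1 - (2 * Complex.I) • ((t : ℂ) • h 0))) := by
      rw [smul_sub, smul_sub]; abel
    have h2 := hN.sub (Ky ((t : ℂ) • h 1) - Ky ((t : ℂ) • h 0))
        ((Ky ((t : ℂ) • h 1) - 1 - (2 * Complex.I) • ((t : ℂ) • h 1)) -
        (Ky ((t : ℂ) • h 0) - 1 - (2 * Complex.I) • ((t : ℂ) • h 0)))
    rw [← e, h1, zero_add, hN.smul, hN.smul] at h2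
    have h3 := h2.trans ((hN.le _).trans (nrm_le_norm _ _))
    have h4 := norm_sub_le (Ky ((t : ℂ) • h 1) - 1 - (2 * Complex.I) • ((t : ℂ) • h 1))
      (Ky ((t : ℂ) • h 0) - 1 - (2 * Complex.I) • ((t : ℂ) • h 0))
    have h5 := Ky_taylor (sa 1)
    have h6 := Ky_taylor (sa 0)
    have n1 : ‖(2 * Complex.I : ℂ)‖ = 2 := by norm_num
    have n2 : ‖(t : ℂ)‖ = t := by simp [abs_of_pos ht]
    rw [norm_smul, n2] at h5 h6
    rw [n1, n2] at h3
    have h7 := mul_le_mul_of_nonneg_right (h4.trans (add_le_add h5 h6)) (nrm_nonneg D.τ 1)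
    have h8 : 2 * (t * N (h 1 - h 0)) ≤ t * (t * C) := by
      refine (h3.trans h7).trans (le_of_eq ?_)
      rw [hC]; ring
    have h9 := hN.nn (h 1 - h 0)
    have h10 : t * N (h 1 - h 0) ≤ t * (t * C) := by nlinarith [mul_nonneg ht.le h9]
    exact le_of_mul_le_mul_left h10 ht
  refine le_antisymm (ge_of_tendsto (x := 𝓝[>] (0 : ℝ)) (f := fun t => t * C) ?_
    (eventually_mem_nhdsWithin.mono fun t ht => key t ht)) (hN.nn _)
  have : Tendsto (fun t : ℝ => t * C) (𝓝 0) (𝓝 (0 * C)) := (continuous_mul_const C).tendsto 0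
  rw [zero_mul] at this
  exact this.mono_left nhdsWithin_le_nhds

/-- conclusion of Part III -/
theorem partIII [Countable G] {z : A} (hz : D.IsZ z) (n : ℕ) :
    (D.x (n + 2) - D.x (n + 1)) * (1 - z) = 0 := by
  obtain ⟨N, hN⟩ := exists_N hz
  have h1 := main2 hN (h := fun n => D.x n + star (D.x n)) ⟨fun i hi => by
      rw [map_add, map_star, D.hx0 i hi], fun n => by
      rw [map_add, map_star, ← D.hx1]⟩ fun n => IsSelfAdjoint.add_star_self _
  have h2 := main2 hN (h := fun n => Complex.I • (star (D.x n) - D.x n)) ⟨fun i hi => by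
      rw [map_smul, map_sub, map_star, D.hx0 i hi], fun n => by
      rw [map_smul, map_sub, map_star, ← D.hx1]⟩ fun n => by
        rw [IsSelfAdjoint, star_smul, star_sub, star_star]
        simp [smul_sub]
        abel
  have h3 : N (D.x 1 - D.x 0) = 0 := by
    have e : D.x 1 - D.x 0 = (1 / 2 : ℂ) • (((D.x 1 + star (D.x 1)) - (D.x 0 + star (D.x 0))) +
        Complex.I • (Complex.I • (star (D.x 1) - D.x 1) - Complex.I • (star (D.x 0) - D.x 0))) := by
      simp only [smul_add, smul_sub, smul_smul]
      ring_nf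
      simp only [Complex.I_sq]
      module
    have h4 := hN.add ((D.x 1 + star (D.x 1)) - (D.x 0 + star (D.x 0)))
      (Complex.I • (Complex.I • (star (D.x 1) - D.x 1) - Complex.I • (star (D.x 0) - D.x 0)))
    rw [hN.smul, h1, h2] at h4
    rw [e, hN.smul, le_antisymm (by simpa using h4) (hN.nn _), mul_zero]
  have h4 : N (D.x (n + 1) - D.x n) = 0 := by
    induction n with
    | zero => exact h3
    | succ n ih =>
      rw [← ih, ← hN.inv (D.s (n + 2)) (D.x (n + 1) - D.x n), map_sub,
        D.isBr_x.shift (by omega), D.isBr_x.shift (by omega)]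
  have h5 := hN.zero _ h4
  rwa [map_sub, D.hα, D.hα] at h5

end BS
end setup
end TailProof

namespace TailProof
section setup
variable {A H : Type} [CStarAlgebra A] [PartialOrder A] [StarOrderedRing A]
    [NormedAddCommGroup H] [InnerProductSpace ℂ H] [CompleteSpace H]

lemma mul_le_one_comm {a b : A} (ha : 0 ≤ a) (ha1 : a ≤ 1) (hb1 : b ≤ 1)
    (h : Commute a b) : a * b ≤ 1 := by
  have h1 := nonneg_mul_of_comm ha (sub_nonneg.2 hb1) ((Commute.one_right a).sub_right h)
  have h2 := add_nonneg (sub_nonneg.2 ha1) h1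
  rw [← sub_nonneg]
  convert h2 using 1
  rw [mul_sub, mul_one]; abel

lemma min_exists {S : VNRep A H} {P : A →ₚ[ℂ] ℂ} (hP : Hcont S P) (hf : ∀ a, nrm P a = 0 → a = 0)
    {C : Set A} (hne : C.Nonempty)
    (hC : ∀ a ∈ C, ∀ b ∈ C, ∀ r s : ℝ, 0 ≤ r → 0 ≤ s → r + s = 1 → r • a + s • b ∈ C)
    (hn : ∀ a ∈ C, ‖a‖ ≤ 1) :
    ∃ (t : A) (f : ℕ → A), (∀ n, f n ∈ C) ∧ S.SC f t ∧
      ∀ c ∈ C, nrm P t ^ 2 ≤ (P (star t * c)).re := by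
  letI : InnerProductSpace ℝ P.GNS := InnerProductSpace.rclikeToReal ℂ P.GNS
  have hsm : ∀ (r : ℝ) (a : A), hat P (r • a) = r • hat P a := fun r a => by
    have e : r • a = (r : ℂ) • a := (Complex.coe_smul r a).symm
    rw [e, map_smul]; rfl
  have hconv : Convex ℝ (hat P '' C) := by
    rintro _ ⟨a, ha, rfl⟩ _ ⟨b, hb, rfl⟩ r s hr hs hrs
    refine ⟨_, hC a ha b hb r s hr hs hrs, ?_⟩
    rw [map_add, hsm, hsm]
  have hcl := hconv.closure
  obtain ⟨v, hv, hmin⟩ := exists_norm_eq_iInf_of_complete_convex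
    (hne.image (hat P)).closure isClosed_closure.isComplete hcl 0
  have hin := (norm_eq_iInf_iff_real_inner_le_zero hcl hv).1 hmin
  obtain ⟨w, hw, hwv⟩ := mem_closure_iff_seq_limit.1 hv
  choose f hfC hfw using hw
  obtain ⟨t, ht, g, hg⟩ := F3' S hP hf (b := f) (fun n => hn _ (hfC n)) (v := v)
    (by simpa only [hfw] using hwv)
  refine ⟨t, fun n => f (g n), fun n => hfC _, hg, fun c hc => ?_⟩
  have h1 := hin (hat P c) (subset_closure ⟨c, hc, rfl⟩)
  have h2 : ⟪(0 : P.GNS) - v, hat P c - v⟫_ℝ = RCLike.re ⟪(0 : P.GNS) - v, hat P c - v⟫_ℂ := rfl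
  rw [h2, ← ht, ← map_zero (hat P), ← map_sub, ← map_sub, inner_hat] at h1
  rw [nrm_sq]
  simp only [zero_sub, star_neg, neg_mul, mul_sub, map_neg, map_sub, RCLike.re_to_complex] at h1
  linarith

namespace BS
variable {S : VNRep A H} {G : Type} [Group G] {D : BS S G}

lemma x_norm (n : ℕ) : ‖D.x n‖ ≤ ‖D.x 0‖ := by
  induction n with
  | zero => exact le_rfl
  | succ n ih =>
    rw [D.hx1]
    exact (NonUnitalStarAlgHom.norm_apply_le (D.th (D.σ n)) _).trans ih

/-- the convex set -/
def CS (D : BS S G) (q : A) : Set A := {f | 0 ≤ f ∧ f ≤ 1 ∧ (D.P f).re = (D.P q).re ∧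
  ∃ N, ∀ n, N ≤ n → D.x n * f = f * D.x n ∧ ∀ m, N ≤ m → (D.x n - D.x m) * f = 0}

lemma CS_conv {q : A} : ∀ a ∈ D.CS q, ∀ b ∈ D.CS q, ∀ r s : ℝ, 0 ≤ r → 0 ≤ s → r + s = 1 →
    r • a + s • b ∈ D.CS q := by
  rintro a ⟨a0, a1, aP, N, hN⟩ b ⟨b0, b1, bP, N', hN'⟩ r s hr hs hrs
  refine ⟨add_nonneg (smul_nonneg hr a0) (smul_nonneg hs b0), ?_, ?_, max N N', fun n hn => ?_⟩
  · have : (1 : A) = r • 1 + s • 1 := by rw [← add_smul, hrs, one_smul]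
    rw [this]
    exact add_le_add (smul_le_smul_of_nonneg_left a1 hr) (smul_le_smul_of_nonneg_left b1 hs)
  · rw [map_add, Complex.add_re, re_smul, re_smul, aP, bP, ← add_mul, hrs, one_mul]
  · obtain ⟨h1, h2⟩ := hN n ((le_max_left _ _).trans hn)
    obtain ⟨h1', h2'⟩ := hN' n ((le_max_right _ _).trans hn)
    refine ⟨?_, fun m hm => ?_⟩
    · rw [mul_add, add_mul, mul_smul_comm, mul_smul_comm, smul_mul_assoc, smul_mul_assoc, h1, h1']
    · rw [mul_add, mul_smul_comm, mul_smul_comm, h2 m ((le_max_left _ _).trans hm),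
        h2' m ((le_max_right _ _).trans hm)]; simp

lemma CS_th {q f : A} (hf : f ∈ D.CS q) (k : ℕ) : D.th (D.σ k) f ∈ D.CS q := by
  obtain ⟨a0, a1, aP, N, hN⟩ := hf
  refine ⟨hom_nonneg _ a0, hom_le_one _ a1, by rw [D.thPre, aP], max N (k + 2), fun n hn => ?_⟩
  obtain ⟨h1, h2⟩ := hN n ((le_max_left _ _).trans hn)
  have e : ∀ n, max N (k + 2) ≤ n → D.th (D.σ k) (D.x n) = D.x n := fun n hn =>
    D.isBr_x.lo ((le_max_right _ _).trans hn)
  refine ⟨?_, fun m hm => ?_⟩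
  · have := congrArg (D.th (D.σ k)) h1
    rwa [map_mul, map_mul, e n hn] at this
  · have := congrArg (D.th (D.σ k)) (h2 m ((le_max_left _ _).trans hm))
    rwa [map_mul, map_sub, e n hn, e m hm, map_zero] at this

lemma exists_t {q : A} (hq : q ∈ D.CS q) : ∃ t : A, 0 ≤ t ∧ t ≤ 1 ∧ (D.P t).re = (D.P q).re ∧
    (∀ k, D.th (D.σ k) t = t) ∧ nrm D.P t ^ 2 ≤ (D.P (t * q)).re ∧
    (∀ n, D.x n * t = t * D.x n) ∧ ∀ n, (D.x (n + 1) - D.x n) * t = 0 := by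
  have hn : ∀ a ∈ D.CS q, ‖a‖ ≤ 1 := fun a ha => norm_le_of_le_one ha.1 ha.2.1
  obtain ⟨t, f, hf, hs, hmin⟩ := min_exists (S := S) D.Pc D.Pf ⟨q, hq⟩ CS_conv hn
  have hlim : Tendsto (fun n => nrm D.P (f n - t)) atTop (𝓝 0) :=
    D.Pc.tendsto S (fun n => hn _ (hf n)) hs
  have hsa : ∀ n, IsSelfAdjoint (f n) := fun n => .of_nonneg (hf n).1
  have t0 : 0 ≤ t := hs.ge_of_ge S hsa (IsSelfAdjoint.zero _) (Eventually.of_forall fun n => (hf n).1)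
  have t1 : t ≤ 1 := hs.le_of_le S hsa (IsSelfAdjoint.one _) (Eventually.of_forall fun n => (hf n).2.1)
  have tP : (D.P t).re = (D.P q).re := by
    have := re_tendsto_of_nrm hlim
    refine tendsto_nhds_unique this ?_
    simp only [(hf _).2.2.1]
    exact tendsto_const_nhds
  have tst : star t = t := (IsSelfAdjoint.of_nonneg t0).star_eq
  have hfix : ∀ k, D.th (D.σ k) t = t := by
    intro k
    have h1 : Tendsto (fun n => nrm D.P (star t * D.th (D.σ k) (f n) - star t * D.th (D.σ k) t))
        atTop (𝓝 0) := by
      refine squeeze_zero (fun _ => nrm_nonneg _ _) (fun n => ?_)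
        (by simpa using hlim.const_mul ‖star t‖)
      rw [← mul_sub, ← map_sub]
      refine (nrm_mul_le _ _ _).trans ?_
      rw [D.thP, norm_star]
    have h2 : nrm D.P t ^ 2 ≤ (D.P (star t * D.th (D.σ k) t)).re :=
      ge_of_tendsto' (re_tendsto_of_nrm h1) fun n => hmin _ (CS_th (hf n) k)
    have h3 : nrm D.P (D.th (D.σ k) t - t) ^ 2 ≤ 0 := by
      have h4 : (D.P (D.th (D.σ k) t * t)).re = (D.P (t * D.th (D.σ k) t)).re := by rw [D.Pt]
      have h5 : nrm D.P (D.th (D.σ k) t) ^ 2 = nrm D.P t ^ 2 := by rw [D.thP]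
      rw [nrm_sq, nrm_sq, ← map_star, tst] at h5
      rw [nrm_sq, tst] at h2
      rw [nrm_sq, star_sub, ← map_star, tst, sub_mul, mul_sub, mul_sub, map_sub, map_sub, map_sub,
        Complex.sub_re, Complex.sub_re, Complex.sub_re]
      linarith
    exact sub_eq_zero.1 (D.Pf _ (pow_eq_zero_iff two_ne_zero |>.1 (le_antisymm h3 (sq_nonneg _))))
  have hsh : ∀ n, D.th (D.s (n + 2)) t = t := fun n => s_fix _ fun k _ => hfix k
  refine ⟨t, t0, t1, tP, hfix, by have := hmin q hq; rwa [tst] at this, fun n => ?_, fun n => ?_⟩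
  · refine eq_of_close (D := D) fun ε hε => ?_
    have hc : ∀ k, nrm D.P (D.x (n + k) * t - t * D.x (n + k)) =
        nrm D.P (D.x n * t - t * D.x n) := by
      intro k
      induction k with
      | zero => rfl
      | succ k ih =>
        rw [← ih, ← D.thP (D.s (n + k + 2)) (D.x (n + k) * t - t * D.x (n + k)), map_sub, map_mul,
          map_mul, hsh (n + k), D.isBr_x.shift (by omega)]
        rfl
    have h2 : Tendsto (fun j => 2 * ‖D.x 0‖ * nrm D.P (f j - t)) atTop (𝓝 0) := by
      simpa using hlim.const_mul (2 * ‖D.x 0‖)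
    obtain ⟨j, hj⟩ := (h2.eventually (gt_mem_nhds hε)).exists
    obtain ⟨N, hN⟩ := (hf j).2.2.2
    rw [← hc N]
    have e : D.x (n + N) * t - t * D.x (n + N) =
        (f j - t) * D.x (n + N) - D.x (n + N) * (f j - t) := by
      rw [sub_mul, mul_sub, (hN (n + N) (by omega)).1]; abel
    rw [e]
    have h3 := nrm_sub_le D.P ((f j - t) * D.x (n + N)) (D.x (n + N) * (f j - t))
    have h4 := nrm_mul_le D.P (D.x (n + N)) (f j - t)
    have h5 := nrm_mul_le' D.Pt (f j - t) (D.x (n + N))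
    nlinarith [x_norm (D := D) (n + N), nrm_nonneg D.P (f j - t)]
  · refine eq_of_close (D := D) fun ε hε => ?_
    rw [sub_zero]
    have hc : ∀ k, nrm D.P ((D.x (n + k + 1) - D.x (n + k)) * t) =
        nrm D.P ((D.x (n + 1) - D.x n) * t) := by
      intro k
      induction k with
      | zero => rfl
      | succ k ih =>
        rw [← ih, ← D.thP (D.s (n + k + 2)) ((D.x (n + k + 1) - D.x (n + k)) * t), map_mul, map_sub,
          hsh (n + k), D.isBr_x.shift (by omega), D.isBr_x.shift (by omega)]
        rfl
    have h2 : Tendsto (fun j => 2 * ‖D.x 0‖ * nrm D.P (f j - t)) atTop (𝓝 0) := by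
      simpa using hlim.const_mul (2 * ‖D.x 0‖)
    obtain ⟨j, hj⟩ := (h2.eventually (gt_mem_nhds hε)).exists
    obtain ⟨N, hN⟩ := (hf j).2.2.2
    rw [← hc N]
    have e : (D.x (n + N + 1) - D.x (n + N)) * t =
        D.x (n + N) * (f j - t) - D.x (n + N + 1) * (f j - t) := by
      have := (hN (n + N + 1) (by omega)).2 (n + N) (by omega)
      rw [sub_mul, sub_eq_zero] at this
      rw [mul_sub, mul_sub, sub_mul, this]; abel
    rw [e]
    have h3 := nrm_sub_le D.P (D.x (n + N) * (f j - t)) (D.x (n + N + 1) * (f j - t))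
    have h4 := nrm_mul_le D.P (D.x (n + N)) (f j - t)
    have h5 := nrm_mul_le D.P (D.x (n + N + 1)) (f j - t)
    nlinarith [x_norm (D := D) (n + N), x_norm (D := D) (n + N + 1), nrm_nonneg D.P (f j - t)]

lemma central_t {t : A} (t0 : 0 ≤ t) (hc : ∀ n, D.x n * t = t * D.x n) (a : A) : a * t = t * a := by
  have tst : star t = t := (IsSelfAdjoint.of_nonneg t0).star_eq
  have hB : ∀ m, ∀ b ∈ D.B 0 m, b * t = t * b := by
    intro m b hb
    have : D.B 0 m ≤ StarSubalgebra.centralizer ℂ {t} := by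
      refine StarAlgebra.adjoin_le ?_
      rintro y ⟨n, -, -, rfl⟩
      refine (StarSubalgebra.mem_centralizer_iff ℂ).2 ?_
      rintro g rfl
      rw [tst]
      exact ⟨(hc n).symm, (hc n).symm⟩
    exact (((StarSubalgebra.mem_centralizer_iff ℂ).1 (this hb)) t rfl).1.symm
  refine eq_of_close (D := D) fun ε hε => ?_
  have hp : 0 < 2 * ‖t‖ + 1 := by positivity
  obtain ⟨m, b, hb, h1⟩ := dens0 (D := D) a (div_pos hε hp)
  rw [lt_div_iff₀ hp] at h1
  have e : a * t - t * a = (a - b) * t - t * (a - b) := by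
    rw [sub_mul, mul_sub, hB m b hb]; abel
  rw [e]
  have h3 := nrm_sub_le D.P ((a - b) * t) (t * (a - b))
  have h4 := nrm_mul_le D.P t (a - b)
  have h5 := nrm_mul_le' D.Pt (a - b) t
  nlinarith [nrm_nonneg D.P (a - b)]

theorem z_eq_one [Countable G] {z : A} (hz : D.IsZ z) : z = 1 := by
  have zst : star z = z := (IsSelfAdjoint.of_nonneg hz.h0).star_eq
  set q : A := 1 - z with hq
  have q0 : 0 ≤ q := sub_nonneg.2 hz.h1
  have q1 : q ≤ 1 := sub_le_self _ hz.h0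
  have hdif : ∀ k, (D.x (k + 1) - D.x 1) * q = 0 := by
    intro k
    induction k with
    | zero => simp
    | succ k ih =>
      have := partIII hz k
      have e : D.x (k + 1 + 1) - D.x 1 = (D.x (k + 2) - D.x (k + 1)) + (D.x (k + 1) - D.x 1) := by
        rw [show k + 1 + 1 = k + 2 from rfl]; abel
      rw [e, add_mul, ih, this, add_zero]
  have hqC : q ∈ D.CS q := by
    refine ⟨q0, q1, rfl, 1, fun n hn => ⟨?_, fun m hm => ?_⟩⟩
    · obtain ⟨k, rfl⟩ := Nat.exists_eq_add_of_le' hn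
      rw [← D.hα, hq, mul_sub, sub_mul, hz.comm, mul_one, one_mul]
    · obtain ⟨k, rfl⟩ := Nat.exists_eq_add_of_le' hn
      obtain ⟨l, rfl⟩ := Nat.exists_eq_add_of_le' hm
      have e : D.x (k + 1) - D.x (l + 1) = (D.x (k + 1) - D.x 1) - (D.x (l + 1) - D.x 1) := by abel
      rw [e, sub_mul, hdif, hdif, sub_zero]
  obtain ⟨t, t0, t1, tP, tfix, tq, tc, td⟩ := exists_t hqC
  have tst : star t = t := (IsSelfAdjoint.of_nonneg t0).star_eq
  have cen := central_t t0 tc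
  have hαt : ∀ m, ∀ b ∈ D.B 0 m, t * D.α b = t * b := by
    intro m b hb
    induction hb using StarAlgebra.adjoin_induction with
    | mem y hy =>
      obtain ⟨n, -, -, rfl⟩ := hy
      have := td n
      rw [sub_mul, sub_eq_zero, cen, cen] at this
      rw [D.hα, this]
    | algebraMap r => rw [AlgHomClass.commutes]
    | add a b _ _ h1 h2 => rw [map_add, mul_add, mul_add, h1, h2]
    | mul a b _ _ h1 h2 =>
      rw [map_mul, ← mul_assoc, h1, ← cen a, mul_assoc, h2, ← mul_assoc, cen a, mul_assoc]
    | star a _ h =>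
      have := congrArg star h
      rw [star_mul, star_mul, tst, ← map_star, cen, cen] at this
      exact this
  have nz := norm_le_of_le_one hz.h0 hz.h1
  have nt := norm_le_of_le_one t0 t1
  have key : ∀ a, D.α a * z * t = a * z * t := by
    intro a
    refine eq_of_close (D := D) fun ε hε => ?_
    obtain ⟨m, b, hb, h1⟩ := dens0 (D := D) a (half_pos hε)
    have e : D.α a * z * t - a * z * t = D.α (a - b) * z * t - (a - b) * (z * t) := by
      have h2 : D.α b * z * t = b * z * t := by
        rw [cen, cen, ← mul_assoc, ← mul_assoc, hαt m b hb]
      rw [map_sub, sub_mul, sub_mul, sub_mul, h2, mul_assoc, mul_assoc, mul_assoc]; abel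
    rw [e]
    have h3 := nrm_sub_le D.P (D.α (a - b) * z * t) ((a - b) * (z * t))
    have h4 := nrm_mul_le' D.Pt (D.α (a - b) * z) t
    have h5 := nrm_mul_le' D.Pt (a - b) (z * t)
    have h6 : ‖z * t‖ ≤ 1 := (norm_mul_le _ _).trans (by nlinarith [norm_nonneg z, norm_nonneg t])
    have h7 := hz.le (a - b)
    have h8 := nrm_nonneg D.P (D.α (a - b) * z)
    nlinarith [nrm_nonneg D.P (a - b)]
  have huq : ∀ k, t * D.u k * q = 0 := by
    intro k
    set y := t * D.u k with hy
    have cu : Commute t (D.u k) := (cen _).symm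
    have y0 : 0 ≤ y := nonneg_mul_of_comm t0 (D.u0 k) cu
    have y1 : y ≤ 1 := mul_le_one_comm t0 t1 (D.u1 k) cu
    have h1 := hz.j y (D.ideal_left (D.uz k) t)
    have h2 : D.α y = y * z := by
      have k1 := key (D.u k)
      rw [← h1, hy, cu.eq, map_mul, mul_assoc, hz.fix tfix, ← cen z, ← mul_assoc, k1, mul_assoc,
        mul_assoc, cen z]
    have h3 : y * z = z * y := by
      have := (IsSelfAdjoint.of_nonneg (hom_nonneg D.α y0)).star_eq
      rw [h2, star_mul, zst, (IsSelfAdjoint.of_nonneg y0).star_eq] at this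
      exact this.symm
    have hcq : Commute y q := (Commute.one_right y).sub_right h3
    have g0 := nonneg_mul_of_comm y0 q0 hcq
    have g1 := mul_le_one_comm y0 y1 q1 hcq
    have e : y * q = y - D.α y := by rw [h2, hq, mul_sub, mul_one]
    have h4 : D.τ (y * q) = 0 := by rw [e, map_sub, D.ατ, sub_self]
    rw [D.hτ] at h4
    have h5 := congrArg Complex.re h4
    rw [Complex.add_re, Complex.zero_re] at h5
    have h6 := re_nonneg D.P g0
    have h7 := re_nonneg D.Ps g0
    have h8 := nrm_sq_le_of_le_one D.P g0 g1
    exact D.Pf _ (pow_eq_zero_iff two_ne_zero |>.1 (le_antisymm (by linarith) (sq_nonneg _)))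
  have htq : t * q = 0 := by
    have h1 := (D.us.mul_left S t).mul_right S q
    simp only [huq, mul_one] at h1
    exact h1.unique S (VNRep.SC.const S 0)
  rw [htq, map_zero, Complex.zero_re] at tq
  have ht : t = 0 := D.Pf _ (pow_eq_zero_iff two_ne_zero |>.1 (le_antisymm tq (sq_nonneg _)))
  rw [ht, map_zero, Complex.zero_re] at tP
  have h8 := nrm_sq_le_of_le_one D.P q0 q1
  have : q = 0 := D.Pf _ (pow_eq_zero_iff two_ne_zero |>.1 (le_antisymm (by linarith) (sq_nonneg _)))
  exact (sub_eq_zero.1 this).symm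

theorem star_ineq (D : BS S G) [Countable G] (a : A) : nrm D.P (D.α a) ≤ nrm D.P a := by
  obtain ⟨z, hz⟩ := D.exists_z
  have := hz.le a
  rwa [z_eq_one hz, mul_one] at this

end BS
end setup
end TailProof

namespace TailProof
section setup
variable {A H : Type} [CStarAlgebra A] [PartialOrder A] [StarOrderedRing A]
    [NormedAddCommGroup H] [InnerProductSpace ℂ H] [CompleteSpace H]

theorem abstract_main (S : VNRep A H) (τ : A → ℂ)
    (hlin : IsLinearMap ℂ τ)
    (hpos : ∀ a, 0 ≤ (τ (star a * a)).re ∧ (τ (star a * a)).im = 0)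
    (hfaithful : ∀ a, τ (star a * a) = 0 → a = 0)
    (htracial : ∀ a b, τ (a * b) = τ (b * a))
    {G : Type} [Group G] [Countable G] (ρ : G →* (A ≃ₐ[ℂ] A))
    (hρstar : ∀ g a, ρ g (star a) = star (ρ g a))
    (hρτ : ∀ g a, τ (ρ g a) = τ a)
    (σ : ℕ → G) (br : ∀ i, σ i * σ (i + 1) * σ i = σ (i + 1) * σ i * σ (i + 1))
    (cm : ∀ i j, i + 1 < j → σ i * σ j = σ j * σ i)
    (x : ℕ → A) (hx0 : ∀ i, 1 ≤ i → ρ (σ i) (x 0) = x 0)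
    (hx1 : ∀ n, x (n + 1) = ρ (σ n) (x n))
    (hgen : ∀ a, InVN S {y | ∃ n, y = x n ∨ y = star (x n)} a)
    (α : A →⋆ₐ[ℂ] A) (hατ : ∀ a, τ (α a) = τ a) (hshift : ∀ n, α (x n) = x (n + 1)) (a : A) :
    ((∀ N, InVN S {y | ∃ n, y = x (N + n) ∨ y = star (x (N + n))} a) ↔ ∀ k, ρ (σ k) a = a) ∧
    ((∀ k, ρ (σ k) a = a) ↔ α a = a) := by
  let τ' : A →ₚ[ℂ] ℂ := PositiveLinearMap.mk₀ (IsLinearMap.mk' τ hlin) fun b hb => by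
    obtain ⟨c, rfl⟩ := CStarAlgebra.nonneg_iff_eq_star_mul_self.1 hb
    rw [Complex.nonneg_iff]
    exact ⟨(hpos c).1, (hpos c).2.symm⟩
  have hτ' : ∀ b, τ' b = τ b := fun _ => rfl
  obtain ⟨P, Ps, Pt, Pst, hτ, Pc, Pf, u, um, u0, u1, uz, us⟩ := partI S τ'
    (fun b c => htracial b c) fun b hb => by
      refine hfaithful b (Complex.ext ?_ (hpos b).2)
      have := nrm_sq τ' b
      rw [hb, hτ'] at this
      simpa using this.symm
  let D : BS S G :=
    { P := P, Ps := Ps, τ := τ', hτ := hτ, Pt := Pt, Pst := Pst, Pc := Pc, Pf := Pf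
      u := u, um := um, u0 := u0, u1 := u1, uz := uz, us := us
      th := fun g => { (ρ g : A →ₐ[ℂ] A) with map_star' := hρstar g }
      th1 := fun a => by
        show ρ 1 a = a
        rw [map_one]; rfl
      thm := fun g h a => by
        show ρ (g * h) a = ρ g (ρ h a)
        rw [map_mul]; rfl
      thτ := fun g a => hρτ g a
      σ := σ, br := br, cm := cm, x := x, hx0 := hx0, hx1 := hx1, hgen := hgen, α := α
      ατ := hατ, hα := hshift }
  have hs := D.star_ineq
  exact ⟨⟨fun h => BS.tail_fix (D := D) h, fun h => BS.fix_tail (D := D) h⟩,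
    ⟨fun h => BS.fix_α (D := D) hs h, fun h => BS.α_fix (D := D) hs h⟩⟩

end setup
end TailProof

namespace TailProof
lemma braid_br (i : ℕ) : braidGen i.succPNat * braidGen (i + 1).succPNat * braidGen i.succPNat =
    braidGen (i + 1).succPNat * braidGen i.succPNat * braidGen (i + 1).succPNat := by
  have : (FreeGroup.of i.succPNat * .of (i + 1).succPNat * .of i.succPNat *
      (.of (i + 1).succPNat * .of i.succPNat * .of (i + 1).succPNat)⁻¹) ∈ braidRels :=
    Or.inl ⟨_, _, by simp, rfl⟩
  have h := PresentedGroup.one_of_mem this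
  rw [map_mul, map_inv, mul_inv_eq_one] at h
  simp only [map_mul] at h
  exact h

lemma braid_cm (i j : ℕ) (hij : i + 1 < j) : braidGen i.succPNat * braidGen j.succPNat =
    braidGen j.succPNat * braidGen i.succPNat := by
  have : (FreeGroup.of i.succPNat * .of j.succPNat *
      (.of j.succPNat * .of i.succPNat)⁻¹) ∈ braidRels :=
    Or.inr ⟨_, _, by simp only [Nat.succPNat_coe, Nat.succ_eq_add_one]; omega, rfl⟩
  have h := PresentedGroup.one_of_mem this
  rw [map_mul, map_inv, mul_inv_eq_one] at h
  simp only [map_mul] at h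
  exact h

lemma braid_countable : Countable BraidGroup := by
  haveI : Countable (FreeGroup ℕ+) :=
    (Quot.mk_surjective (r := FreeGroup.Red.Step (α := ℕ+))).countable
  exact (PresentedGroup.mk_surjective braidRels).countable

lemma braid_fix {X : Type} (ρ : BraidGroup →* Equiv.Perm X) (a : X)
    (h : ∀ k : ℕ, ρ (braidGen k.succPNat) a = a) (g : BraidGroup) : ρ g a = a := by
  have hs : (⊤ : Subgroup BraidGroup) ≤ (MulAction.stabilizer (Equiv.Perm X) a).comap ρ := by
    rw [← PresentedGroup.closure_range_of braidRels, Subgroup.closure_le]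
    rintro _ ⟨i, rfl⟩
    have := h i.natPred
    rw [PNat.succPNat_natPred] at this
    exact this
  exact hs (Subgroup.mem_top g)

section
variable {H : Type} [NormedAddCommGroup H] [InnerProductSpace ℂ H] [CompleteSpace H]

lemma vN_closed (M : VonNeumannAlgebra H) : IsClosed (M.toStarSubalgebra : Set (H →L[ℂ] H)) := by
  have : (M.toStarSubalgebra : Set (H →L[ℂ] H)) =
      Set.centralizer (Set.centralizer (M : Set (H →L[ℂ] H))) := by simp
  rw [this]
  exact Set.isClosed_centralizer _

lemma vN_mem (M : VonNeumannAlgebra H) {T : H →L[ℂ] H}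
    (h : ∀ R ∈ M.commutant, R * T = T * R) : T ∈ M.toStarSubalgebra := by
  have : T ∈ M.commutant.commutant := VonNeumannAlgebra.mem_commutant_iff.2 h
  rwa [VonNeumannAlgebra.commutant_commutant] at this

lemma vN_lim (M : VonNeumannAlgebra H) (a : ℕ → M.toStarSubalgebra)
    (C : ℝ) (hC : ∀ n, ‖(a n : H →L[ℂ] H)‖ ≤ C)
    (h : ∀ ξ : H, ∃ η, Tendsto (fun n => (a n : H →L[ℂ] H) ξ) atTop (𝓝 η)) :
    ∃ b : M.toStarSubalgebra, ∀ ξ : H,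
      Tendsto (fun n => (a n : H →L[ℂ] H) ξ) atTop (𝓝 ((b : H →L[ℂ] H) ξ)) := by
  choose f hf using h
  let T : H →L[ℂ] H := LinearMap.mkContinuous
    { toFun := f
      map_add' := fun v w => tendsto_nhds_unique (hf (v + w))
        (by simpa using (hf v).add (hf w))
      map_smul' := fun c v => tendsto_nhds_unique (hf (c • v))
        (by simpa using (hf v).const_smul c) } C fun v =>
      le_of_tendsto (hf v).norm (Eventually.of_forall fun n => (a n : H →L[ℂ] H).le_of_opNorm_le (hC n) v)
  have hT : ∀ v, T v = f v := fun _ => rfl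
  refine ⟨⟨T, vN_mem M fun R hR => ?_⟩, fun ξ => hf ξ⟩
  ext v
  show R (T v) = T (R v)
  rw [hT, hT]
  refine tendsto_nhds_unique ((R.continuous.tendsto _).comp (hf v)) ?_
  refine (hf (R v)).congr fun n => ?_
  have h1 := VonNeumannAlgebra.mem_commutant_iff.1 hR (a n) (a n).2
  exact congrArg (fun Q : H →L[ℂ] H => Q v) h1

lemma genVN_eq (M : VonNeumannAlgebra H) (y : ℕ → M.toStarSubalgebra) :
    genVN (Set.range fun n => (y n : H →L[ℂ] H)) = Set.centralizer (Set.centralizer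
      ((fun b : M.toStarSubalgebra => (b : H →L[ℂ] H)) '' {w | ∃ n, w = y n ∨ w = star (y n)})) := by
  unfold genVN
  congr 2
  ext w
  constructor
  · rintro (⟨n, rfl⟩ | ⟨_, ⟨n, rfl⟩, rfl⟩)
    · exact ⟨y n, ⟨n, Or.inl rfl⟩, rfl⟩
    · exact ⟨star (y n), ⟨n, Or.inr rfl⟩, rfl⟩
  · rintro ⟨_, ⟨n, rfl | rfl⟩, rfl⟩
    · exact Or.inl ⟨n, rfl⟩
    · exact Or.inr ⟨_, ⟨n, rfl⟩, rfl⟩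
end
end TailProof

/-- For a braidable sequence `(xₙ)` generating a tracial probability space `(A, τ)`
via a representation `ρ : B∞ → Aut(A, τ)`, the tail algebra of `(xₙ)`, the fixed
point algebra of `ρ(B∞)` and the fixed point algebra of the shift `α` (with
`α(xₙ) = x_{n+1}`) all coincide. -/
theorem tail_eq_fixed_points_braidable
    {H : Type} [NormedAddCommGroup H] [InnerProductSpace ℂ H] [CompleteSpace H]
    (M : VonNeumannAlgebra H) (τ : M.toStarSubalgebra → ℂ)
    (hlin : IsLinearMap ℂ τ) (hτ1 : τ 1 = 1)
    (hpos : ∀ a, 0 ≤ (τ (star a * a)).re ∧ (τ (star a * a)).im = 0)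
    (hfaithful : ∀ a, τ (star a * a) = 0 → a = 0)
    (htracial : ∀ a b, τ (a * b) = τ (b * a))
    (ρ : BraidGroup →* (M.toStarSubalgebra ≃ₐ[ℂ] M.toStarSubalgebra))
    (hρstar : ∀ g a, ρ g (star a) = star (ρ g a))
    (hρτ : ∀ g a, τ (ρ g a) = τ a)
    (x₀ : M.toStarSubalgebra) (hloc : ∀ i : ℕ+, 2 ≤ (i : ℕ) → ρ (braidGen i) x₀ = x₀)
    (x : ℕ → M.toStarSubalgebra) (hx : ∀ n, x n = ρ (descWord n) x₀)
    (hgen : genVN (Set.range fun n => (x n : H →L[ℂ] H)) = (M : Set (H →L[ℂ] H)))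
    (α : M.toStarSubalgebra →⋆ₐ[ℂ] M.toStarSubalgebra)
    (hατ : ∀ a, τ (α a) = τ a)
    (hshift : ∀ n, α (x n) = x (n + 1)) :
    ∀ a : M.toStarSubalgebra,
      ((∀ n : ℕ, (a : H →L[ℂ] H) ∈ genVN (Set.range fun k => (x (n + k) : H →L[ℂ] H))) ↔
        (∀ g : BraidGroup, ρ g a = a)) ∧
      ((∀ g : BraidGroup, ρ g a = a) ↔ α a = a) := by
  haveI hcl : IsClosed (M.toStarSubalgebra : Set (H →L[ℂ] H)) := TailProof.vN_closed M
  letI : CStarAlgebra M.toStarSubalgebra := StarSubalgebra.cstarAlgebra M.toStarSubalgebra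
  letI : PartialOrder M.toStarSubalgebra := CStarAlgebra.spectralOrder _
  haveI : StarOrderedRing M.toStarSubalgebra := CStarAlgebra.spectralOrderedRing _
  haveI := TailProof.braid_countable
  let S : TailProof.VNRep M.toStarSubalgebra H :=
    { π := M.toStarSubalgebra.subtype
      inj := Subtype.coe_injective
      closed := fun a C hC h => TailProof.vN_lim M a C hC h }
  intro a
  have h0 : x 0 = x₀ := by rw [hx, descWord, map_one]; rfl
  obtain ⟨h1, h2⟩ := TailProof.abstract_main S τ hlin hpos hfaithful htracial ρ hρstar hρτ
    (fun k => braidGen k.succPNat) TailProof.braid_br TailProof.braid_cm x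
    (fun i hi => by
      rw [h0]
      exact hloc _ (by simp only [Nat.succPNat_coe, Nat.succ_eq_add_one]; omega))
    (fun n => by rw [hx, hx n, descWord, map_mul]; rfl)
    (fun b => by
      have hb : (b : H →L[ℂ] H) ∈ genVN (Set.range fun n => (x n : H →L[ℂ] H)) := by
        rw [hgen]; exact b.2
      rw [TailProof.genVN_eq] at hb
      exact hb)
    α hατ hshift a
  have h3 : (∀ g : BraidGroup, ρ g a = a) ↔ ∀ k : ℕ, ρ (braidGen k.succPNat) a = a :=
    ⟨fun h k => h _, fun h g => TailProof.braid_fix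
      ((MulAction.toPermHom (M.toStarSubalgebra ≃ₐ[ℂ] M.toStarSubalgebra) M.toStarSubalgebra).comp ρ)
      a h g⟩
  have h4 : (∀ n : ℕ, (a : H →L[ℂ] H) ∈ genVN (Set.range fun k => (x (n + k) : H →L[ℂ] H))) ↔
      ∀ N, TailProof.InVN S {y | ∃ n, y = x (N + n) ∨ y = star (x (N + n))} a := by
    refine forall_congr' fun N => ?_
    rw [TailProof.genVN_eq M fun k => x (N + k)]
    rfl
  rw [h3, h4]
  exact ⟨h1, h2⟩
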